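/- Suppose d ∈ {1, 2} and α = d/3. Then the susceptibility is mean-field to within a polylogarithmic factor near criticality: there are constants C₁ < ∞ and ε₀ > 0 (depending only on d, α, c, C) such that C₁^{−1} (log(1/ε))^{−2} ε^{−1} ≤ 𝔼_{β_c−ε}|K| ≤ C₁ (log(1/ε))^{2} ε^{−1} for every 0 < ε < ε₀. -/

import Mathlib

open MeasureTheory ENNReal

namespace LRP

/-- The vertex set `ℤ^d`. -/
abbrev V (d : ℕ) : Type := Fin d → ℤ

/-- The `ℓ^∞` norm of a lattice point, as a natural number. -/
def normInf {d : ℕ} (x : V d) : ℕ := Finset.univ.sup fun i => (x i).natAbs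

/-- A percolation configuration: each (unordered) pair of vertices is open or closed. -/
abbrev Config (d : ℕ) : Type := Sym2 (V d) → Bool

/-- The probability `1 - exp (-β J(x,y))` that the edge `e = {x,y}` is open
(the symmetrization `(J x y + J y x)/2` equals `J x y` for symmetric `J`). -/
noncomputable def edgeProb {d : ℕ} (J : V d → V d → ℝ) (β : ℝ) (e : Sym2 (V d)) : ℝ≥0∞ :=
  ENNReal.ofReal (1 - Real.exp (-β *
    Sym2.lift ⟨fun x y => (J x y + J y x) / 2, fun x y => by dsimp only; rw [add_comm]⟩ e))

/-- `IsLRP J P` asserts that for each `β`, `P β` is the law of long-range percolation on `ℤ^d`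
with kernel `J` at inverse temperature `β`: distinct edges are open independently, edge `{x,y}`
being open with probability `1 - exp (-β J(x,y))`.  This is expressed by prescribing the
probability of every finite cylinder event, which characterizes the measure uniquely. -/
def IsLRP {d : ℕ} (J : V d → V d → ℝ) (P : ℝ → Measure (Config d)) : Prop :=
  ∀ (β : ℝ) (s : Finset (Sym2 (V d))) (f : Sym2 (V d) → Bool),
    P β {ω | ∀ e ∈ s, ω e = f e} =
      ∏ e ∈ s, (if f e then edgeProb J β e else 1 - edgeProb J β e)

/-- Two vertices are adjacent if they are distinct and the edge between them is open. -/
def adj {d : ℕ} (ω : Config d) (x y : V d) : Prop := x ≠ y ∧ ω s(x, y) = true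

/-- `x ↔ y`: the vertices are connected by a path of open edges. -/
def conn {d : ℕ} (ω : Config d) (x y : V d) : Prop := Relation.ReflTransGen (adj ω) x y

/-- `x ↔ y` inside `A`: connected by an open path all of whose vertices lie in `A`. -/
def connIn {d : ℕ} (ω : Config d) (A : Set (V d)) (x y : V d) : Prop :=
  x ∈ A ∧ y ∈ A ∧ Relation.ReflTransGen (fun a b => a ∈ A ∧ b ∈ A ∧ adj ω a b) x y

/-- The cluster of `x`. -/
def cluster {d : ℕ} (ω : Config d) (x : V d) : Set (V d) := {y | conn ω x y}

/-- The critical point `β_c`. -/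
noncomputable def betaC {d : ℕ} (P : ℝ → Measure (Config d)) : ℝ :=
  sInf {β : ℝ | 0 ≤ β ∧ 0 < P β {ω | ∃ x, (cluster ω x).Infinite}}

/-- The two-point function `ℙ_β(x ↔ y)`. -/
noncomputable def twoPoint {d : ℕ} (P : ℝ → Measure (Config d)) (β : ℝ) (x y : V d) : ℝ≥0∞ :=
  P β {ω | conn ω x y}

/-- The susceptibility `χ(β) = Σ_x ℙ_β(0 ↔ x)`. -/
noncomputable def chi {d : ℕ} (P : ℝ → Measure (Config d)) (β : ℝ) : ℝ≥0∞ :=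
  ∑' x : V d, twoPoint P β 0 x

/-- `Σ_{x ∈ [-n,n]^d} ℙ_β(0 ↔ x)`. -/
noncomputable def boxSum {d : ℕ} (P : ℝ → Measure (Config d)) (β : ℝ) (n : ℕ) : ℝ≥0∞ :=
  ∑' x : V d, if normInf x ≤ n then twoPoint P β 0 x else 0

/-- The correlation length `ξ(β) = inf {r ≥ 1 : Σ_{x ∈ [-r,r]^d} ℙ_β(0↔x) ≥ χ(β)/2}`
(`= ∞` if no such `r` exists). -/
noncomputable def xi {d : ℕ} (P : ℝ → Measure (Config d)) (β : ℝ) : ℝ≥0∞ :=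
  sInf {r : ℝ≥0∞ | ∃ n : ℕ, r = (n : ℝ≥0∞) ∧ 1 ≤ n ∧ chi P β ≤ 2 * boxSum P β n}

/-- The triangle diagram `∇_β`. -/
noncomputable def triangle {d : ℕ} (P : ℝ → Measure (Config d)) (β : ℝ) : ℝ≥0∞ :=
  ∑' x : V d, ∑' y : V d, twoPoint P β 0 x * twoPoint P β x y * twoPoint P β y 0

/-- The standing assumptions on the kernel `J`: symmetric, integrable, translation-invariant,
with `c ‖x-y‖^{-d-α} ≤ J(x,y) ≤ C ‖x-y‖^{-d-α}` for distinct `x, y`, where `0 < α < d`. -/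
structure KernelHyp (d : ℕ) (J : V d → V d → ℝ) (α c C : ℝ) : Prop where
  d_pos : 1 ≤ d
  symm : ∀ x y, J x y = J y x
  transInv : ∀ x y z : V d, J (x + z) (y + z) = J x y
  nonneg : ∀ x y, 0 ≤ J x y
  integrable : Summable fun x : V d => J 0 x
  alpha_pos : 0 < α
  alpha_lt_d : α < (d : ℝ)
  c_pos : 0 < c
  c_le_C : c ≤ C
  lower : ∀ x y : V d, x ≠ y → c * (normInf (x - y) : ℝ) ^ (-(d : ℝ) - α) ≤ J x y
  upper : ∀ x y : V d, x ≠ y → J x y ≤ C * (normInf (x - y) : ℝ) ^ (-(d : ℝ) - α)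

local notation "oR" => ENNReal.ofReal
abbrev FV (d : ℕ) := Finset (V d)
abbrev SV (d : ℕ) := Set (V d)
section Part1
section Base
variable {ι : Type*}
def Det (S : Set ι) (A : Set (ι → Bool)) : Prop :=
  ∀ ω ω' : ι → Bool, (∀ e ∈ S, ω e = ω' e) → (ω ∈ A ↔ ω' ∈ A)
def IsBer (p : ι → ℝ) (μ : Measure (ι → Bool)) : Prop :=
  (∀ e, 0 ≤ p e ∧ p e ≤ 1) ∧ ∀ (s : Finset ι) (f : ι → Bool), μ {ω | ∀ e ∈ s, ω e = f e} =
    oR (∏ e ∈ s, (if f e then p e else 1 - p e))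
theorem IsBer.prob {p : ι → ℝ} {μ : Measure (ι → Bool)} (h : IsBer p μ) :
    IsProbabilityMeasure μ := by
  constructor
  have := h.2 ∅ (fun _ => true)
  simpa using this
theorem IsBer.cyl {p : ι → ℝ} {μ : Measure (ι → Bool)} (h : IsBer p μ) (s : Finset ι) :
    μ {ω | ∀ e ∈ s, ω e = true} = ∏ e ∈ s, oR (p e) := by
  have := h.2 s (fun _ => true)
  rw [this, ENNReal.ofReal_prod_of_nonneg]
  · simp
  · intro i _; simpa using (h.1 i).1
theorem IsBer.iIndep {p : ι → ℝ} {μ : Measure (ι → Bool)} (h : IsBer p μ) :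
    ProbabilityTheory.iIndep (fun e : ι => MeasurableSpace.comap (fun ω : ι → Bool => ω e) ⊤) μ := by
  have hp := h.prob
  refine ProbabilityTheory.iIndepSets.iIndep (m := fun e : ι => MeasurableSpace.comap (fun ω : ι → Bool => ω e) ⊤)
    (fun e => ?_) (fun e => {{ω | ω e = true}}) (fun e => ?_) (fun e => ?_) ?_
  · exact (measurable_pi_apply e).comap_le
  · exact IsPiSystem.singleton _
  · apply le_antisymm
    · rw [MeasurableSpace.comap_le_iff_le_map]
      have : ∀ t : Set Bool, MeasurableSet[MeasurableSpace.generateFrom {{ω : ι → Bool | ω e = true}}] ((fun ω : ι → Bool => ω e) ⁻¹' t) := by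
        intro t
        have h1 : MeasurableSet[MeasurableSpace.generateFrom {{ω : ι → Bool | ω e = true}}] {ω : ι → Bool | ω e = true} :=
          MeasurableSpace.measurableSet_generateFrom rfl
        have h2 := h1.compl
        by_cases ht : true ∈ t <;> by_cases hf : false ∈ t
        · convert MeasurableSet.univ
          ext ω; simp; cases ω e <;> assumption
        · convert h1 using 1
          ext ω; simp; cases ω e <;> simp [ht, hf]
        · convert h2 using 1
          ext ω; simp; cases ω e <;> simp [ht, hf]
        · convert MeasurableSet.empty
          ext ω; simp; cases ω e <;> assumption
      intro t _
      exact this t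
    · apply MeasurableSpace.generateFrom_le
      rintro t rfl
      exact ⟨{true}, trivial, by ext; simp⟩
  · rw [ProbabilityTheory.iIndepSets_iff]
    intro s f hf
    have e1 : (⋂ i ∈ s, f i) = {ω | ∀ e ∈ s, ω e = true} := by
      ext ω; simp only [Set.mem_iInter, Set.mem_ofPred_eq]
      refine forall₂_congr fun i hi => ?_
      rw [Set.mem_singleton_iff.1 (hf i hi)]; rfl
    rw [e1, h.cyl]
    refine Finset.prod_congr rfl fun i hi => ?_
    rw [Set.mem_singleton_iff.1 (hf i hi)]
    simpa using (h.cyl {i}).symm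
theorem IsBer.indep {p : ι → ℝ} {μ : Measure (ι → Bool)} (h : IsBer p μ) {S T : Set ι}
    {A B : Set (ι → Bool)} (hA : MeasurableSet A) (hB : MeasurableSet B)
    (dA : Det S A) (dB : Det T B) (hST : Disjoint S T) : μ (A ∩ B) = μ A * μ B := by
  classical
  have key := ProbabilityTheory.indep_iSup_of_disjoint
    (m := fun e : ι => MeasurableSpace.comap (fun ω : ι → Bool => ω e) ⊤)
    (fun e => (measurable_pi_apply e).comap_le) h.iIndep hST
  have aux : ∀ (S : Set ι) (A : Set (ι → Bool)), MeasurableSet A → Det S A →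
      MeasurableSet[⨆ i ∈ S, MeasurableSpace.comap (fun ω : ι → Bool => ω i) ⊤] A := by
    intro S A hA dA
    have e1 : A = (fun ω : ι → Bool => fun e => if e ∈ S then ω e else false) ⁻¹' A := by
      ext ω
      rw [Set.mem_preimage]
      apply dA
      intro e he; simp [he]
    rw [e1]
    have hm : @Measurable _ _ (⨆ i ∈ S, MeasurableSpace.comap (fun ω : ι → Bool => ω i) ⊤) _
        (fun ω : ι → Bool => fun e => if e ∈ S then ω e else false) := ?_
    · exact hm hA
    refine @measurable_pi_lambda _ _ _ (⨆ i ∈ S, MeasurableSpace.comap (fun ω : ι → Bool => ω i) ⊤) _ _ fun e => ?_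
    by_cases he : e ∈ S
    · simp only [he, if_true]
      intro t ht
      exact (le_iSup₂ (f := fun i (_ : i ∈ S) => MeasurableSpace.comap (fun ω : ι → Bool => ω i) ⊤) e he) _ ⟨t, trivial, rfl⟩
    · simp only [he, if_false]
      exact measurable_const
  exact ProbabilityTheory.Indep_iff _ _ _ |>.1 key A B (aux S A hA dA) (aux T B hB dB)
theorem IsBer.unique {p : ι → ℝ} {μ ν : Measure (ι → Bool)} (h : IsBer p μ) (h' : IsBer p ν) :
    μ = ν := by
  have := h.prob
  have := h'.prob
  refine MeasureTheory.ext_of_generate_finite {A | ∃ s : Finset ι, A = {ω | ∀ e ∈ s, ω e = true}}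
    ?_ ?_ ?_ ?_
  · apply le_antisymm
    · apply iSup_le
      intro e
      rw [MeasurableSpace.comap_le_iff_le_map]
      intro t _
      have h1 : MeasurableSet[MeasurableSpace.generateFrom {A | ∃ s : Finset ι, A = {ω : ι → Bool | ∀ e ∈ s, ω e = true}}] {ω : ι → Bool | ω e = true} :=
          MeasurableSpace.measurableSet_generateFrom ⟨{e}, by simp⟩
      have h2 := h1.compl
      change MeasurableSet[MeasurableSpace.generateFrom _] ((fun ω : ι → Bool => ω e) ⁻¹' t)
      by_cases ht : true ∈ t <;> by_cases hf : false ∈ t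
      · convert MeasurableSet.univ
        ext ω; simp; cases ω e <;> assumption
      · convert h1 using 1
        ext ω; simp; cases ω e <;> simp [ht, hf]
      · convert h2 using 1
        ext ω; simp; cases ω e <;> simp [ht, hf]
      · convert MeasurableSet.empty
        ext ω; simp; cases ω e <;> assumption
    · apply MeasurableSpace.generateFrom_le
      rintro t ⟨s, rfl⟩
      have : {ω : ι → Bool | ∀ e ∈ s, ω e = true} = ⋂ e ∈ s, {ω | ω e = true} := by ext; simp
      rw [this]
      exact Finset.measurableSet_biInter _ fun e _ => (measurable_pi_apply e : Measurable fun ω : ι → Bool => ω e) (measurableSet_singleton true)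
  · classical
    rintro _ ⟨s, rfl⟩ _ ⟨t, rfl⟩ _
    exact ⟨s ∪ t, by ext ω; simp [or_imp, forall_and]⟩
  · rintro _ ⟨s, rfl⟩
    rw [h.cyl, h'.cyl]
  · simp
end Base
end Part1
section Part2
section Fin
open Classical in
noncomputable def pr {ι : Type*} (p : ι → ℝ) (E : Finset ι) (A : Finset ι → Prop) : ℝ :=
  ∑ S ∈ E.powerset, (∏ e ∈ S, p e) * (∏ e ∈ E \ S, (1 - p e)) * (if A S then 1 else 0)
variable {ι : Type*} {p : ι → ℝ} {E : Finset ι} {A B : Finset ι → Prop}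
def Inc (A : Finset ι → Prop) : Prop := ∀ ⦃S T⦄, S ⊆ T → A S → A T
theorem pr_mono (hp : ∀ e, 0 ≤ p e ∧ p e ≤ 1) (h : ∀ S ⊆ E, A S → B S) : pr p E A ≤ pr p E B := by
  classical
  unfold pr
  refine Finset.sum_le_sum fun S hS => ?_
  have h1 : 0 ≤ (∏ e ∈ S, p e) * (∏ e ∈ E \ S, (1 - p e)) :=
    mul_nonneg (Finset.prod_nonneg fun e _ => (hp e).1)
      (Finset.prod_nonneg fun e _ => by linarith [(hp e).2])
  refine mul_le_mul_of_nonneg_left ?_ h1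
  have := h S (Finset.mem_powerset.1 hS)
  split_ifs <;> first | tauto | norm_num
theorem pr_congr (h : ∀ S ⊆ E, (A S ↔ B S)) : pr p E A = pr p E B := by
  classical
  unfold pr
  refine Finset.sum_congr rfl fun S hS => ?_
  have := h S (Finset.mem_powerset.1 hS)
  simp only [this]
theorem pr_false : pr p E (fun _ => False) = 0 := by simp [pr]
theorem pr_nonneg (hp : ∀ e, 0 ≤ p e ∧ p e ≤ 1) : 0 ≤ pr p E A := by
  rw [← pr_false (p := p) (E := E)]
  exact pr_mono hp fun _ _ h => h.elim
theorem pr_or_and : pr p E (fun S => A S ∨ B S) + pr p E (fun S => A S ∧ B S) =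
    pr p E A + pr p E B := by
  classical
  unfold pr
  rw [← Finset.sum_add_distrib, ← Finset.sum_add_distrib]
  refine Finset.sum_congr rfl fun S hS => ?_
  by_cases h1 : A S <;> by_cases h2 : B S <;> simp [h1, h2]
theorem pr_empty : pr p ∅ A = (open Classical in if A ∅ then 1 else 0) := by
  classical
  simp [pr]
theorem pr_insert [dec : DecidableEq ι] {e : ι} (he : e ∉ E) : pr p (insert e E) A =
    (1 - p e) * pr p E A + p e * pr p E (fun S => A (insert e S)) := by
  obtain rfl : dec = fun a b => Classical.propDecidable _ := Subsingleton.elim _ _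
  classical
  unfold pr
  rw [Finset.sum_powerset_insert he, Finset.mul_sum, Finset.mul_sum]
  congr 1
  · refine Finset.sum_congr rfl fun S hS => ?_
    have hS' := Finset.mem_powerset.1 hS
    have : e ∉ S := fun h => he (hS' h)
    rw [Finset.insert_sdiff_of_notMem _ this, Finset.prod_insert (by simp [he])]
    ring
  · refine Finset.sum_congr rfl fun S hS => ?_
    have hS' := Finset.mem_powerset.1 hS
    have h2 : e ∉ S := fun h => he (hS' h)
    rw [Finset.insert_sdiff_insert, Finset.prod_insert h2]
    have : E \ insert e S = E \ S := by
      ext x; simp only [Finset.mem_sdiff, Finset.mem_insert]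
      constructor
      · tauto
      · rintro ⟨a, b⟩; refine ⟨a, ?_⟩; rintro (rfl | h); exacts [he a, b h]
    rw [this]; ring
theorem pr_le_one (hp : ∀ e, 0 ≤ p e ∧ p e ≤ 1) : pr p E A ≤ 1 := by
  classical
  induction E using Finset.induction_on generalizing A with
  | empty => rw [pr_empty]; split_ifs <;> norm_num
  | insert e E he ih =>
    rw [pr_insert he]
    have := hp e
    nlinarith [ih (A := A), ih (A := fun S => A (insert e S))]
def Box (A B : Finset ι → Prop) (S : Finset ι) : Prop :=
  ∃ S₁ S₂ : Finset ι, Disjoint S₁ S₂ ∧ S₁ ⊆ S ∧ S₂ ⊆ S ∧ A S₁ ∧ B S₂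
theorem Inc.box : Inc (Box A B) := by
  rintro S T h ⟨a, b, c, d, e, f⟩
  exact ⟨a, b, c, d.trans h, e.trans h, f⟩
theorem bk (hp : ∀ e, 0 ≤ p e ∧ p e ≤ 1) (hA : Inc A) (hB : Inc B) :
    pr p E (Box A B) ≤ pr p E A * pr p E B := by
  classical
  induction E using Finset.induction_on generalizing A B with
  | empty =>
    simp only [pr_empty]
    by_cases h : Box A B ∅
    · obtain ⟨a, b, c, d, e, f, g⟩ := h
      have : A ∅ := by rwa [Finset.subset_empty.1 d] at f
      have h2 : B ∅ := by rwa [Finset.subset_empty.1 e] at g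
      simp [this, h2]; split_ifs <;> norm_num
    · simp only [h, if_false]; split_ifs <;> norm_num
  | insert e E he ih =>
    rw [pr_insert he, pr_insert he, pr_insert he]
    set A1 : Finset ι → Prop := fun S => A (insert e S) with hA1
    set B1 : Finset ι → Prop := fun S => B (insert e S) with hB1
    have iA1 : Inc A1 := fun S T h => hA (Finset.insert_subset_insert _ h)
    have iB1 : Inc B1 := fun S T h => hB (Finset.insert_subset_insert _ h)
    have A01 : ∀ S, A S → A1 S := fun S => hA (Finset.subset_insert _ _)
    have B01 : ∀ S, B S → B1 S := fun S => hB (Finset.subset_insert _ _)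
    have hu1 : pr p E (fun S => Box A B (insert e S)) ≤ pr p E (fun S => Box A1 B S ∨ Box A B1 S) := by
      refine pr_mono hp fun S hS => ?_
      rintro ⟨a, b, hab, ha, hb, h1, h2⟩
      by_cases ea : e ∈ a
      · left
        have eb : e ∉ b := Finset.disjoint_left.1 hab ea
        refine ⟨a.erase e, b, hab.mono_left (Finset.erase_subset _ _), ?_, ?_, ?_, h2⟩
        · intro x hx; have := ha (Finset.mem_of_mem_erase hx); have := Finset.ne_of_mem_erase hx
          simp_all
        · intro x hx; have := hb hx; rw [Finset.mem_insert] at this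
          rcases this with rfl | h; exacts [(eb hx).elim, h]
        · simpa [hA1, Finset.insert_erase ea] using h1
      · right
        refine ⟨a, b.erase e, hab.mono_right (Finset.erase_subset _ _), ?_, ?_, h1, ?_⟩
        · intro x hx; have := ha hx; rw [Finset.mem_insert] at this
          rcases this with rfl | h; exacts [(ea hx).elim, h]
        · intro x hx; have := hb (Finset.mem_of_mem_erase hx); have := Finset.ne_of_mem_erase hx
          simp_all
        · apply hB _ h2
          intro x hx
          by_cases hxe : x = e <;> simp [hxe, hx]
    have hand := pr_or_and (p := p) (E := E) (A := Box A1 B) (B := Box A B1)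
    have hand2 : pr p E (Box A B) ≤ pr p E (fun S => Box A1 B S ∧ Box A B1 S) := by
      refine pr_mono hp fun S hS => ?_
      rintro ⟨a, b, hab, ha, hb, h1, h2⟩
      exact ⟨⟨a, b, hab, ha, hb, A01 _ h1, h2⟩, ⟨a, b, hab, ha, hb, h1, B01 _ h2⟩⟩
    have hu2 : pr p E (fun S => Box A1 B S ∨ Box A B1 S) ≤ pr p E (Box A1 B1) := by
      refine pr_mono hp fun S hS => ?_
      rintro (⟨a, b, hab, ha, hb, h1, h2⟩ | ⟨a, b, hab, ha, hb, h1, h2⟩)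
      · exact ⟨a, b, hab, ha, hb, h1, B01 _ h2⟩
      · exact ⟨a, b, hab, ha, hb, A01 _ h1, h2⟩
    have i1 := ih iA1 hB
    have i2 := ih hA iB1
    have i3 := ih iA1 iB1
    have i4 := ih hA hB
    have a01 : pr p E A ≤ pr p E A1 := pr_mono hp fun S _ => A01 S
    have b01 : pr p E B ≤ pr p E B1 := pr_mono hp fun S _ => B01 S
    have := hp e
    set u := pr p E (fun S => Box A B (insert e S))
    set D := pr p E (Box A B)
    set a0 := pr p E A
    set a1 := pr p E A1
    set b0 := pr p E B
    set b1 := pr p E B1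
    have k1 : u ≤ a1 * b0 + a0 * b1 - D := by linarith
    have k2 : u ≤ a1 * b1 := by linarith
    have k3 := mul_nonneg (sub_nonneg.2 a01) (sub_nonneg.2 b01)
    obtain ⟨p0, p1⟩ := this
    rcases le_total (p e) (1/2) with hh | hh
    · have : (1 - p e) * D + p e * u ≤ (1 - 2 * p e) * (a0 * b0) + p e * (a1 * b0 + a0 * b1) := by
        nlinarith [mul_le_mul_of_nonneg_left k1 p0, mul_le_mul_of_nonneg_left i4 (by linarith : 0 ≤ 1 - 2 * p e)]
      nlinarith [mul_nonneg (sq_nonneg (p e)) k3]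
    · have : (1 - p e) * D + p e * u ≤ (1 - p e) * (a1 * b0 + a0 * b1) + (2 * p e - 1) * (a1 * b1) := by
        nlinarith [mul_le_mul_of_nonneg_left k1 (sub_nonneg.2 p1), mul_le_mul_of_nonneg_left k2 (by linarith : 0 ≤ 2 * p e - 1)]
      nlinarith [mul_nonneg (sq_nonneg (1 - p e)) k3]
def Piv (e : ι) (A : Finset ι → Prop) (S : Finset ι) : Prop :=
  e ∉ S ∧ ¬ A S ∧ (open Classical in A (insert e S))
theorem russo (w : ι → ℝ) (hA : Inc A) (b : ℝ) :
    HasDerivAt (fun b => pr (fun e => 1 - Real.exp (-b * w e)) E A)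
      (∑ e ∈ E, w e * pr (fun e => 1 - Real.exp (-b * w e)) E (Piv e A)) b := by
  classical
  induction E using Finset.induction_on generalizing A with
  | empty => simp only [pr_empty, Finset.sum_empty]; exact hasDerivAt_const _ _
  | insert e E he ih =>
    have iA1 : Inc (fun S => A (insert e S)) := fun S T h => hA (Finset.insert_subset_insert _ h)
    simp only [pr_insert he]
    have hexp : HasDerivAt (fun b : ℝ => Real.exp (-b * w e)) (Real.exp (-b * w e) * (-w e)) b := by
      have := ((hasDerivAt_id b).neg.mul_const (w e)).exp
      simpa using this
    have h1 := ((hexp.const_sub 1).const_sub 1).mul (ih hA)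
    have h2 := (hexp.const_sub 1).mul (ih iA1)
    refine (h1.add h2).congr_deriv ?_
    rw [Finset.sum_insert he]
    set q : ι → ℝ := fun e => 1 - Real.exp (-b * w e)
    have e1 : pr q E (fun S => Piv e A (insert e S)) = 0 := by
      rw [← pr_false (p := q) (E := E)]
      refine pr_congr fun S _ => ?_
      simp [Piv]
    have e2 : pr q E (Piv e A) + pr q E A = pr q E (fun S => A (insert e S)) := by
      rw [← pr_or_and]
      have : pr q E (fun S => Piv e A S ∧ A S) = 0 := by
        rw [← pr_false (p := q) (E := E)]
        refine pr_congr fun S _ => ?_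
        simp only [Piv]; tauto
      rw [this, add_zero]
      refine pr_congr fun S hS => ?_
      have : e ∉ S := fun h => he (hS h)
      have := @hA S (insert e S) (Finset.subset_insert _ _)
      have e3 : Piv e A S ↔ ¬ A S ∧ A (insert e S) := by
        unfold Piv
        constructor
        · rintro ⟨_, b, c⟩; refine ⟨b, ?_⟩; convert c
        · rintro ⟨b, c⟩; refine ⟨‹_›, b, ?_⟩; convert c
      rw [e3]
      tauto
    have e3 : ∀ f ∈ E, w f * ((1 - q e) * pr q E (Piv f A) + q e * pr q E (fun S => Piv f A (insert e S))) =
        (1 - q e) * (w f * pr q E (Piv f A)) + q e * (w f * pr q E (Piv f (fun S => A (insert e S)))) := by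
      intro f hf
      have hfe : f ≠ e := by rintro rfl; exact he hf
      have : pr q E (fun S => Piv f A (insert e S)) = pr q E (Piv f (fun S => A (insert e S))) := by
        refine pr_congr fun S hS => ?_
        unfold Piv
        have : insert f (insert e S) = insert e (insert f S) := Finset.insert_comm _ _ _
        simp only [Finset.mem_insert, hfe, false_or]
        refine and_congr Iff.rfl (and_congr Iff.rfl ?_)
        constructor
        · intro h; convert h using 1; rw [← this]
        · intro h; convert h using 1
      rw [this]; ring
    rw [Finset.sum_congr rfl e3, Finset.sum_add_distrib, ← Finset.mul_sum, ← Finset.mul_sum, e1, ← e2]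
    simp only [q]
    ring
theorem IsBer.pr_eq {μ : Measure (ι → Bool)} (h : IsBer p μ) (E : Finset ι) (A : Finset ι → Prop) :
    μ {ω | A (E.filter (fun e => ω e = true))} = oR (pr p E A) := by
  classical
  have e1 : {ω : ι → Bool | A (E.filter (fun e => ω e = true))} =
      ⋃ S ∈ E.powerset.filter A, {ω | ∀ e ∈ E, ω e = decide (e ∈ S)} := by
    ext ω
    simp only [Set.mem_ofPred_eq, Set.mem_iUnion, Finset.mem_filter, Finset.mem_powerset, exists_prop]
    constructor
    · intro h
      refine ⟨_, ⟨Finset.filter_subset _ _, h⟩, ?_⟩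
      intro e he; simp [he]
    · rintro ⟨S, ⟨h1, h2⟩, h3⟩
      convert h2
      ext e
      simp only [Finset.mem_filter]
      constructor
      · rintro ⟨a, b⟩; rw [h3 e a] at b; simpa using b
      · intro a; exact ⟨h1 a, by rw [h3 e (h1 a)]; simpa using a⟩
  rw [e1, measure_biUnion_finset]
  · unfold pr
    rw [ENNReal.ofReal_sum_of_nonneg, Finset.sum_filter]
    · refine Finset.sum_congr rfl fun S hS => ?_
      split_ifs with hA
      · rw [h.2 E (fun e => decide (e ∈ S)), mul_one]
        congr 1
        have hS' := Finset.mem_powerset.1 hS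
        rw [Finset.prod_ite]
        congr 1
        · congr 1; ext x; simp; exact fun hx => hS' hx
        · congr 1; ext x; simp
      · simp
    · intro S hS
      refine mul_nonneg (mul_nonneg (Finset.prod_nonneg fun e _ => (h.1 e).1)
        (Finset.prod_nonneg fun e _ => by linarith [(h.1 e).2])) (by split_ifs <;> norm_num)
  · intro S hS T hT hST
    refine Set.disjoint_left.2 fun ω h1 h2 => hST ?_
    simp only [Finset.coe_filter, Finset.mem_powerset, Set.mem_ofPred_eq] at hS hT h1 h2
    ext e
    constructor
    · intro h; have := (h1 e (hS.1 h)).symm.trans (h2 e (hS.1 h)); simpa [h] using this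
    · intro h; have := (h1 e (hT.1 h)).symm.trans (h2 e (hT.1 h)); simpa [h] using this
  · intro S _
    have : {ω : ι → Bool | ∀ e ∈ E, ω e = decide (e ∈ S)} = ⋂ e ∈ E, (fun ω : ι → Bool => ω e) ⁻¹' {decide (e ∈ S)} := by
      ext; simp
    rw [this]
    exact Finset.measurableSet_biInter _ fun e _ => measurable_pi_apply e (measurableSet_singleton _)
end Fin
end Part2
section Part3
section Graph
variable {d : ℕ} {ω ω' : Config d} {D U : SV d} {x y z : V d}
theorem adj.symm (h : adj ω x y) : adj ω y x := ⟨h.1.symm, by rw [Sym2.eq_swap]; exact h.2⟩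
theorem connIn.refl (h : x ∈ D) : connIn ω D x x := ⟨h, h, .refl⟩
theorem connIn.trans (h : connIn ω D x y) (h' : connIn ω D y z) : connIn ω D x z :=
  ⟨h.1, h'.2.1, h.2.2.trans h'.2.2⟩
theorem connIn.symm (h : connIn ω D x y) : connIn ω D y x := by
  refine ⟨h.2.1, h.1, ?_⟩
  have : Std.Symm (fun a b => a ∈ D ∧ b ∈ D ∧ adj ω a b) :=
    ⟨fun a b ⟨h1, h2, h3⟩ => ⟨h2, h1, h3.symm⟩⟩
  exact Std.Symm.symm _ _ h.2.2
theorem connIn_comm : connIn ω D x y ↔ connIn ω D y x := ⟨.symm, .symm⟩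
theorem connIn.single (hx : x ∈ D) (hy : y ∈ D) (h : adj ω x y) : connIn ω D x y :=
  ⟨hx, hy, .single ⟨hx, hy, h⟩⟩
theorem connIn.tail (h : connIn ω D x y) (hz : z ∈ D) (h' : adj ω y z) : connIn ω D x z :=
  h.trans (.single h.2.1 hz h')
theorem connIn.induct {Q : V d → Prop} (h : connIn ω D x y) (h0 : Q x)
    (hs : ∀ a b, connIn ω D x a → Q a → b ∈ D → adj ω a b → Q b) : Q y := by
  obtain ⟨hx, hy, h⟩ := h
  have : connIn ω D x y ∧ Q y := by
    induction h with
    | refl => exact ⟨.refl hx, h0⟩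
    | tail h1 h2 ih =>
      have := ih h2.1
      exact ⟨this.1.tail h2.2.1 h2.2.2, hs _ _ this.1 this.2 h2.2.1 h2.2.2⟩
  exact this.2
theorem connIn.mono (h : connIn ω D x y) (hD : D ⊆ U) : connIn ω U x y :=
  h.induct (Q := fun y => connIn ω U x y) (.refl (hD h.1)) fun _ _ _ h2 h3 h4 => h2.tail (hD h3) h4
def inE (D : SV d) : Set (Sym2 (V d)) := {e | ∀ v ∈ e, v ∈ D}
def toE (D : SV d) : Set (Sym2 (V d)) := {e | ∃ v ∈ e, v ∈ D}
theorem mem_inE : s(x, y) ∈ inE D ↔ x ∈ D ∧ y ∈ D := by simp [inE]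
theorem mem_toE : s(x, y) ∈ toE D ↔ x ∈ D ∨ y ∈ D := by simp [toE]
theorem disj_toE_inE (B : SV d) (h : Disjoint B D) : Disjoint (toE B) (inE D) := by
  rw [Set.disjoint_left] at *
  rintro e ⟨v, hv, hB⟩ h2
  exact h hB (h2 v hv)
theorem connIn.agree (h : connIn ω D x y) (ha : ∀ e ∈ inE D, ω e = true → ω' e = true) :
    connIn ω' D x y := by
  refine h.induct (Q := fun y => connIn ω' D x y) (.refl h.1) fun a b h1 h2 h3 h4 => h2.tail h3 ⟨h4.1, ?_⟩
  exact ha _ (mem_inE.2 ⟨h1.2.1, h3⟩) h4.2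
theorem det_connIn : Det (inE D) {ω : Config d | connIn ω D x y} := by
  intro ω ω' h
  constructor
  · intro h1; exact connIn.agree h1 fun e he => by rw [h e he]; exact id
  · intro h1; exact connIn.agree h1 fun e he => by rw [h e he]; exact id
theorem Det.mono {ι : Type*} {S T : Set ι} {A : Set (ι → Bool)} (h : Det S A) (hST : S ⊆ T) : Det T A :=
  fun ω ω' h' => h ω ω' fun e he => h' e (hST he)
theorem meas_adj : MeasurableSet {ω : Config d | adj ω x y} := by
  by_cases h : x = y
  · simp [adj, h]
  · simp only [adj, ne_eq, h, not_false_eq_true, true_and]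
    exact (measurable_pi_apply (s(x, y)) : Measurable fun ω : Config d => ω s(x, y)) (measurableSet_singleton true)
def stepIn (ω : Config d) (D : SV d) (x : V d) : ℕ → V d → Prop
  | 0, y => x = y
  | n + 1, y => ∃ z, stepIn ω D x n z ∧ (z ∈ D ∧ y ∈ D ∧ adj ω z y)
theorem meas_stepIn (n : ℕ) : ∀ y, MeasurableSet {ω : Config d | stepIn ω D x n y} := by
  induction n with
  | zero => intro y; simp [stepIn]
  | succ n ih =>
    intro y
    have : {ω : Config d | stepIn ω D x (n+1) y} = ⋃ z, ({ω | stepIn ω D x n z} ∩ ({ω | z ∈ D ∧ y ∈ D} ∩ {ω | adj ω z y})) := by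
      ext ω; simp [stepIn, and_assoc]
    rw [this]
    exact MeasurableSet.iUnion fun z => (ih z).inter ((MeasurableSet.const _).inter meas_adj)
theorem connIn_iff_step : connIn ω D x y ↔ x ∈ D ∧ y ∈ D ∧ ∃ n, stepIn ω D x n y := by
  unfold connIn
  refine and_congr_right fun hx => and_congr_right fun hy => ?_
  clear hx hy
  constructor
  · intro h
    induction h with
    | refl => exact ⟨0, rfl⟩
    | tail h1 h2 ih => obtain ⟨n, hn⟩ := ih; exact ⟨n+1, _, hn, h2⟩
  · rintro ⟨n, hn⟩
    induction n generalizing y with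
    | zero => cases hn; exact .refl
    | succ n ih => obtain ⟨z, h1, h2⟩ := hn; exact (ih h1).tail h2
theorem meas_connIn : MeasurableSet {ω : Config d | connIn ω D x y} := by
  have : {ω : Config d | connIn ω D x y} = {ω | x ∈ D ∧ y ∈ D} ∩ ⋃ n, {ω | stepIn ω D x n y} := by
    ext ω; simp [connIn_iff_step, and_assoc]
  rw [this]
  exact (MeasurableSet.const _).inter (MeasurableSet.iUnion fun n => meas_stepIn n y)
theorem conn_iff : conn ω x y ↔ connIn ω Set.univ x y := by simp [conn, connIn]
def Kc (ω : Config d) (D : SV d) (x : V d) : SV d := {y | connIn ω D x y}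
theorem cluster_eq : cluster ω x = Kc ω Set.univ x := by ext; simp [cluster, Kc, conn_iff]
theorem Kc_subset : Kc ω D x ⊆ D := fun _ h => h.2.1
theorem connIn.inK (h : connIn ω D x y) : connIn ω (Kc ω D x) x y := by
  have hx : x ∈ Kc ω D x := connIn.refl h.1
  refine h.induct (Q := fun y => connIn ω (Kc ω D x) x y) (.refl hx) ?_
  intro a b h1 h2 h3 h4
  exact h2.tail (show connIn ω D x b from h1.tail h3 h4) h4
theorem Kc_eq_iff {B : SV d} (hx : x ∈ D) : Kc ω D x = B ↔
    x ∈ B ∧ B ⊆ D ∧ (∀ y ∈ B, connIn ω B x y) ∧ ∀ b ∈ B, ∀ a ∈ D, a ∉ B → ¬ adj ω b a := by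
  constructor
  · rintro rfl
    refine ⟨.refl hx, Kc_subset, fun y hy => connIn.inK hy, fun b hb a ha hab h => hab ?_⟩
    exact connIn.tail hb ha h
  · rintro ⟨h1, h2, h3, h4⟩
    ext y
    constructor
    · intro h
      refine connIn.induct (Q := fun y => y ∈ B) h h1 ?_
      intro a b _ ha hb hab
      by_contra hbB
      exact h4 a ha b hb hbB hab
    · intro hy; exact (h3 y hy).mono h2
theorem det_adj : Det {s(x, y)} {ω : Config d | adj ω x y} := by
  intro ω ω' h
  simp [adj, h]
theorem det_Kc {B : SV d} (hx : x ∈ D) : Det (toE B) {ω : Config d | Kc ω D x = B} := by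
  intro ω ω' h
  simp only [Set.mem_ofPred_eq, Kc_eq_iff hx]
  refine and_congr_right fun _ => and_congr_right fun _ => and_congr ?_ ?_
  · refine forall₂_congr fun y hy => ?_
    refine det_connIn ω ω' fun e he => h e ?_
    induction e with | _ a b => exact mem_toE.2 (Or.inl (mem_inE.1 he).1)
  · refine forall₂_congr fun y hy => forall₂_congr fun a ha => imp_congr_right fun _ => not_congr ?_
    refine det_adj ω ω' fun e he => h e ?_
    rw [Set.mem_singleton_iff.1 he]
    exact mem_toE.2 (Or.inl hy)
theorem meas_Kc {B : SV d} : MeasurableSet {ω : Config d | Kc ω D x = B} := by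
  have : {ω : Config d | Kc ω D x = B} = ⋂ y, {ω | connIn ω D x y ↔ y ∈ B} := by
    ext ω; simp [Set.ext_iff, Kc]
  rw [this]
  refine MeasurableSet.iInter fun y => ?_
  exact (meas_connIn (x := x) (y := y) (D := D)).iff (MeasurableSet.const (y ∈ B))
noncomputable def tau (μ : Measure (Config d)) (D : SV d) (x y : V d) : ℝ≥0∞ :=
  μ {ω | connIn ω D x y}
theorem tau_mono {μ : Measure (Config d)} (h : D ⊆ U) : tau μ D x y ≤ tau μ U x y :=
  measure_mono fun _ h' => connIn.mono h' h
theorem tau_symm {μ : Measure (Config d)} : tau μ D x y = tau μ D y x := by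
  simp only [tau, connIn_comm]
theorem tau_notMem {μ : Measure (Config d)} (h : y ∉ D) : tau μ D x y = 0 := by
  have : {ω : Config d | connIn ω D x y} = ∅ := by
    ext ω; simp [connIn, h]
  simp [tau, this]
theorem tau_notMem' {μ : Measure (Config d)} (h : x ∉ D) : tau μ D x y = 0 := by
  rw [tau_symm, tau_notMem h]
theorem ae_fin {μ : Measure (Config d)} (h : ∑' y, tau μ D x y ≠ ∞) :
    ∀ᵐ ω ∂μ, (Kc ω D x).Finite := by
  have h1 : ∫⁻ ω, ∑' y, Set.indicator {ω : Config d | connIn ω D x y} 1 ω ∂μ ≠ ∞ := by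
    rw [lintegral_tsum]
    · simp only [lintegral_indicator_one meas_connIn]; exact h
    · intro y; exact (measurable_one.indicator meas_connIn).aemeasurable
  have h2 := ae_lt_top (Measurable.tsum fun y => measurable_one.indicator meas_connIn) h1
  filter_upwards [h2] with ω hω
  have := ENNReal.finite_const_le_of_tsum_ne_top hω.ne one_ne_zero
  refine this.subset fun y hy => ?_
  have hy' : ω ∈ {ω : Config d | connIn ω D x y} := hy
  simp [Set.indicator_of_mem hy']
theorem exit_path (hx : x ∈ U) (h : connIn ω D x y) (hy : ¬ connIn ω U x y) :
    ∃ a, a ∉ U ∧ a ∈ D ∧ (∃ b ∈ Kc ω U x, adj ω b a) ∧ connIn ω (D \ Kc ω U x) a y := by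
  have hyK : y ∉ Kc ω U x := hy
  have : ∀ y, connIn ω D x y → y ∉ Kc ω U x → ∃ a, a ∉ U ∧ a ∈ D ∧ (∃ b ∈ Kc ω U x, adj ω b a) ∧ connIn ω (D \ Kc ω U x) a y := by
    intro y hxy
    refine hxy.induct (Q := fun y => y ∉ Kc ω U x → ∃ a, a ∉ U ∧ a ∈ D ∧ (∃ b ∈ Kc ω U x, adj ω b a) ∧ connIn ω (D \ Kc ω U x) a y) ?_ ?_
    · intro h; exact (h (connIn.refl hx)).elim
    · intro a b h1 h2 h3 h4 h5
      by_cases ha : a ∈ Kc ω U x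
      · refine ⟨b, ?_, h3, ⟨a, ha, h4⟩, .refl ⟨h3, h5⟩⟩
        intro hb; exact h5 (connIn.tail ha hb h4)
      · obtain ⟨a', e1, e2, e3, e4⟩ := h2 ha
        exact ⟨a', e1, e2, e3, e4.tail ⟨h3, h5⟩ h4⟩
  exact this y h hyK
end Graph
section Prob
variable {d : ℕ} {p : Sym2 (V d) → ℝ} {μ : Measure (Config d)} {D U : SV d} {x y z u v : V d}
theorem explore (h : IsBer p μ) {B : SV d} (hx : x ∈ U) (hD : Disjoint B D) {F : Set (Config d)}
    (mF : MeasurableSet F) (dF : Det (toE B) F) :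
    μ ({ω | Kc ω U x = B} ∩ F ∩ {ω | connIn ω D u v}) = μ ({ω | Kc ω U x = B} ∩ F) * tau μ D u v := by
  refine h.indep (meas_Kc.inter mF) meas_connIn (S := toE B) (T := inE D) ?_ det_connIn (disj_toE_inE B hD)
  intro ω ω' h
  exact and_congr (det_Kc hx ω ω' h) (dF ω ω' h)
theorem exit_prob (h : IsBer p μ) {a : V d} (ha : a ∉ U) :
    tau μ (insert a U) x a ≤ (if x = a then 1 else 0) + ∑' b, tau μ U x b * oR (p s(b, a)) := by
  have hpr := h.prob
  split_ifs with hxa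
  · exact le_trans prob_le_one (by simp)
  rw [zero_add]
  have h1 : {ω : Config d | connIn ω (insert a U) x a} ⊆ ⋃ b, ({ω | connIn ω U x b} ∩ {ω | ω s(b, a) = true}) := by
    intro ω hω
    by_contra hcon
    simp only [Set.mem_iUnion, Set.mem_inter_iff, Set.mem_ofPred_eq, not_exists, not_and] at hcon hω
    have : connIn ω U x a := by
      refine hω.induct (Q := fun y => connIn ω U x y) (.refl ?_) ?_
      · rcases hω.1 with h | h; exacts [(hxa h).elim, h]
      · intro b c _ hb hc hbc
        rcases hc with rfl | hc
        · exact (hcon b hb hbc.2).elim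
        · exact hb.tail hc hbc
    exact ha this.2.1
  refine (measure_mono h1).trans ((measure_iUnion_le _).trans ?_)
  refine ENNReal.tsum_le_tsum fun b => ?_
  by_cases hb : b ∈ U
  swap
  · have : {ω : Config d | connIn ω U x b} = ∅ := by ext; simp [connIn, hb]
    simp [this]
  have m2 : MeasurableSet {ω : Config d | ω s(b, a) = true} :=
    (measurable_pi_apply (s(b, a)) : Measurable fun ω : Config d => ω s(b, a)) (measurableSet_singleton true)
  rw [h.indep meas_connIn m2 det_connIn (T := {s(b,a)})]
  · refine le_of_eq ?_
    have := h.cyl {s(b,a)}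
    simp only [Finset.mem_singleton, forall_eq, Finset.prod_singleton] at this
    rw [this]; rfl
  · intro ω ω' h; simp [h]
  · rw [Set.disjoint_singleton_right, mem_inE]; tauto
open Classical in
theorem exit_lemma (h : IsBer p μ) (hx : x ∈ U) (hf : ∀ᵐ ω ∂μ, (Kc ω U x).Finite) :
    tau μ D x y ≤ tau μ U x y +
      ∑' a : V d, (if a ∈ U then 0 else tau μ (insert a U) x a * tau μ (D \ {x}) a y) := by
  classical
  set F : V d → FV d → Set (Config d) := fun a B => {ω | ∃ b ∈ B, adj ω b a}
  have mF : ∀ a B, MeasurableSet (F a B) := by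
    intro a B
    have : F a B = ⋃ b ∈ B, {ω | adj ω b a} := by ext; simp [F]
    rw [this]
    exact Finset.measurableSet_biUnion _ fun _ _ => meas_adj
  have h1 : {ω : Config d | connIn ω D x y} ⊆ {ω | connIn ω U x y} ∪ ({ω | ¬ (Kc ω U x).Finite} ∪
      ⋃ a : V d, ⋃ (_ : a ∈ D \ U), ⋃ B : FV d, ({ω | Kc ω U x = B} ∩ F a B ∩ {ω | connIn ω (D \ B) a y})) := by
    intro ω hω
    by_cases h1 : connIn ω U x y
    · exact Or.inl h1
    by_cases h2 : (Kc ω U x).Finite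
    swap
    · exact Or.inr (Or.inl h2)
    obtain ⟨a, a1, a2, ⟨b, b1, b2⟩, a4⟩ := exit_path hx hω h1
    right; right
    simp only [Set.mem_iUnion]
    refine ⟨a, ⟨a2, a1⟩, h2.toFinset, ⟨by simp, ⟨b, by simpa using b1, b2⟩⟩, ?_⟩
    simpa using a4
  refine (measure_mono h1).trans ((measure_union_le _ _).trans ?_)
  refine add_le_add le_rfl ?_
  refine (measure_union_le _ _).trans ?_
  rw [show μ {ω | ¬ (Kc ω U x).Finite} = 0 from hf, zero_add]
  refine (measure_iUnion_le _).trans (ENNReal.tsum_le_tsum fun a => ?_)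
  by_cases ha : a ∈ D \ U
  swap
  · simp [ha]
  simp only [ha, Set.iUnion_true, ha.2, if_false]
  refine (measure_iUnion_le _).trans ?_
  calc ∑' B : FV d, μ ({ω | Kc ω U x = B} ∩ F a B ∩ {ω | connIn ω (D \ B) a y})
      ≤ ∑' B : FV d, μ ({ω | Kc ω U x = B} ∩ F a B) * tau μ (D \ {x}) a y := by
        refine ENNReal.tsum_le_tsum fun B => ?_
        rw [explore h hx disjoint_sdiff_self_right (mF a B)]
        · by_cases hxB : x ∈ B
          · gcongr
            exact tau_mono (Set.sdiff_subset_sdiff_right (by simpa using hxB))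
          · have : {ω : Config d | Kc ω U x = B} = ∅ := by
              ext ω; simp only [Kc_eq_iff hx]; simp [hxB]
            simp [this]
        · intro ω ω' h
          refine exists_congr fun b => and_congr_right fun hb => ?_
          refine det_adj ω ω' fun e he => h e ?_
          rw [Set.mem_singleton_iff.1 he]
          exact mem_toE.2 (Or.inl hb)
    _ = (∑' B : FV d, μ ({ω | Kc ω U x = B} ∩ F a B)) * tau μ (D \ {x}) a y := ENNReal.tsum_mul_right
    _ ≤ _ := by
      gcongr
      rw [← measure_iUnion]
      · refine measure_mono ?_
        rintro ω hω
        simp only [Set.mem_iUnion] at hω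
        obtain ⟨B, hB, b, hb, hba⟩ := hω
        have : connIn ω U x b := by
          have : b ∈ Kc ω U x := by rw [hB]; exact hb
          exact this
        exact (this.mono (Set.subset_insert _ _)).tail (Set.mem_insert _ _) hba
      · intro B B' hBB
        refine Set.disjoint_left.2 ?_
        rintro ω ⟨h1, _⟩ ⟨h2, _⟩
        exact hBB (Finset.coe_injective (h1.symm.trans h2))
      · intro B; exact meas_Kc.inter (mF a B)
theorem piv_bound (h : IsBer p μ) (hf : ∀ᵐ ω ∂μ, (Kc ω D x).Finite) :
    μ {ω | connIn ω D x u ∧ connIn ω D v y ∧ ¬ connIn ω D x y} ≤ tau μ D x u * tau μ D v y := by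
  by_cases hx : x ∈ D
  swap
  · have : {ω : Config d | connIn ω D x u ∧ connIn ω D v y ∧ ¬ connIn ω D x y} = ∅ := by
      ext; simp [connIn, hx]
    simp [this]
  have h1 : {ω : Config d | connIn ω D x u ∧ connIn ω D v y ∧ ¬ connIn ω D x y} ⊆
     {ω | ¬ (Kc ω D x).Finite} ∪ ⋃ B : FV d, ({ω | Kc ω D x = B} ∩ {ω | u ∈ B} ∩ {ω | connIn ω (D \ B) v y}) := by
    rintro ω ⟨h1, h2, h3⟩
    by_cases h4 : (Kc ω D x).Finite
    swap
    · exact Or.inl h4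
    right
    simp only [Set.mem_iUnion]
    refine ⟨h4.toFinset, ⟨by simp, (Set.Finite.mem_toFinset h4).2 h1⟩, ?_⟩
    simp only [Set.mem_ofPred_eq, Set.Finite.coe_toFinset]
    have h5 : ¬ connIn ω D x v := fun h5 => h3 (h5.trans h2)
    refine h2.induct (Q := fun y => connIn ω (D \ Kc ω D x) v y) (.refl ⟨h2.1, h5⟩) ?_
    intro a b k1 k2 k3 k4
    refine k2.tail ⟨k3, ?_⟩ k4
    intro k5
    exact h5 (connIn.trans k5 (k1.tail k3 k4).symm)
  refine (measure_mono h1).trans ((measure_union_le _ _).trans ?_)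
  rw [show μ {ω | ¬ (Kc ω D x).Finite} = 0 from hf, zero_add]
  refine (measure_iUnion_le _).trans ?_
  calc ∑' B : FV d, μ ({ω | Kc ω D x = B} ∩ {ω | u ∈ B} ∩ {ω | connIn ω (D \ B) v y})
      ≤ ∑' B : FV d, μ ({ω | Kc ω D x = B} ∩ {ω | u ∈ B}) * tau μ D v y := by
        refine ENNReal.tsum_le_tsum fun B => ?_
        rw [explore h hx disjoint_sdiff_self_right (MeasurableSet.const _)]
        · gcongr
          exact tau_mono Set.sdiff_subset
        · intro ω ω' h; exact Iff.rfl
    _ = (∑' B : FV d, μ ({ω | Kc ω D x = B} ∩ {ω | u ∈ B})) * tau μ D v y := ENNReal.tsum_mul_right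
    _ ≤ _ := by
      gcongr
      rw [← measure_iUnion]
      · refine measure_mono ?_
        rintro ω hω
        simp only [Set.mem_iUnion] at hω
        obtain ⟨B, hB, hb⟩ := hω
        have : u ∈ Kc ω D x := by rw [hB]; exact hb
        exact this
      · intro B B' hBB
        refine Set.disjoint_left.2 ?_
        rintro ω ⟨h1, _⟩ ⟨h2, _⟩
        exact hBB (Finset.coe_injective (h1.symm.trans h2))
      · intro B; exact meas_Kc.inter (MeasurableSet.const _)
end Prob
section Trans
variable {d : ℕ} {p : Sym2 (V d) → ℝ} {μ : Measure (Config d)} {D U : SV d} {x y z u v : V d}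
def shift (z : V d) (ω : Config d) : Config d := fun e => ω (e.map (· + z))
theorem meas_shift : Measurable (shift z : Config d → Config d) :=
  measurable_pi_lambda _ fun _ => measurable_pi_apply _
theorem connIn_shift {ω : Config d} : connIn (shift z ω) D x y ↔ connIn ω {v | v - z ∈ D} (x + z) (y + z) := by
  constructor
  · intro h
    refine h.induct (Q := fun y => connIn ω {v | v - z ∈ D} (x + z) (y + z)) (.refl (by simpa using h.1)) ?_
    intro a b h1 h2 h3 h4
    refine h2.tail (by simpa using h3) ⟨fun h => h4.1 (by simpa using h), ?_⟩
    simpa [shift] using h4.2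
  · intro h
    have := h.induct (Q := fun y => connIn (shift z ω) D x (y - z)) (by simpa using connIn.refl (by simpa using h.1)) (by
      intro a b h1 h2 h3 h4
      refine h2.tail h3 ⟨fun h => h4.1 (by simpa using h), ?_⟩
      simpa [shift] using h4.2)
    simpa using this
def TI (p : Sym2 (V d) → ℝ) : Prop := ∀ (z : V d) (e : Sym2 (V d)), p (e.map (· + z)) = p e
theorem map_shift (h : IsBer p μ) (ht : TI p) : μ.map (shift z) = μ := by
  classical
  refine IsBer.unique (p := p) ⟨h.1, fun s f => ?_⟩ h
  have hinj : Function.Injective (Sym2.map (· + z) : Sym2 (V d) → Sym2 (V d)) :=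
    Sym2.map.injective (add_left_injective z)
  have hm : MeasurableSet {ω : Config d | ∀ e ∈ s, ω e = f e} := by
    have : {ω : Config d | ∀ e ∈ s, ω e = f e} = ⋂ e ∈ s, (fun ω : Config d => ω e) ⁻¹' {f e} := by
      ext; simp
    rw [this]
    exact Finset.measurableSet_biInter _ fun e _ => measurable_pi_apply e (measurableSet_singleton _)
  rw [Measure.map_apply meas_shift hm]
  have : shift z ⁻¹' {ω : Config d | ∀ e ∈ s, ω e = f e} =
    {ω | ∀ e ∈ s.image (Sym2.map (· + z)), ω e = f (e.map (· - z))} := by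
    ext ω
    have e2 : ∀ a : Sym2 (V d), (a.map (· + z)).map (· - z) = a := by
      intro a; rw [Sym2.map_map]; simp
    simp [shift, e2]
  rw [this, h.2, Finset.prod_image hinj.injOn]
  congr 1
  refine Finset.prod_congr rfl fun e _ => ?_
  have e2 : (e.map (· + z)).map (· - z) = e := by
    rw [Sym2.map_map]; simp
  rw [ht, e2]
theorem tau_shift (h : IsBer p μ) (ht : TI p) (z : V d) : tau μ {v | v - z ∈ D} (x + z) (y + z) = tau μ D x y := by
  conv_rhs => rw [tau, ← map_shift (z := z) h ht]
  rw [Measure.map_apply meas_shift meas_connIn]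
  simp only [tau, Set.preimage_ofPred_eq, connIn_shift]
theorem tau_univ (h : IsBer p μ) (ht : TI p) : tau μ Set.univ x y = tau μ Set.univ 0 (y - x) := by
  have := tau_shift (D := Set.univ) (x := 0) (y := y - x) h ht x
  simpa using this
end Trans
end Part3
section Part4
section Setup
variable {d : ℕ} {J : V d → V d → ℝ} {α c C : ℝ} {P : ℝ → Measure (Config d)} {β : ℝ}
noncomputable def wJ (J : V d → V d → ℝ) (e : Sym2 (V d)) : ℝ :=
  Sym2.lift ⟨fun x y => (J x y + J y x) / 2, fun x y => by dsimp only; rw [add_comm]⟩ e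
noncomputable def pJ (J : V d → V d → ℝ) (β : ℝ) (e : Sym2 (V d)) : ℝ := 1 - Real.exp (-β * wJ J e)
theorem wJ_mk (hJ : KernelHyp d J α c C) (x y : V d) : wJ J s(x, y) = J x y := by
  simp [wJ, hJ.symm y x]
theorem wJ_nonneg (hJ : KernelHyp d J α c C) (e : Sym2 (V d)) : 0 ≤ wJ J e := by
  induction e with | _ x y => rw [wJ_mk hJ]; exact hJ.nonneg x y
theorem pJ_bd (hJ : KernelHyp d J α c C) (hβ : 0 ≤ β) (e : Sym2 (V d)) : 0 ≤ pJ J β e ∧ pJ J β e ≤ 1 := by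
  have := mul_nonneg hβ (wJ_nonneg hJ e)
  unfold pJ
  constructor
  · have : Real.exp (-β * wJ J e) ≤ 1 := Real.exp_le_one_iff.2 (by linarith)
    linarith
  · linarith [Real.exp_pos (-β * wJ J e)]
theorem pJ_le (hJ : KernelHyp d J α c C) (x y : V d) : pJ J β s(x, y) ≤ β * J x y := by
  unfold pJ
  rw [wJ_mk hJ]
  have := Real.add_one_le_exp (-β * J x y)
  linarith
theorem isBer (hJ : KernelHyp d J α c C) (hP : IsLRP J P) (hβ : 0 ≤ β) : IsBer (pJ J β) (P β) := by
  refine ⟨pJ_bd hJ hβ, fun s f => ?_⟩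
  rw [hP, ENNReal.ofReal_prod_of_nonneg]
  · refine Finset.prod_congr rfl fun e _ => ?_
    have : edgeProb J β e = oR (pJ J β e) := rfl
    split_ifs
    · exact this
    · rw [this, ← ofReal_one, ENNReal.ofReal_sub _ (pJ_bd hJ hβ e).1]
  · intro e _
    have := pJ_bd hJ hβ e
    split_ifs <;> linarith
theorem TI_pJ (hJ : KernelHyp d J α c C) : TI (pJ J β) := by
  intro z e
  induction e with | _ x y =>
  simp only [Sym2.map_mk, pJ, wJ_mk hJ, hJ.transInv]
noncomputable def JJ (J : V d → V d → ℝ) : ℝ≥0∞ := ∑' v, oR (J 0 v)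
theorem JJ_fin (hJ : KernelHyp d J α c C) : JJ J ≠ ∞ := by
  unfold JJ
  rw [← ENNReal.ofReal_tsum_of_nonneg (fun v => hJ.nonneg 0 v) hJ.integrable]
  exact ENNReal.ofReal_ne_top
theorem J_sub (hJ : KernelHyp d J α c C) (u v : V d) : J u v = J 0 (v - u) := by
  have := hJ.transInv 0 (v - u) u
  simpa using this
theorem JJ_eq (hJ : KernelHyp d J α c C) (u : V d) : ∑' v, oR (J u v) = JJ J := by
  unfold JJ
  rw [← (Equiv.subRight u).tsum_eq (fun v => oR (J 0 v))]
  simp [J_sub hJ u]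
theorem JJ_eq' (hJ : KernelHyp d J α c C) (u : V d) : ∑' v, oR (J v u) = JJ J := by
  simp_rw [hJ.symm _ u]; exact JJ_eq hJ u
def cfg (S : Finset (Sym2 (V d))) : Config d := fun e => decide (e ∈ S)
def opn (e : Sym2 (V d)) (ω : Config d) : Config d := Function.update ω e true
theorem fin_rep {p : Sym2 (V d) → ℝ} {μ : Measure (Config d)} (h : IsBer p μ) {E : Finset (Sym2 (V d))} {Q : Config d → Prop}
    (hQ : Det (E : Set (Sym2 (V d))) {ω | Q ω}) : μ {ω | Q ω} = oR (pr p E (fun S => Q (cfg S))) := by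
  rw [← h.pr_eq]
  congr 1
  ext ω
  refine hQ ω _ ?_
  intro e he
  have he' : e ∈ E := he
  simp [cfg, he']
def Mon (Q : Config d → Prop) : Prop := ∀ ⦃ω ω' : Config d⦄, (∀ e, ω e = true → ω' e = true) → Q ω → Q ω'
theorem Mon.inc {Q : Config d → Prop} (h : Mon Q) : Inc (fun S => Q (cfg S)) := by
  intro S T hST
  refine h fun e he => ?_
  simp only [cfg, decide_eq_true_eq] at *
  exact hST he
theorem russo_meas (hJ : KernelHyp d J α c C) (hP : IsLRP J P) {E : Finset (Sym2 (V d))} {Q : Config d → Prop}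
    (hQ : Mon Q) (dQ : Det (E : Set (Sym2 (V d))) {ω | Q ω}) :
    ∃ f f' : ℝ → ℝ, (∀ β, 0 ≤ β → 0 ≤ f β ∧ f β ≤ 1 ∧ P β {ω | Q ω} = oR (f β)) ∧
      (∀ β, HasDerivAt f (f' β) β) ∧ ∀ β, 0 ≤ β → 0 ≤ f' β ∧
        oR (f' β) = ∑ e ∈ E, oR (wJ J e) * P β {ω | ¬ Q ω ∧ Q (opn e ω)} := by
  classical
  refine ⟨fun β => pr (pJ J β) E (fun S => Q (cfg S)),
    fun β => ∑ e ∈ E, wJ J e * pr (pJ J β) E (Piv e (fun S => Q (cfg S))), ?_, ?_, ?_⟩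
  · intro β hβ
    exact ⟨pr_nonneg (pJ_bd hJ hβ), pr_le_one (pJ_bd hJ hβ), fin_rep (isBer hJ hP hβ) dQ⟩
  · intro β
    exact russo (wJ J) hQ.inc β
  · intro β hβ
    have nn : ∀ e ∈ E, 0 ≤ wJ J e * pr (pJ J β) E (Piv e (fun S => Q (cfg S))) :=
      fun e _ => mul_nonneg (wJ_nonneg hJ e) (pr_nonneg (pJ_bd hJ hβ))
    refine ⟨Finset.sum_nonneg nn, ?_⟩
    rw [ENNReal.ofReal_sum_of_nonneg nn]
    refine Finset.sum_congr rfl fun e he => ?_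
    rw [ofReal_mul (wJ_nonneg hJ e)]
    congr 1
    rw [fin_rep (E := E) (isBer hJ hP hβ)]
    · congr 1
      refine pr_congr fun S hS => ?_
      have : opn e (cfg S) = cfg (insert e S) := by
        ext f
        by_cases hf : f = e
        · subst hf; simp [opn, cfg]
        · simp [opn, cfg, hf]
      simp only [Piv, this]
      constructor
      · rintro ⟨_, b, c⟩; refine ⟨b, ?_⟩; convert c
      · rintro ⟨b, c⟩; refine ⟨?_, b, ?_⟩
        · intro he; rw [Finset.insert_eq_of_mem he] at c; exact b c
        · convert c
    · intro ω ω' h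
      refine and_congr (not_congr (dQ ω ω' h)) (dQ _ _ ?_)
      intro f hf
      by_cases hfe : f = e
      · subst hfe; simp [opn]
      · simp [opn, hfe, h f hf]
theorem sym2_sum (D : FV d) (g : V d → V d → ℝ≥0∞) :
    ∑ u ∈ D, ∑ v ∈ D, g u v = ∑ e ∈ D.sym2, Sym2.lift ⟨fun u v => if u = v then g u u else g u v + g v u, by
      intro u v; by_cases h : u = v
      · subst h; simp
      · simp [h, Ne.symm h, add_comm]⟩ e := by
  classical
  rw [← Finset.sum_product', ← Finset.sum_fiberwise_of_maps_to (s := D ×ˢ D) (t := D.sym2) (g := fun x => s(x.1, x.2))]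
  · refine Finset.sum_congr rfl fun e he => ?_
    induction e with | _ u v =>
    have hu : u ∈ D ∧ v ∈ D := by simpa using he
    by_cases h : u = v
    · subst h
      have : (D ×ˢ D).filter (fun x => s(x.1, x.2) = s(u, u)) = {(u, u)} := by
        ext ⟨a, b⟩; simp; grind
      rw [this]; simp
    · have : (D ×ˢ D).filter (fun x => s(x.1, x.2) = s(u, v)) = {(u, v), (v, u)} := by
        ext ⟨a, b⟩; simp; grind
      rw [this, Finset.sum_pair]
      · simp [h]
      · simp [h]
  · rintro ⟨a, b⟩ h; simpa using h
theorem sym2_le {D : FV d} {g : V d → V d → ℝ≥0∞} {h : Sym2 (V d) → ℝ≥0∞}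
    (h1 : ∀ u ∈ D, ∀ v ∈ D, u ≠ v → h s(u, v) ≤ g u v + g v u) (h0 : ∀ u, h s(u, u) = 0) :
    ∑ e ∈ D.sym2, h e ≤ ∑ u ∈ D, ∑ v ∈ D, g u v := by
  rw [sym2_sum]
  refine Finset.sum_le_sum fun e he => ?_
  induction e with | _ u v =>
  have hu : u ∈ D ∧ v ∈ D := by simpa using he
  by_cases huv : u = v
  · subst huv; simp [h0]
  · simpa [huv] using h1 u hu.1 v hu.2 huv
theorem le_sym2 {D : FV d} {g : V d → V d → ℝ≥0∞} {h : Sym2 (V d) → ℝ≥0∞}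
    (h1 : ∀ u ∈ D, ∀ v ∈ D, u ≠ v → g u v + g v u ≤ h s(u, v)) (h0 : ∀ u, g u u = 0) :
    ∑ u ∈ D, ∑ v ∈ D, g u v ≤ ∑ e ∈ D.sym2, h e := by
  rw [sym2_sum]
  refine Finset.sum_le_sum fun e he => ?_
  induction e with | _ u v =>
  have hu : u ∈ D ∧ v ∈ D := by simpa using he
  by_cases huv : u = v
  · subst huv; simp [h0]
  · simpa [huv] using h1 u hu.1 v hu.2 huv
theorem inE_coe (D : FV d) : inE (D : SV d) = (D.sym2 : Set (Sym2 (V d))) := by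
  ext e; induction e with | _ a b => simp [inE]
theorem mon_connIn {D : SV d} {x y : V d} : Mon (fun ω : Config d => connIn ω D x y) :=
  fun _ _ h h' => connIn.agree h' fun e _ => h e
theorem det_fin {D : FV d} {x y : V d} : Det (D.sym2 : Set (Sym2 (V d))) {ω : Config d | connIn ω (D : SV d) x y} := by
  rw [← inE_coe]; exact det_connIn
theorem mono_fin (hJ : KernelHyp d J α c C) (hP : IsLRP J P) {E : Finset (Sym2 (V d))} {Q : Config d → Prop}
    (hQ : Mon Q) (dQ : Det (E : Set (Sym2 (V d))) {ω | Q ω}) {b b' : ℝ} (h0 : 0 ≤ b) (h : b ≤ b') :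
    P b {ω | Q ω} ≤ P b' {ω | Q ω} := by
  obtain ⟨f, f', h1, h2, h3⟩ := russo_meas hJ hP hQ dQ
  rw [(h1 b h0).2.2, (h1 b' (h0.trans h)).2.2]
  refine ofReal_le_ofReal ?_
  have : MonotoneOn f (Set.Ici 0) := by
    refine monotoneOn_of_deriv_nonneg (convex_Ici 0) (fun x _ => (h2 x).continuousAt.continuousWithinAt)
      (fun x _ => (h2 x).differentiableAt.differentiableWithinAt) ?_
    intro x hx
    rw [interior_Ici] at hx
    rw [(h2 x).deriv]
    exact (h3 x (le_of_lt hx)).1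
  exact this h0 (h0.trans h) h
end Setup
section Boxes
variable {d : ℕ}
theorem normInf_le {x : V d} {n : ℕ} : normInf x ≤ n ↔ ∀ i, (x i).natAbs ≤ n := by
  simp [normInf, Finset.sup_le_iff]
theorem normInf_neg (x : V d) : normInf (-x) = normInf x := by simp [normInf]
theorem normInf_sub_comm (x y : V d) : normInf (x - y) = normInf (y - x) := by
  rw [← normInf_neg, neg_sub]
theorem le_normInf (x : V d) (i : Fin d) : (x i).natAbs ≤ normInf x :=
  normInf_le.1 le_rfl i
theorem normInf_add_le (x y : V d) : normInf (x + y) ≤ normInf x + normInf y := by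
  rw [normInf_le]
  intro i
  have := le_normInf x i
  have := le_normInf y i
  simp only [Pi.add_apply]; omega
theorem normInf_eq_zero {x : V d} : normInf x = 0 ↔ x = 0 := by
  constructor
  · intro h; ext i; have := le_normInf x i; simp only [Pi.zero_apply]; omega
  · rintro rfl; simp [normInf]
theorem normInf_tri (x y z : V d) : normInf (x - z) ≤ normInf (x - y) + normInf (y - z) := by
  have := normInf_add_le (x - y) (y - z)
  simpa using this
noncomputable def bx (n : ℕ) : FV d := Finset.Icc (fun _ => -(n : ℤ)) (fun _ => (n : ℤ))
theorem mem_bx {n : ℕ} {x : V d} : x ∈ bx n ↔ normInf x ≤ n := by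
  rw [normInf_le, bx, Finset.mem_Icc, Pi.le_def, Pi.le_def, ← forall_and]
  refine forall_congr' fun i => ?_
  omega
theorem bx_mono {m n : ℕ} (h : m ≤ n) : (bx m : FV d) ⊆ bx n := fun x hx => by
  rw [mem_bx] at *; omega
theorem card_bx (n : ℕ) : (bx n : FV d).card = (2 * n + 1) ^ d := by
  have : (((n:ℤ) + 1 + (n:ℤ))).toNat = 2 * n + 1 := by omega
  simp [bx, Pi.card_Icc, this]
theorem zero_mem_bx (n : ℕ) : (0 : V d) ∈ (bx n : FV d) := by
  rw [mem_bx, normInf_eq_zero.2 rfl]; omega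
theorem connIn_exhaust {ω : Config d} {x y : V d} : connIn ω Set.univ x y ↔ ∃ n, connIn ω (bx n : FV d) x y := by
  constructor
  · intro h
    refine h.induct (Q := fun y => ∃ n, connIn ω (bx n : FV d) x y) ⟨normInf x, .refl ?_⟩ ?_
    · simp [mem_bx]
    · rintro a b _ ⟨n, hn⟩ _ hab
      refine ⟨max n (normInf b), (hn.mono ?_).tail ?_ hab⟩
      · exact Finset.coe_subset.2 (bx_mono (le_max_left _ _))
      · simp [mem_bx]
  · rintro ⟨n, hn⟩; exact hn.mono (Set.subset_univ _)
theorem tau_iSup (μ : Measure (Config d)) (x y : V d) : tau μ Set.univ x y = ⨆ n, tau μ (bx n : FV d) x y := by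
  unfold tau
  have : {ω : Config d | connIn ω Set.univ x y} = ⋃ n, {ω | connIn ω (bx n : FV d) x y} := by
    ext ω; simp [connIn_exhaust]
  rw [this, Monotone.measure_iUnion]
  intro m n h ω hω
  exact connIn.mono hω (Finset.coe_subset.2 (bx_mono h))
theorem tau_mono_bx (μ : Measure (Config d)) (x y : V d) : Monotone fun n => tau μ (bx n : FV d) x y :=
  fun _ _ h => tau_mono (Finset.coe_subset.2 (bx_mono h))
theorem tsum_tau_iSup (μ : Measure (Config d)) (x : V d) :
    ∑' y, tau μ Set.univ x y = ⨆ n, ∑' y, tau μ (bx n : FV d) x y := by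
  simp_rw [tau_iSup]
  simp_rw [ENNReal.tsum_eq_iSup_sum]
  rw [iSup_comm]
  congr 1; ext s
  exact ENNReal.finsetSum_iSup_of_monotone fun y => tau_mono_bx μ x y
theorem tsum_tau_eq_sum (μ : Measure (Config d)) (D : FV d) (x : V d) :
    ∑' y, tau μ (D : SV d) x y = ∑ y ∈ D, tau μ (D : SV d) x y :=
  tsum_eq_sum fun y hy => tau_notMem (by simpa using hy)
end Boxes
end Part4
section Part5
section Sharp
variable {d : ℕ} {J : V d → V d → ℝ} {α c C : ℝ} {P : ℝ → Measure (Config d)} {β : ℝ}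
theorem chi_eq : chi P β = ∑' y, tau (P β) Set.univ 0 y := by
  simp only [chi, twoPoint, tau, conn_iff]
theorem chi_at (hJ : KernelHyp d J α c C) (hP : IsLRP J P) (hβ : 0 ≤ β) (u : V d) :
    ∑' y, tau (P β) Set.univ u y = chi P β := by
  rw [chi_eq, ← (Equiv.subRight u).tsum_eq (fun y => tau (P β) Set.univ 0 y)]
  refine tsum_congr fun y => ?_
  rw [tau_univ (isBer hJ hP hβ) (TI_pJ hJ)]; rfl
theorem chi_D_le (hJ : KernelHyp d J α c C) (hP : IsLRP J P) (hβ : 0 ≤ β) (D : SV d) (u : V d) :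
    ∑' y, tau (P β) D u y ≤ chi P β := by
  rw [← chi_at hJ hP hβ u]
  exact ENNReal.tsum_le_tsum fun y => tau_mono (Set.subset_univ _)
theorem tau_mono_beta (hJ : KernelHyp d J α c C) (hP : IsLRP J P) {b b' : ℝ} (h0 : 0 ≤ b) (h : b ≤ b')
    (D : FV d) (x y : V d) : tau (P b) (D : SV d) x y ≤ tau (P b') (D : SV d) x y :=
  mono_fin hJ hP mon_connIn det_fin h0 h
theorem chi_mono (hJ : KernelHyp d J α c C) (hP : IsLRP J P) {b b' : ℝ} (h0 : 0 ≤ b) (h : b ≤ b') :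
    chi P b ≤ chi P b' := by
  rw [chi_eq, chi_eq, tsum_tau_iSup, tsum_tau_iSup]
  exact iSup_mono fun n => ENNReal.tsum_le_tsum fun y => tau_mono_beta hJ hP h0 h _ _ _
theorem one_le_chi (hJ : KernelHyp d J α c C) (hP : IsLRP J P) (hβ : 0 ≤ β) : 1 ≤ chi P β := by
  rw [chi_eq]
  refine le_trans ?_ (ENNReal.le_tsum 0)
  have : {ω : Config d | connIn ω Set.univ 0 0} = Set.univ := by
    ext ω; simp [connIn.refl]
  have := (isBer hJ hP hβ).prob
  simp [tau, *]
theorem tau_le_one (hJ : KernelHyp d J α c C) (hP : IsLRP J P) (hβ : 0 ≤ β) {D : SV d} {x y : V d} :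
    tau (P β) D x y ≤ 1 := by
  have := (isBer hJ hP hβ).prob
  exact prob_le_one
open Classical in
noncomputable def phi (μ : Measure (Config d)) (p : Sym2 (V d) → ℝ) (S : SV d) : ℝ≥0∞ :=
  ∑' a, if a ∈ S then 0 else ∑' b, tau μ S 0 b * oR (p s(b, a))
theorem sup_bound {M s f : ℝ≥0∞} (hM : M ≠ ∞) (hf : f < 1) (h : M ≤ s + f * M) : M ≤ s / (1 - f) := by
  have h1 : 1 - f ≠ 0 := (tsub_pos_of_lt hf).ne'
  rw [ENNReal.le_div_iff_mul_le (Or.inl h1) (Or.inl (by simp)), mul_comm, ENNReal.sub_mul (fun _ _ => hM), one_mul]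
  exact tsub_le_iff_right.2 h
theorem phi_lt (hJ : KernelHyp d J α c C) (hP : IsLRP J P) (hβ : 0 ≤ β) {S : FV d} (h0 : 0 ∈ S)
    (h : phi (P β) (pJ J β) S < 1) : chi P β ≠ ∞ := by
  classical
  have hB := isBer hJ hP hβ
  set φ := phi (P β) (pJ J β) S
  suffices chi P β ≤ S.card / (1 - φ) by
    refine ne_top_of_le_ne_top ?_ this
    exact ENNReal.div_ne_top (by simp) (tsub_pos_of_lt h).ne'
  rw [chi_eq, tsum_tau_iSup]
  refine iSup_le fun n => ?_
  set D : SV d := ((bx n : FV d) : SV d) with hD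
  set X : V d → ℝ≥0∞ := fun u => ∑' y, tau (P β) D u y with hX
  set M : ℝ≥0∞ := (bx n).sup X with hM
  have hXM : ∀ u, X u ≤ M := by
    intro u
    by_cases hu : u ∈ (bx n : FV d)
    · exact Finset.le_sup hu
    · have : X u = 0 := by
        simp only [hX]
        rw [ENNReal.tsum_eq_zero]
        exact fun y => tau_notMem' (by simpa [hD] using hu)
      simp [this]
  have hMtop : M ≠ ∞ := by
    refine ne_top_of_le_ne_top (ENNReal.natCast_ne_top (bx n : FV d).card) (Finset.sup_le fun u _ => ?_)
    simp only [hX, hD]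
    rw [tsum_tau_eq_sum]
    refine (Finset.sum_le_sum fun y _ => tau_le_one hJ hP hβ).trans ?_
    simp
  have key : M ≤ S.card + φ * M := by
    refine Finset.sup_le fun u hu => ?_
    obtain ⟨U, hU⟩ : ∃ U : SV d, U = D ∩ {v | v - u ∈ S} := ⟨_, rfl⟩
    have huU : u ∈ U := by rw [hU]; exact ⟨hu, by simpa using h0⟩
    have hUf : U.Finite := by rw [hU]; exact (Finset.finite_toSet _).inter_of_left _
    have hex := fun y => exit_lemma (D := D) (y := y) hB huU (Filter.Eventually.of_forall fun ω => hUf.subset Kc_subset)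
    have e1 : ∑' y, tau (P β) U u y ≤ S.card := by
      have : ∑' y, tau (P β) U u y ≤ ∑' y : V d, if y ∈ S.image (· + u) then 1 else 0 := by
        refine ENNReal.tsum_le_tsum fun y => ?_
        split_ifs with hy
        · exact tau_le_one hJ hP hβ
        · rw [tau_notMem]
          rw [hU]
          rintro ⟨_, h2⟩
          apply hy
          rw [Finset.mem_image]
          exact ⟨y - u, h2, by simp⟩
      refine this.trans ?_
      rw [tsum_eq_sum (s := S.image (· + u)) (fun b hb => if_neg hb)]
      simp only [Finset.sum_ite_mem, Finset.inter_self, Finset.sum_const, nsmul_eq_mul, mul_one]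
      exact_mod_cast Finset.card_image_le
    have e2 : ∑' a, (if a ∈ U then 0 else tau (P β) (insert a U) u a * ∑' y, tau (P β) (D \ {u}) a y) ≤ φ * M := by
      have e3 : φ = ∑' a, if a ∈ {v | v - u ∈ S} then 0 else ∑' b, tau (P β) {v | v - u ∈ S} u b * oR (pJ J β s(b, a)) := by
        simp only [φ, phi]
        rw [← (Equiv.subRight u).tsum_eq]
        refine tsum_congr fun a => ?_
        simp only [Equiv.subRight_apply, SetLike.mem_coe, Set.mem_ofPred_eq]
        split_ifs with ha
        · rfl
        rw [← (Equiv.subRight u).tsum_eq]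
        refine tsum_congr fun b => ?_
        have k1 := tau_shift (D := (S : SV d)) (x := 0) (y := b - u) hB (TI_pJ hJ) u
        have k2 := TI_pJ (β := β) hJ u s(b - u, a - u)
        simp only [Sym2.map_mk, sub_add_cancel, zero_add, SetLike.mem_coe] at k1 k2
        simp only [Equiv.subRight_apply]
        rw [k1, k2]
      rw [e3, ← ENNReal.tsum_mul_right]
      refine ENNReal.tsum_le_tsum fun a => ?_
      by_cases haU : a ∈ U
      · simp [haU]
      by_cases haD : a ∈ D
      swap
      · have : ∑' y, tau (P β) (D \ {u}) a y = 0 := by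
          rw [ENNReal.tsum_eq_zero]; exact fun y => tau_notMem' (fun h => haD h.1)
        simp [this]
      have ha : a ∉ {v | v - u ∈ S} := fun h => haU (by rw [hU]; exact ⟨haD, h⟩)
      simp only [haU, ha, if_false]
      refine mul_le_mul' ?_ ?_
      · refine (exit_prob hB haU).trans ?_
        rw [if_neg (by rintro rfl; exact haU huU), zero_add]
        exact ENNReal.tsum_le_tsum fun b => mul_le_mul' (tau_mono (by rw [hU]; exact Set.inter_subset_right)) le_rfl
      · exact (ENNReal.tsum_le_tsum fun y => tau_mono Set.sdiff_subset).trans (hXM a)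
    calc X u ≤ ∑' y, (tau (P β) U u y + ∑' a : V d, (if a ∈ U then 0 else tau (P β) (insert a U) u a * tau (P β) (D \ {u}) a y)) :=
          ENNReal.tsum_le_tsum hex
      _ = ∑' y, tau (P β) U u y + ∑' a, (if a ∈ U then 0 else tau (P β) (insert a U) u a * ∑' y, tau (P β) (D \ {u}) a y) := by
          rw [ENNReal.tsum_add]
          congr 1
          rw [ENNReal.tsum_comm]
          refine tsum_congr fun a => ?_
          split_ifs
          · simp
          · rw [ENNReal.tsum_mul_left]
      _ ≤ _ := add_le_add e1 e2
  exact (hXM 0).trans (sup_bound hMtop h key)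
def Tz (ω : Config d) (D Z : SV d) : SV d := {x | ∃ z ∈ Z, connIn ω D x z}
theorem Tz_inside {ω : Config d} {D Z : SV d} {y z : V d} (hz : z ∈ Z) (h : connIn ω D z y) :
    connIn ω (Tz ω D Z) y z := by
  refine (h.induct (Q := fun y => connIn ω (Tz ω D Z) z y) (.refl ⟨z, hz, .refl h.1⟩) ?_).symm
  intro a b h1 h2 h3 h4
  exact h2.tail ⟨z, hz, (h1.tail h3 h4).symm⟩ h4
theorem Tz_eq_iff {ω : Config d} {D Z B : SV d} (hZ : Z ⊆ D) : Tz ω D Z = B ↔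
    Z ⊆ B ∧ B ⊆ D ∧ (∀ y ∈ B, ∃ z ∈ Z, connIn ω B y z) ∧ ∀ b ∈ B, ∀ a ∈ D, a ∉ B → ¬ adj ω b a := by
  constructor
  · rintro rfl
    refine ⟨fun z hz => ⟨z, hz, .refl (hZ hz)⟩, fun y ⟨z, _, h⟩ => h.1, ?_, ?_⟩
    · rintro y ⟨z, hz, h⟩
      exact ⟨z, hz, Tz_inside hz h.symm⟩
    · rintro b ⟨z, hz, hb⟩ a ha hab h
      exact hab ⟨z, hz, (hb.symm.tail ha h).symm⟩
  · rintro ⟨h1, h2, h3, h4⟩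
    ext y
    constructor
    · rintro ⟨z, hz, h⟩
      refine connIn.induct (Q := fun y => y ∈ B) h.symm (h1 hz) ?_
      intro a b _ ha hb hab
      by_contra hbB
      exact h4 a ha b hb hbB hab
    · intro hy
      obtain ⟨z, hz, h⟩ := h3 y hy
      exact ⟨z, hz, h.mono h2⟩
theorem det_Tz {D Z B : SV d} (hZ : Z ⊆ D) : Det (toE B) {ω : Config d | Tz ω D Z = B} := by
  intro ω ω' h
  simp only [Set.mem_ofPred_eq, Tz_eq_iff hZ]
  refine and_congr_right fun _ => and_congr_right fun _ => and_congr ?_ ?_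
  · refine forall₂_congr fun y hy => exists_congr fun z => and_congr_right fun _ => ?_
    refine det_connIn ω ω' fun e he => h e ?_
    induction e with | _ a b => exact mem_toE.2 (Or.inl (mem_inE.1 he).1)
  · refine forall₂_congr fun y hy => forall₂_congr fun a ha => imp_congr_right fun _ => not_congr ?_
    refine det_adj ω ω' fun e he => h e ?_
    rw [Set.mem_singleton_iff.1 he]
    exact mem_toE.2 (Or.inl hy)
theorem meas_memTz {D Z : SV d} {x : V d} : MeasurableSet {ω : Config d | x ∈ Tz ω D Z} := by
  have : {ω : Config d | x ∈ Tz ω D Z} = ⋃ z, ({ω | z ∈ Z} ∩ {ω | connIn ω D x z}) := by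
    ext ω; simp [Tz]
  rw [this]
  exact MeasurableSet.iUnion fun z => (MeasurableSet.const _).inter meas_connIn
theorem meas_Tz {D Z B : SV d} : MeasurableSet {ω : Config d | Tz ω D Z = B} := by
  have : {ω : Config d | Tz ω D Z = B} = ⋂ y, {ω | y ∈ Tz ω D Z ↔ y ∈ B} := by
    ext ω; simp [Set.ext_iff]
  rw [this]
  exact MeasurableSet.iInter fun y => (meas_memTz (x := y) (D := D)).iff (MeasurableSet.const (y ∈ B))
theorem connIn_opn {ω : Config d} {D : SV d} {e : Sym2 (V d)} {x y : V d} (h : connIn ω D x y) :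
    connIn (opn e ω) D x y := mon_connIn (ω := ω) (by
      intro f hf
      by_cases hfe : f = e
      · subst hfe; simp [opn]
      · simp [opn, hfe, hf]) h
theorem adj_opn {ω : Config d} {u v : V d} (h : u ≠ v) : adj (opn s(u, v) ω) u v := ⟨h, by simp [opn]⟩
open Classical in
theorem dct_ineq (hJ : KernelHyp d J α c C) (hP : IsLRP J P) (hβ : 0 < β)
    (hphi : ∀ S : FV d, 0 ∈ S → 1 ≤ phi (P β) (pJ J β) S)
    {D L Z : FV d} (hZ : Z = D \ L) (h0 : 0 ∈ D)
    (herr : oR β * ∑' v, (if v ∈ D then 0 else ∑ u ∈ L, oR (J u v)) ≤ 1 / 2) :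
    oR (1 / (2 * β)) * P β {ω | ¬ (0 ∈ Tz ω D Z)} ≤
    ∑ e ∈ D.sym2, oR (wJ J e) * P β {ω | ¬ (0 ∈ Tz ω D Z) ∧ (0 ∈ Tz (opn e ω) D Z)} := by
  have hB := isBer hJ hP hβ.le
  set μ := P β
  have hZD : (Z : SV d) ⊆ D := by rw [hZ]; simp
  set G : V d → V d → Set (Config d) := fun u v =>
    {ω | 0 ∉ Tz ω D Z ∧ v ∈ Tz ω D Z ∧ connIn ω (D \ Tz ω D Z) 0 u}
  set Bs : Finset (FV d) := D.powerset.filter fun B => 0 ∉ B ∧ Z ⊆ B with hBs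
  set X : FV d → ℝ≥0∞ := fun B => ∑ u ∈ D, ∑ v ∈ B, oR (J u v) * tau μ ((D \ B : FV d) : SV d) 0 u
  have hX : ∀ B ∈ Bs, oR (1 / (2 * β)) ≤ X B := by
    intro B hBB
    rw [hBs, Finset.mem_filter, Finset.mem_powerset] at hBB
    obtain ⟨b1, b2, b3⟩ := hBB
    have h1 := hphi (D \ B) (by simp [h0, b2])
    have h2 : phi μ (pJ J β) ((D \ B : FV d) : SV d) ≤ oR β * X B + 1 / 2 := by
      refine le_trans ?_ (add_le_add le_rfl herr)
      have e1 : X B = ∑' v, if v ∈ B then ∑ u ∈ D, oR (J u v) * tau μ ((D \ B : FV d) : SV d) 0 u else 0 := by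
        rw [tsum_eq_sum (s := B) (by intro b hb; simp [hb]), Finset.sum_ite_mem, Finset.inter_self]
        exact Finset.sum_comm
      rw [e1, ← mul_add, ← ENNReal.tsum_add, ← ENNReal.tsum_mul_left]
      refine ENNReal.tsum_le_tsum fun a => ?_
      have hsum : ∑' b, tau μ ((D \ B : FV d) : SV d) 0 b * oR (pJ J β s(b, a)) ≤
         oR β * ∑ u ∈ D \ B, oR (J u a) * tau μ ((D \ B : FV d) : SV d) 0 u := by
        rw [tsum_eq_sum (s := D \ B) (by
          intro b hb
          rw [tau_notMem (by exact fun h => hb h)]; simp), Finset.mul_sum]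
        refine Finset.sum_le_sum fun u hu => ?_
        rw [← mul_assoc, ← ofReal_mul hβ.le, mul_comm]
        gcongr
        exact pJ_le hJ u a
      by_cases haB : a ∈ B
      · have : a ∉ D \ B := by simp [haB]
        simp only [haB, if_true, SetLike.mem_coe, this, if_false]
        refine hsum.trans ?_
        gcongr
        refine le_trans (Finset.sum_le_sum_of_subset Finset.sdiff_subset) le_self_add
      · by_cases haD : a ∈ D
        · simp [haB, haD]
        · simp only [haB, if_false, SetLike.mem_coe, haD, zero_add, Finset.mem_sdiff, false_and]
          refine hsum.trans ?_
          gcongr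
          refine le_trans (Finset.sum_le_sum fun u _ => mul_le_of_le_one_right' (tau_le_one hJ hP hβ.le)) ?_
          refine Finset.sum_le_sum_of_subset ?_
          intro u hu
          rw [Finset.mem_sdiff] at hu
          by_contra hL
          exact hu.2 (b3 (by rw [hZ]; simp [hu.1, hL]))
    have h3 : (1 : ℝ≥0∞) / 2 ≤ oR β * X B := by
      have : (1 : ℝ≥0∞) / 2 + 1 / 2 ≤ oR β * X B + 1 / 2 := by
        refine le_trans (le_of_eq ?_) (h1.trans h2)
        simp [ENNReal.inv_two_add_inv_two]
      exact (ENNReal.add_le_add_iff_right (by simp)).1 this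
    have e : oR (1 / (2 * β)) = (1 / 2) / oR β := by
      rw [show 1 / (2 * β) = (1 / 2) / β by field_simp, ENNReal.ofReal_div_of_pos hβ,
        ENNReal.ofReal_div_of_pos two_pos]
      simp
    rw [e]
    exact ENNReal.div_le_of_le_mul' h3
  have hGle : ∀ u v, ∑ B ∈ Bs, (if v ∈ B then μ {ω | Tz ω D Z = B} * tau μ ((D \ B : FV d) : SV d) 0 u else 0) ≤ μ (G u v) := by
    intro u v
    have e1 : ∀ B ∈ Bs, (if v ∈ B then μ {ω | Tz ω D Z = B} * tau μ ((D \ B : FV d) : SV d) 0 u else 0) =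
        μ ({ω | Tz ω D Z = B} ∩ {ω | v ∈ B ∧ connIn ω ((D \ B : FV d) : SV d) 0 u}) := by
      intro B hB'
      split_ifs with hv
      · simp only [hv, true_and]
        rw [hB.indep meas_Tz meas_connIn (det_Tz hZD) det_connIn]
        · rfl
        · refine disj_toE_inE _ ?_
          rw [Finset.coe_sdiff]; exact disjoint_sdiff_self_right
      · simp [hv]
    rw [Finset.sum_congr rfl e1, ← measure_biUnion_finset]
    · refine measure_mono ?_
      intro ω hω
      simp only [Set.mem_iUnion] at hω
      obtain ⟨B, hB', h1, h2, h3⟩ := hω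
      have h1' : Tz ω D Z = B := h1
      rw [hBs, Finset.mem_filter] at hB'
      refine ⟨?_, ?_, ?_⟩
      · rw [h1']; exact hB'.2.1
      · rw [h1']; exact h2
      · rw [h1']; rw [Finset.coe_sdiff] at h3; exact h3
    · intro B _ B' _ hBB
      refine Set.disjoint_left.2 ?_
      rintro ω ⟨h1, _⟩ ⟨h2, _⟩
      exact hBB (Finset.coe_injective (h1.symm.trans h2))
    · intro B _
      exact meas_Tz.inter ((MeasurableSet.const _).inter meas_connIn)
  have mG : ∀ u v, MeasurableSet (G u v) := by
    intro u v
    have : G u v = ⋃ B ∈ D.powerset, ({ω | Tz ω D Z = B} ∩ {ω | 0 ∉ B ∧ v ∈ B ∧ connIn ω (D \ B) 0 u}) := by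
      ext ω
      simp only [Set.mem_iUnion]
      constructor
      · intro h
        have hf : (Tz ω D Z).Finite := (Finset.finite_toSet D).subset fun y ⟨z, _, h⟩ => h.1
        refine ⟨hf.toFinset, ?_, by simp, ?_⟩
        · rw [Finset.mem_powerset]; intro y hy
          obtain ⟨z, _, h⟩ := (Set.Finite.mem_toFinset hf).1 hy; exact h.1
        · simpa [G] using h
      · rintro ⟨B, _, h1, h2⟩
        have h1' : Tz ω D Z = B := h1
        simp only [G, Set.mem_ofPred_eq, h1']
        exact h2
    rw [this]
    exact Finset.measurableSet_biUnion _ fun B _ => meas_Tz.inter ((MeasurableSet.const _).inter ((MeasurableSet.const _).inter meas_connIn))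
  calc oR (1 / (2 * β)) * μ {ω | ¬ (0 ∈ Tz ω D Z)}
      ≤ oR (1 / (2 * β)) * ∑ B ∈ Bs, μ {ω | Tz ω D Z = B} := by
        gcongr
        refine le_trans (measure_mono ?_) (measure_biUnion_finset_le _ _)
        intro ω hω
        simp only [Set.mem_iUnion]
        have hf : (Tz ω D Z).Finite := (Finset.finite_toSet D).subset fun y ⟨z, _, h⟩ => h.1
        refine ⟨hf.toFinset, ?_, by simp⟩
        rw [hBs, Finset.mem_filter, Finset.mem_powerset]
        refine ⟨?_, ?_, ?_⟩
        · intro y hy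
          obtain ⟨z, _, h⟩ := (Set.Finite.mem_toFinset hf).1 hy; exact h.1
        · simpa using hω
        · intro z hz; rw [Set.Finite.mem_toFinset]; exact ⟨z, hz, .refl (hZD hz)⟩
    _ ≤ ∑ B ∈ Bs, X B * μ {ω | Tz ω D Z = B} := by
        rw [Finset.mul_sum]
        exact Finset.sum_le_sum fun B hB' => mul_le_mul' (hX B hB') le_rfl
    _ = ∑ u ∈ D, ∑ v ∈ D, oR (J u v) * ∑ B ∈ Bs, (if v ∈ B then μ {ω | Tz ω D Z = B} * tau μ ((D \ B : FV d) : SV d) 0 u else 0) := by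
        simp_rw [Finset.mul_sum]
        have : ∀ u ∈ D, ∑ v ∈ D, ∑ B ∈ Bs, oR (J u v) * (if v ∈ B then μ {ω | Tz ω D Z = B} * tau μ ((D \ B : FV d) : SV d) 0 u else 0)
          = ∑ B ∈ Bs, ∑ v ∈ B, oR (J u v) * (μ {ω | Tz ω D Z = B} * tau μ ((D \ B : FV d) : SV d) 0 u) := by
          intro u _
          rw [Finset.sum_comm]
          refine Finset.sum_congr rfl fun B hB' => ?_
          simp_rw [mul_ite, mul_zero]
          rw [Finset.sum_ite_mem]
          rw [hBs, Finset.mem_filter, Finset.mem_powerset] at hB'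
          rw [Finset.inter_eq_right.2 hB'.1]
        rw [Finset.sum_congr rfl this, Finset.sum_comm]
        refine Finset.sum_congr rfl fun B _ => ?_
        rw [Finset.sum_mul]
        refine Finset.sum_congr rfl fun u _ => ?_
        rw [Finset.sum_mul]
        refine Finset.sum_congr rfl fun v _ => ?_
        ring
    _ ≤ ∑ u ∈ D, ∑ v ∈ D, oR (J u v) * μ (G u v) := by
        gcongr; exact hGle _ _
    _ ≤ _ := by
        refine le_sym2 ?_ ?_
        · intro u hu v hv huv
          rw [hJ.symm v u, ← mul_add, wJ_mk hJ]
          gcongr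
          rw [← measure_union _ (mG v u)]
          · refine measure_mono ?_
            have aux : ∀ u v, u ≠ v → u ∈ D → v ∈ D → ∀ ω ∈ G u v, 0 ∈ Tz (opn s(u, v) ω) D Z := by
              rintro u v huv hu hv ω ⟨_, ⟨z, hz, h2⟩, h3⟩
              refine ⟨z, hz, ?_⟩
              have k1 := connIn_opn (e := s(u, v)) (h3.mono Set.sdiff_subset)
              have k2 := connIn_opn (e := s(u, v)) h2
              exact (k1.tail hv (adj_opn huv)).trans k2
            rintro ω (h | h)
            · exact ⟨h.1, aux u v huv hu hv ω h⟩
            · refine ⟨h.1, ?_⟩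
              have := aux v u huv.symm hv hu ω h
              rwa [Sym2.eq_swap] at this
          · refine Set.disjoint_left.2 ?_
            rintro ω ⟨_, h2, _⟩ ⟨_, _, h3⟩
            exact h3.2.1.2 h2
        · intro u
          have : G u u = ∅ := by
            ext ω; simp only [Set.mem_empty_iff_false, iff_false]
            rintro ⟨_, h2, h3⟩
            exact h3.2.1.2 h2
          simp [this]
end Sharp
end Part5
section Part6
section Sharp2
variable {d : ℕ} {J : V d → V d → ℝ} {α c C : ℝ} {P : ℝ → Measure (Config d)} {β : ℝ}
def Perc (P : ℝ → Measure (Config d)) (β : ℝ) : Prop := 0 < P β {ω | ∃ x, (cluster ω x).Infinite}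
theorem mon_Tz {D Z : SV d} {x : V d} : Mon (fun ω : Config d => x ∈ Tz ω D Z) := by
  rintro ω ω' h ⟨z, hz, h'⟩
  exact ⟨z, hz, mon_connIn h h'⟩
theorem det_memTz {D : FV d} {Z : SV d} {x : V d} :
    Det (D.sym2 : Set (Sym2 (V d))) {ω : Config d | x ∈ Tz ω D Z} := by
  intro ω ω' h
  exact exists_congr fun z => and_congr_right fun _ => det_fin (x := x) (y := z) ω ω' h
open Classical in
theorem dct (hJ : KernelHyp d J α c C) (hP : IsLRP J P) {b b' : ℝ} (hb : 0 < b) (hbb : b < b')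
    (hchi : chi P b = ∞) : Perc P b' := by
  have hb' : 0 < b' := hb.trans hbb
  have := (isBer hJ hP hb'.le).prob
  set s : ℝ := (b' - b) * (1 / (2 * b')) with hs
  have hs0 : 0 < s := by have := sub_pos.2 hbb; positivity
  have key : ∀ n, oR (s / (1 + s)) ≤ P b' {ω | ∃ y, n < normInf y ∧ connIn ω Set.univ 0 y} := by
    intro n
    set L : FV d := bx n
    set F : V d → ℝ≥0∞ := fun v => ∑ u ∈ L, oR (J u v)
    have hF : ∑' v, F v ≠ ∞ := by
      simp only [F]
      rw [Summable.tsum_finsetSum (fun _ _ => ENNReal.summable)]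
      simp_rw [JJ_eq hJ]
      exact ENNReal.sum_ne_top.2 fun _ _ => JJ_fin hJ
    have hlim := ENNReal.tendsto_tsum_compl_atTop_zero hF
    have hpos : (0 : ℝ≥0∞) < oR (1 / (2 * b')) := ENNReal.ofReal_pos.2 (by positivity)
    obtain ⟨S, hS⟩ := ((hlim.eventually (gt_mem_nhds hpos)).and (Filter.eventually_ge_atTop L)).exists
    obtain ⟨hS, hLS⟩ := hS
    have hbig : ∀ t, b ≤ t → t ≤ b' → oR t * ∑' v, (if v ∈ S then 0 else F v) ≤ 1 / 2 := by
      intro t _ ht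
      have e : ∑' v, (if v ∈ S then 0 else F v) = ∑' v : {v // v ∉ S}, F v := by
        have := tsum_subtype {v | v ∉ S} F
        refine Eq.trans ?_ this.symm
        refine tsum_congr fun v => ?_
        by_cases h : v ∈ S <;> simp [h]
      rw [e]
      calc _ ≤ oR b' * oR (1 / (2 * b')) := by gcongr
        _ = oR (1 / 2) := by
            rw [← ofReal_mul hb'.le]; congr 1; field_simp
        _ = 1 / 2 := by rw [ENNReal.ofReal_div_of_pos two_pos]; simp
    set Z : FV d := S \ L with hZ
    obtain ⟨f, f', h1, h2, h3⟩ := russo_meas hJ hP (mon_Tz (D := (S : SV d)) (Z := (Z : SV d)) (x := 0)) det_memTz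
    have hineq : ∀ t, b ≤ t → t ≤ b' → 1 / (2 * t) * (1 - f t) ≤ f' t := by
      intro t ht ht'
      have ht0 : 0 < t := hb.trans_le ht
      have hpr := (isBer hJ hP ht0.le).prob
      have := dct_ineq hJ hP ht0 (fun U hU => by
        by_contra hlt
        refine phi_lt hJ hP ht0.le hU (not_le.1 hlt) ?_
        exact top_le_iff.1 (hchi ▸ chi_mono hJ hP hb.le ht)) hZ (hLS (zero_mem_bx n)) (hbig t ht ht')
      rw [← (h3 t ht0.le).2] at this
      have e : P t {ω | ¬ (0 ∈ Tz ω S Z)} = oR (1 - f t) := by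
        have := prob_compl_eq_one_sub (μ := P t) (meas_memTz (D := (S : SV d)) (Z := (Z : SV d)) (x := 0))
        rw [ENNReal.ofReal_sub _ (h1 t ht0.le).1, ← (h1 t ht0.le).2.2, ofReal_one]
        exact this
      rw [e, ← ofReal_mul (by positivity)] at this
      exact (ofReal_le_ofReal_iff (h3 t ht0.le).1).1 this
    obtain ⟨t, ht, hslope⟩ := exists_hasDerivAt_eq_slope f f' hbb
      (fun x _ => (h2 x).continuousAt.continuousWithinAt) (fun x _ => h2 x)
    have hmono : f t ≤ f b' := by
      have := mono_fin hJ hP (mon_Tz (D := (S : SV d)) (Z := (Z : SV d)) (x := 0)) det_memTz (hb.trans ht.1).le ht.2.le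
      rw [(h1 t (hb.trans ht.1).le).2.2, (h1 b' hb'.le).2.2] at this
      exact (ofReal_le_ofReal_iff (h1 b' hb'.le).1).1 this
    have hf' := hineq t ht.1.le ht.2.le
    have hfin : s / (1 + s) ≤ f b' := by
      have k1 : 1 / (2 * b') * (1 - f b') ≤ f' t := by
        refine le_trans ?_ hf'
        have := (h1 b' hb'.le).2.1
        have ht0 : 0 < t := hb.trans ht.1
        have := ht.2
        gcongr
      rw [hslope, le_div_iff₀ (sub_pos.2 hbb)] at k1
      have k2 := (h1 b hb.le).1
      rw [div_le_iff₀ (by positivity)]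
      have : s * (1 - f b') ≤ f b' - f b := by rw [hs]; linarith
      nlinarith
    refine (ofReal_le_ofReal hfin).trans ?_
    rw [← (h1 b' hb'.le).2.2]
    refine measure_mono ?_
    rintro ω ⟨z, hz, h⟩
    refine ⟨z, ?_, h.mono (Set.subset_univ _)⟩
    rw [hZ, Finset.mem_coe, Finset.mem_sdiff] at hz
    exact not_le.1 fun h => hz.2 (mem_bx.2 h)
  have hanti : Antitone fun n : ℕ => {ω : Config d | ∃ y, n < normInf y ∧ connIn ω Set.univ 0 y} := by
    rintro m n h ω ⟨y, hy, h'⟩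
    exact ⟨y, lt_of_le_of_lt h hy, h'⟩
  have hm : ∀ n : ℕ, MeasurableSet {ω : Config d | ∃ y, n < normInf y ∧ connIn ω Set.univ 0 y} := by
    intro n
    have : {ω : Config d | ∃ y, n < normInf y ∧ connIn ω Set.univ 0 y} =
      ⋃ y, ({ω | n < normInf y} ∩ {ω | connIn ω Set.univ 0 y}) := by ext ω; simp
    rw [this]
    exact MeasurableSet.iUnion fun y => (MeasurableSet.const _).inter meas_connIn
  have hI := hanti.measure_iInter (μ := P b') (fun n => (hm n).nullMeasurableSet) ⟨0, measure_ne_top _ _⟩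
  have : 0 < P b' (⋂ n : ℕ, {ω : Config d | ∃ y, n < normInf y ∧ connIn ω Set.univ 0 y}) := by
    rw [hI]
    exact lt_of_lt_of_le (ENNReal.ofReal_pos.2 (by positivity)) (le_iInf key)
  refine lt_of_lt_of_le this (measure_mono ?_)
  intro ω hω
  refine ⟨0, fun hfin => ?_⟩
  rw [cluster_eq] at hfin
  simp only [Set.mem_iInter] at hω
  obtain ⟨y, hy, h⟩ := hω (hfin.toFinset.sup normInf)
  exact absurd (Finset.le_sup (f := normInf) (hfin.mem_toFinset.2 h)) (not_le.2 hy)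
theorem chi_zero_fin (hJ : KernelHyp d J α c C) (hP : IsLRP J P) : chi P 0 ≠ ∞ := by
  refine phi_lt hJ hP le_rfl (S := {0}) (by simp) ?_
  simp [phi, pJ]
theorem chi_fin (hJ : KernelHyp d J α c C) (hP : IsLRP J P) (h0 : 0 ≤ β) (h : β < betaC P) : chi P β ≠ ∞ := by
  intro hinf
  rcases h0.eq_or_lt with rfl | h0
  · exact chi_zero_fin hJ hP hinf
  obtain ⟨b', h1, h2⟩ := exists_between h
  have := dct hJ hP h0 h1 hinf
  have h3 : betaC P ≤ b' := csInf_le ⟨0, fun x hx => hx.1⟩ ⟨(h0.trans h1).le, this⟩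
  exact absurd h3 (not_le.2 h2)
theorem perc_chi (hJ : KernelHyp d J α c C) (hP : IsLRP J P) (h0 : 0 ≤ β) (h : Perc P β) : chi P β = ∞ := by
  by_contra hfin
  have : ∀ᵐ ω ∂(P β), ∀ x, (Kc ω Set.univ x).Finite :=
    ae_all_iff.2 fun x => ae_fin (by rwa [chi_at hJ hP h0])
  refine h.ne' (measure_mono_null ?_ (ae_iff.1 this))
  rintro ω ⟨x, hx⟩ h
  exact hx (by rw [cluster_eq]; exact h x)
theorem opn_split {ω : Config d} {D : SV d} {x y u v : V d}
    (h : connIn (opn s(u, v) ω) D x y) (hn : ¬ connIn ω D x y) (hu : u ∈ D) (hv : v ∈ D) :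
    (connIn ω D x u ∧ connIn ω D v y) ∨ (connIn ω D x v ∧ connIn ω D u y) := by
  refine (h.induct (Q := fun z => connIn ω D x z ∨ (connIn ω D x u ∧ connIn ω D v z) ∨ (connIn ω D x v ∧ connIn ω D u z))
    (Or.inl (.refl h.1)) ?_).resolve_left hn
  intro a b _ hQ hb hab
  by_cases he : s(a, b) = s(u, v)
  · rw [Sym2.eq_iff] at he
    rcases he with ⟨rfl, rfl⟩ | ⟨rfl, rfl⟩
    · rcases hQ with h | ⟨h, _⟩ | ⟨h, _⟩
      · exact Or.inr (Or.inl ⟨h, .refl hb⟩)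
      · exact Or.inr (Or.inl ⟨h, .refl hb⟩)
      · exact Or.inl h
    · rcases hQ with h | ⟨h, _⟩ | ⟨h, _⟩
      · exact Or.inr (Or.inr ⟨h, .refl hb⟩)
      · exact Or.inl h
      · exact Or.inr (Or.inr ⟨h, .refl hb⟩)
  · have hab' : adj ω a b := ⟨hab.1, by have := hab.2; simpa [opn, he] using this⟩
    rcases hQ with h | ⟨h, h'⟩ | ⟨h, h'⟩
    · exact Or.inl (h.tail hb hab')
    · exact Or.inr (Or.inl ⟨h, h'.tail hb hab'⟩)
    · exact Or.inr (Or.inr ⟨h, h'.tail hb hab'⟩)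
theorem chiD_deriv (hJ : KernelHyp d J α c C) (hP : IsLRP J P) (D : FV d) (x : V d) :
    ∃ g g' : ℝ → ℝ, (∀ t, 0 ≤ t → 0 ≤ g t ∧ ∑' y, tau (P t) D x y = oR (g t)) ∧
      (∀ t, HasDerivAt g (g' t) t) ∧ ∀ t, 0 ≤ t → 0 ≤ g' t ∧ oR (g' t) =
        ∑ y ∈ D, ∑ e ∈ D.sym2, oR (wJ J e) * P t {ω | ¬ connIn ω D x y ∧ connIn (opn e ω) D x y} := by
  choose f f' h1 h2 h3 using fun y => russo_meas hJ hP (mon_connIn (D := (D : SV d)) (x := x) (y := y)) det_fin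
  refine ⟨fun t => ∑ y ∈ D, f y t, fun t => ∑ y ∈ D, f' y t, ?_, ?_, ?_⟩
  · intro t ht
    refine ⟨Finset.sum_nonneg fun y _ => (h1 y t ht).1, ?_⟩
    rw [tsum_tau_eq_sum, ENNReal.ofReal_sum_of_nonneg fun y _ => (h1 y t ht).1]
    exact Finset.sum_congr rfl fun y _ => (h1 y t ht).2.2
  · intro t; exact HasDerivAt.fun_sum fun y _ => h2 y t
  · intro t ht
    refine ⟨Finset.sum_nonneg fun y _ => (h3 y t ht).1, ?_⟩
    rw [ENNReal.ofReal_sum_of_nonneg fun y _ => (h3 y t ht).1]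
    exact Finset.sum_congr rfl fun y _ => (h3 y t ht).2
theorem deriv_upper (hJ : KernelHyp d J α c C) (hP : IsLRP J P) (hβ : 0 ≤ β) (D : FV d) (x : V d) {M : ℝ≥0∞}
    (hM : ∀ u ∈ D, ∑' y, tau (P β) D u y ≤ M) (hx : x ∈ D) :
    ∑ y ∈ D, ∑ e ∈ D.sym2, oR (wJ J e) * P β {ω | ¬ connIn ω D x y ∧ connIn (opn e ω) D x y}
      ≤ JJ J * M * M := by
  have hB := isBer hJ hP hβ
  have hf : ∀ x, ∀ᵐ ω ∂(P β), (Kc ω D x).Finite := fun x =>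
    Filter.Eventually.of_forall fun ω => (Finset.finite_toSet D).subset Kc_subset
  have h1 : ∀ y ∈ D, ∑ e ∈ D.sym2, oR (wJ J e) * P β {ω | ¬ connIn ω D x y ∧ connIn (opn e ω) D x y}
      ≤ ∑ u ∈ D, ∑ v ∈ D, oR (J u v) * (tau (P β) D x u * tau (P β) D v y) := by
    intro y _
    refine sym2_le ?_ ?_
    · intro u hu v hv _
      rw [wJ_mk hJ, hJ.symm v u, ← mul_add]
      gcongr
      refine le_trans (measure_mono ?_) ((measure_union_le _ _).trans (add_le_add (piv_bound hB (hf x)) (piv_bound hB (hf x))))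
      rintro ω ⟨h1, h2⟩
      rcases opn_split h2 h1 hu hv with h | h
      · exact Or.inl ⟨h.1, h.2, h1⟩
      · exact Or.inr ⟨h.1, h.2, h1⟩
    · intro u
      have : {ω : Config d | ¬ connIn ω D x y ∧ connIn (opn s(u, u) ω) D x y} = ∅ := by
        ext ω
        simp only [Set.mem_empty_iff_false, iff_false]
        rintro ⟨h1, h2⟩
        refine h1 (h2.induct (Q := fun z => connIn ω D x z) (.refl h2.1) fun a b _ h3 h4 h5 => h3.tail h4 ⟨h5.1, ?_⟩)
        have : s(a, b) ≠ s(u, u) := by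
          intro he; rw [Sym2.eq_iff] at he
          rcases he with ⟨rfl, rfl⟩ | ⟨rfl, rfl⟩ <;> exact h5.1 rfl
        simpa [opn, this] using h5.2
      simp [this]
  refine (Finset.sum_le_sum h1).trans ?_
  calc ∑ y ∈ D, ∑ u ∈ D, ∑ v ∈ D, oR (J u v) * (tau (P β) D x u * tau (P β) D v y)
      = ∑ u ∈ D, tau (P β) D x u * ∑ v ∈ D, oR (J u v) * ∑ y ∈ D, tau (P β) D v y := by
        rw [Finset.sum_comm]
        refine Finset.sum_congr rfl fun u _ => ?_
        rw [Finset.sum_comm, Finset.mul_sum]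
        refine Finset.sum_congr rfl fun v _ => ?_
        rw [Finset.mul_sum, Finset.mul_sum]
        refine Finset.sum_congr rfl fun y _ => ?_
        ring
    _ ≤ ∑ u ∈ D, tau (P β) D x u * (JJ J * M) := by
        refine Finset.sum_le_sum fun u _ => mul_le_mul' le_rfl ?_
        rw [← JJ_eq hJ u]
        refine le_trans (Finset.sum_le_sum fun v hv => mul_le_mul' le_rfl (?_ : _ ≤ M)) ?_
        · rw [← tsum_tau_eq_sum]; exact hM v hv
        · rw [← Finset.sum_mul]
          gcongr
          exact ENNReal.sum_le_tsum _
    _ ≤ JJ J * M * M := by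
        rw [← Finset.sum_mul, mul_comm]
        gcongr
        rw [← tsum_tau_eq_sum]; exact hM x hx
theorem chi_growth (hJ : KernelHyp d J α c C) (hP : IsLRP J P) (hβ : 0 ≤ β) (hfin : chi P β ≠ ∞) {δ : ℝ} (hδ : 0 ≤ δ)
    (h : 4 * (JJ J).toReal * (chi P β).toReal * δ < 1) : chi P (β + δ) ≤ 2 * chi P β := by
  have hδ' := add_nonneg hβ hδ
  set m := (chi P β).toReal with hm
  have hme : chi P β = oR m := (ofReal_toReal hfin).symm
  have hm1 : 1 ≤ m := by
    have := one_le_chi hJ hP hβ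
    rw [hme] at this
    exact ENNReal.one_le_ofReal.1 this
  rw [chi_eq, tsum_tau_iSup]
  refine iSup_le fun n => ?_
  set D : FV d := bx n
  have hne : D.Nonempty := ⟨0, zero_mem_bx n⟩
  choose g g' h1 h2 h3 using chiD_deriv hJ hP D
  set M : ℝ → ℝ := fun t => D.sup' hne fun u => g u t
  have hMc : Continuous M := Continuous.finset_sup'_apply hne fun u _ =>
    continuous_iff_continuousAt.2 fun t => (h2 u t).continuousAt
  have hle : ∀ u ∈ D, ∀ t, g u t ≤ M t := fun u hu t => Finset.le_sup' (fun u => g u t) hu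
  have hmon : ∀ u, ∀ t t', 0 ≤ t → t ≤ t' → g u t ≤ g u t' := by
    intro u t t' ht htt
    rw [← ofReal_le_ofReal_iff (h1 u t' (ht.trans htt)).1, ← (h1 u t ht).2, ← (h1 u t' (ht.trans htt)).2]
    exact ENNReal.tsum_le_tsum fun y => tau_mono_beta hJ hP ht htt D u y
  have hMβ : ∀ u, g u β ≤ m := by
    intro u
    rw [← ofReal_le_ofReal_iff (by positivity), ← (h1 u β hβ).2, ← hme]
    exact chi_D_le hJ hP hβ _ _
  have hgoal : M (β + δ) ≤ 2 * m := by
    by_contra hcon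
    push Not at hcon
    have hMb : M β ≤ m := Finset.sup'_le _ _ fun u _ => hMβ u
    obtain ⟨t, ht, hMt⟩ := intermediate_value_Icc (le_add_of_nonneg_right hδ : β ≤ β + δ) hMc.continuousOn
      (show 2 * m ∈ Set.Icc (M β) (M (β + δ)) from ⟨by linarith, hcon.le⟩)
    obtain ⟨u, hu, hMu⟩ := Finset.exists_mem_eq_sup' hne fun u => g u t
    have hut : g u t = 2 * m := hMu.symm.trans hMt
    have hlt : β < t := by
      rcases ht.1.eq_or_lt with h | h
      · have := hMβ u; rw [h, hut] at this; linarith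
      · exact h
    obtain ⟨s, hs, hsl⟩ := exists_hasDerivAt_eq_slope (g u) (g' u) hlt
      (fun x _ => (h2 u x).continuousAt.continuousWithinAt) (fun x _ => h2 u x)
    have hs0 : 0 ≤ s := hβ.trans hs.1.le
    have hder : g' u s ≤ (JJ J).toReal * (2 * m) * (2 * m) := by
      rw [← ofReal_le_ofReal_iff (by positivity), (h3 u s hs0).2]
      refine (deriv_upper hJ hP hs0 D u (M := oR (2 * m)) ?_ hu).trans (le_of_eq ?_)
      · intro w hw
        rw [(h1 w s hs0).2]
        refine ofReal_le_ofReal ((hmon w s t hs0 hs.2.le).trans ((hle w hw t).trans hMt.le))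
      · rw [ofReal_mul (p := _ * _) (by positivity), ofReal_mul (p := (JJ J).toReal) (by positivity), ofReal_toReal (JJ_fin hJ)]
    rw [hsl, div_le_iff₀ (sub_pos.2 hlt), hut] at hder
    have k1 := hMβ u
    have k2 : t - β ≤ δ := by linarith [ht.2]
    have k3 : (JJ J).toReal * (2 * m) * (2 * m) * (t - β) ≤ (JJ J).toReal * (2 * m) * (2 * m) * δ := by gcongr
    have k4 : (JJ J).toReal * (2 * m) * (2 * m) * δ = m * (4 * (JJ J).toReal * m * δ) := by ring
    have k5 : m * (4 * (JJ J).toReal * m * δ) < m * 1 := by gcongr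
    linarith
  rw [(h1 0 _ hδ').2, hme, ← ENNReal.ofReal_ofNat, ← ofReal_mul (by norm_num)]
  exact ofReal_le_ofReal ((hle 0 (zero_mem_bx n) _).trans hgoal)
theorem betaC_gap (hJ : KernelHyp d J α c C) (hP : IsLRP J P) (hne : ∃ b, 0 ≤ b ∧ Perc P b)
    (hβ : 0 ≤ β) (hfin : chi P β ≠ ∞) {δ : ℝ} (hδ : 0 ≤ δ)
    (h : 4 * (JJ J).toReal * (chi P β).toReal * δ < 1) : β + δ ≤ betaC P := by
  refine le_csInf hne fun b hb => ?_
  by_contra hlt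
  have h1 := perc_chi hJ hP hb.1 hb.2
  have h2 := (chi_mono hJ hP hb.1 (not_le.1 hlt).le).trans (chi_growth hJ hP hβ hfin hδ h)
  rw [h1, top_le_iff] at h2
  exact ENNReal.mul_ne_top (by simp) hfin h2
end Sharp2
end Part6
section Part7
theorem tree_split {ι : Type*} [DecidableEq ι] {K : Finset ι} {u : ι} (hu : u ∈ K) {par : ι → ι} {dep : ι → ℕ}
    (h : ∀ k ∈ K, k ≠ u → par k ∈ K ∧ dep (par k) < dep k) {n : ℕ} (hn : 1 ≤ n) (hK : 3 * n ≤ K.card) :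
    ∃ I : Finset ι, ∃ i ∈ K, I ⊆ K ∧ u ∉ I ∧ i ∉ I ∧ (∀ k ∈ I, par k ∈ I ∨ par k = i) ∧
      (∀ k ∈ K, k ≠ u → k ∉ I → par k ∉ I) ∧ n ≤ I.card + 1 ∧ I.card + 2 ≤ 2 * n := by
  have main : ∀ N, ∀ I : Finset ι, I.card = N → ∀ i ∈ K, I ⊆ K → u ∉ I → i ∉ I → (∀ k ∈ I, par k ∈ I ∨ par k = i) →
      (∀ k ∈ K, k ≠ u → k ∉ I → par k ∉ I) → n ≤ I.card + 1 →
      ∃ I : Finset ι, ∃ i ∈ K, I ⊆ K ∧ u ∉ I ∧ i ∉ I ∧ (∀ k ∈ I, par k ∈ I ∨ par k = i) ∧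
      (∀ k ∈ K, k ≠ u → k ∉ I → par k ∉ I) ∧ n ≤ I.card + 1 ∧ I.card + 2 ≤ 2 * n := by
    intro N
    induction N using Nat.strong_induction_on with
    | _ N ih =>
    intro I hN i hi hIK huI hiI hpar hcl hnI
    by_cases hsmall : I.card + 2 ≤ 2 * n
    · exact ⟨I, i, hi, hIK, huI, hiI, hpar, hcl, hnI, hsmall⟩
    have hne : I.Nonempty := Finset.card_pos.1 (by omega)
    have hneu : ∀ k ∈ I, k ≠ u := fun k hk hku => huI (hku ▸ hk)
    obtain ⟨j, hj, hjmin⟩ := Finset.exists_min_image I dep hne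
    have hji : par j = i := by
      refine (hpar j hj).resolve_left fun hp => ?_
      have := (h j (hIK hj) (hneu j hj)).2
      have := hjmin _ hp
      omega
    classical
    set T : Finset ι := I.filter fun k => Relation.ReflTransGen (fun a b => a ∈ I ∧ par a = b) k j with hT
    have hTs : T ⊆ I := Finset.filter_subset _ _
    have hjT : j ∈ T := Finset.mem_filter.2 ⟨hj, .refl⟩
    have hTpar : ∀ k ∈ T, k ≠ j → par k ∈ T := by
      intro k hk hkj
      obtain ⟨hkI, hm⟩ := Finset.mem_filter.1 hk
      obtain hm | ⟨b, ⟨_, rfl⟩, hm⟩ := hm.cases_head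
      · exact absurd hm hkj
      · refine Finset.mem_filter.2 ⟨?_, hm⟩
        obtain hm | ⟨b, hb, _⟩ := hm.cases_head
        · rw [hm]; exact hj
        · exact hb.1
    have hTcl : ∀ k ∈ K, k ≠ u → k ∉ T → par k ∉ T := by
      intro k hkK hku hkT hp
      obtain ⟨hpI, hm⟩ := Finset.mem_filter.1 hp
      by_cases hkI : k ∈ I
      · exact hkT (Finset.mem_filter.2 ⟨hkI, hm.head ⟨hkI, rfl⟩⟩)
      · exact hcl k hkK hku hkI hpI
    have hiT : i ∉ T := fun hh => hiI (hTs hh)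
    have huT : u ∉ T := fun hh => huI (hTs hh)
    by_cases hTI : T = I
    · refine ih _ ?_ (I.erase j) rfl j (hIK hj) ((Finset.erase_subset _ _).trans hIK) (fun hh => huI (Finset.mem_of_mem_erase hh)) (Finset.notMem_erase _ _) ?_ ?_ ?_
      · rw [← hN]; exact Finset.card_erase_lt_of_mem hj
      · intro k hk
        obtain ⟨hkj, hkI⟩ := Finset.mem_erase.1 hk
        have := hTpar k (hTI ▸ hkI) hkj
        rw [hTI] at this
        by_cases hpj : par k = j
        · exact Or.inr hpj
        · exact Or.inl (Finset.mem_erase.2 ⟨hpj, this⟩)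
      · intro k hk hku hkI hp
        by_cases hkj : k = j
        · subst hkj; rw [hji] at hp; exact hiI (Finset.mem_of_mem_erase hp)
        · exact hcl k hk hku (fun hh => hkI (Finset.mem_erase.2 ⟨hkj, hh⟩)) (Finset.mem_of_mem_erase hp)
      · rw [Finset.card_erase_of_mem hj]; omega
    · have hlt : T.card < I.card := Finset.card_lt_card (Finset.ssubset_iff_subset_ne.2 ⟨hTs, hTI⟩)
      have hTpos : 0 < T.card := Finset.card_pos.2 ⟨j, hjT⟩
      have hc := Finset.card_sdiff_add_card_eq_card hTs
      by_cases hTn : n ≤ T.card + 1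
      · refine ih _ (hN ▸ hlt) T rfl i hi (hTs.trans hIK) huT hiT ?_ hTcl hTn
        intro k hk
        by_cases hkj : k = j
        · subst hkj; exact Or.inr hji
        · exact Or.inl (hTpar k hk hkj)
      · refine ih (I \ T).card (by omega) (I \ T) rfl i hi (Finset.sdiff_subset.trans hIK) (fun hh => huI (Finset.sdiff_subset hh)) (fun hh => hiI (Finset.sdiff_subset hh)) ?_ ?_ (by omega)
        · intro k hk
          obtain ⟨hk1, hk2⟩ := Finset.mem_sdiff.1 hk
          refine (hpar k hk1).imp_left fun hp => Finset.mem_sdiff.2 ⟨hp, hTcl k (hIK hk1) (hneu k hk1) hk2⟩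
        · intro k hk hku hkn hp
          obtain ⟨hp1, hp2⟩ := Finset.mem_sdiff.1 hp
          by_cases hkI : k ∈ I
          · have hkT : k ∈ T := by by_contra hh; exact hkn (Finset.mem_sdiff.2 ⟨hkI, hh⟩)
            by_cases hkj : k = j
            · subst hkj; rw [hji] at hp1; exact hiI hp1
            · exact hp2 (hTpar k hkT hkj)
          · exact hcl k hk hku hkI hp1
  refine main _ (K.erase u) rfl u hu (Finset.erase_subset _ _) (Finset.notMem_erase _ _) (Finset.notMem_erase _ _) ?_ ?_ ?_
  · intro k hk
    obtain ⟨h1, h2⟩ := Finset.mem_erase.1 hk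
    by_cases hp : par k = u
    · exact Or.inr hp
    · exact Or.inl (Finset.mem_erase.2 ⟨hp, (h k h2 h1).1⟩)
  · intro k hk hku hkI
    exact absurd (Finset.mem_erase.2 ⟨hku, hk⟩) hkI
  · rw [Finset.card_erase_of_mem hu]; omega
section BKm
variable {d : ℕ} {p : Sym2 (V d) → ℝ} {μ : Measure (Config d)}
def DO (Q R : Config d → Prop) (ω : Config d) : Prop :=
  ∃ S₁ S₂ : Finset (Sym2 (V d)), Disjoint S₁ S₂ ∧ (∀ e ∈ S₁, ω e = true) ∧ (∀ e ∈ S₂, ω e = true) ∧ Q (cfg S₁) ∧ R (cfg S₂)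
theorem DO.mon {Q R : Config d → Prop} : Mon (DO Q R) := by
  rintro ω ω' h ⟨S₁, S₂, h1, h2, h3, h4⟩
  exact ⟨S₁, S₂, h1, fun e he => h e (h2 e he), fun e he => h e (h3 e he), h4⟩
theorem det_cfg {E : Finset (Sym2 (V d))} {Q : Config d → Prop} (hQ : Det (E : Set (Sym2 (V d))) {ω | Q ω})
    {S : Finset (Sym2 (V d))} (h : Q (cfg S)) : Q (cfg (S ∩ E)) :=
  (hQ (cfg S) (cfg (S ∩ E)) (fun e he => by have : e ∈ E := he; simp [cfg, this])).1 h
theorem DO.det {E : Finset (Sym2 (V d))} {Q R : Config d → Prop} (hQ : Det (E : Set (Sym2 (V d))) {ω | Q ω})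
    (hR : Det (E : Set (Sym2 (V d))) {ω | R ω}) : Det (E : Set (Sym2 (V d))) {ω | DO Q R ω} := by
  have : ∀ ω ω' : Config d, (∀ e ∈ (E : Set (Sym2 (V d))), ω e = ω' e) → DO Q R ω → DO Q R ω' := by
    rintro ω ω' h ⟨S₁, S₂, h1, h2, h3, h4, h5⟩
    refine ⟨S₁ ∩ E, S₂ ∩ E, h1.mono Finset.inter_subset_left Finset.inter_subset_left, ?_, ?_, det_cfg hQ h4, det_cfg hR h5⟩
    · intro e he; rw [Finset.mem_inter] at he; rw [← h e he.2, h2 e he.1]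
    · intro e he; rw [Finset.mem_inter] at he; rw [← h e he.2, h3 e he.1]
  exact fun ω ω' h => ⟨this ω ω' h, this ω' ω fun e he => (h e he).symm⟩
theorem bk_meas (h : IsBer p μ) {E : Finset (Sym2 (V d))} {Q R : Config d → Prop} (mQ : Mon Q) (mR : Mon R)
    (hQ : Det (E : Set (Sym2 (V d))) {ω | Q ω}) (hR : Det (E : Set (Sym2 (V d))) {ω | R ω}) :
    μ {ω | DO Q R ω} ≤ μ {ω | Q ω} * μ {ω | R ω} := by
  rw [fin_rep h hQ, fin_rep h hR, fin_rep h (DO.det hQ hR), ← ofReal_mul (pr_nonneg h.1)]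
  refine ofReal_le_ofReal (le_trans (pr_mono h.1 ?_) (bk h.1 mQ.inc mR.inc))
  rintro S _ ⟨S₁, S₂, h1, h2, h3, h4, h5⟩
  refine ⟨S₁, S₂, h1, ?_, ?_, h4, h5⟩
  · intro e he; simpa [cfg] using h2 e he
  · intro e he; simpa [cfg] using h3 e he
noncomputable def sz (ω : Config d) (D : SV d) (u : V d) : ℕ := (Kc ω D u).ncard
theorem sz_mono {ω ω' : Config d} {D : FV d} {u : V d} (h : ∀ e, ω e = true → ω' e = true) :
    sz ω D u ≤ sz ω' D u :=
  Set.ncard_le_ncard (fun _ hy => mon_connIn h hy) ((Finset.finite_toSet D).subset Kc_subset)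
theorem mon_sz {D : FV d} {u : V d} {n : ℕ} : Mon fun ω : Config d => n ≤ sz ω D u :=
  fun _ _ h h' => h'.trans (sz_mono h)
theorem Kc_congr {D : FV d} {u : V d} {ω ω' : Config d} (h : ∀ e ∈ (D.sym2 : Set (Sym2 (V d))), ω e = ω' e) :
    Kc ω D u = Kc ω' D u := by
  ext y; exact det_fin ω ω' h
theorem det_sz {D : FV d} {u : V d} {n : ℕ} : Det (D.sym2 : Set (Sym2 (V d))) {ω : Config d | n ≤ sz ω D u} := by
  intro ω ω' h
  simp only [Set.mem_ofPred_eq, sz, Kc_congr h]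
theorem cluster_split {ω : Config d} {D : FV d} {u : V d} {n : ℕ} (hu : u ∈ D) (hn : 1 ≤ n) (h : 3 * n ≤ sz ω D u) :
    DO (fun ω => n ≤ sz ω D u) (fun ω => ∃ v ∈ D, n ≤ sz ω D v) ω := by
  classical
  have hfin : (Kc ω D u).Finite := (Finset.finite_toSet D).subset Kc_subset
  set K := hfin.toFinset with hK
  have memK : ∀ k, k ∈ K ↔ connIn ω D u k := fun k => hfin.mem_toFinset
  set dep : V d → ℕ := fun k => sInf {n | stepIn ω D u n k} with hdep
  have hpar : ∀ k, ∃ z, k ∈ K → k ≠ u → z ∈ K ∧ dep z < dep k ∧ adj ω k z := by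
    intro k
    by_cases hk : k ∈ K ∧ k ≠ u
    swap
    · exact ⟨k, fun h1 h2 => absurd ⟨h1, h2⟩ hk⟩
    obtain ⟨_, _, hne⟩ := connIn_iff_step.1 ((memK k).1 hk.1)
    have hmem : stepIn ω D u (dep k) k := Nat.sInf_mem (s := {n | stepIn ω D u n k}) hne
    rcases hd : dep k with _ | m
    · rw [hd] at hmem; exact absurd hmem.symm hk.2
    · rw [hd] at hmem
      obtain ⟨z, h1, h2, h3, h4⟩ := hmem
      refine ⟨z, fun _ _ => ⟨(memK z).2 (connIn_iff_step.2 ⟨hu, h2, m, h1⟩), ?_, h4.symm⟩⟩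
      exact Nat.lt_succ_of_le (Nat.sInf_le h1)
  choose par hpar using hpar
  have hcard : K.card = sz ω D u := (Set.ncard_eq_toFinset_card _ hfin).symm
  obtain ⟨I, i, hi, hIK, huI, hiI, h1, h2, h3, h4⟩ := tree_split ((memK u).2 (.refl hu))
    (fun k hk hku => ⟨(hpar k hk hku).1, (hpar k hk hku).2.1⟩) hn (hcard ▸ h)
  have hKD : ∀ k ∈ K, k ∈ D := fun k hk => ((memK k).1 hk).2.1
  have hneu : ∀ k ∈ I, k ≠ u := fun k hk hku => huI (hku ▸ hk)
  set f : V d → Sym2 (V d) := fun k => s(k, par k)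
  have hadj : ∀ (S : FV d) k, k ∈ S → k ∈ K → k ≠ u → adj (cfg (S.image f)) (par k) k := by
    intro S k hk hkK hku
    refine adj.symm ⟨(hpar k hkK hku).2.2.1, ?_⟩
    simp only [cfg, decide_eq_true_eq]
    exact Finset.mem_image_of_mem f hk
  refine ⟨((K.erase u) \ I).image f, I.image f, ?_, ?_, ?_, ?_, ?_⟩
  · rw [Finset.disjoint_left]
    intro e he1 he2
    obtain ⟨k, hk, rfl⟩ := Finset.mem_image.1 he1
    obtain ⟨l, hl, hkl⟩ := Finset.mem_image.1 he2
    simp only [Finset.mem_sdiff, Finset.mem_erase] at hk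
    have a1 := (hpar k hk.1.2 hk.1.1).2.1
    have a2 := (hpar l (hIK hl) (hneu l hl)).2.1
    rw [Sym2.eq_iff] at hkl
    rcases hkl with ⟨rfl, _⟩ | ⟨b1, b2⟩
    · exact hk.2 hl
    · rw [← b1] at a1; rw [b2] at a2; omega
  · intro e he
    obtain ⟨k, hk, rfl⟩ := Finset.mem_image.1 he
    simp only [Finset.mem_sdiff, Finset.mem_erase] at hk
    exact (hpar k hk.1.2 hk.1.1).2.2.2
  · intro e he
    obtain ⟨k, hk, rfl⟩ := Finset.mem_image.1 he
    exact (hpar k (hIK hk) (hneu k hk)).2.2.2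
  · have : ∀ N k, dep k ≤ N → k ∈ K → k ∉ I → connIn (cfg (((K.erase u) \ I).image f)) D u k := by
      intro N
      induction N with
      | zero =>
        intro k hk hkK hkI
        by_cases hku : k = u
        · subst hku; exact .refl hu
        · have := (hpar k hkK hku).2.1; omega
      | succ N ih =>
        intro k hk hkK hkI
        by_cases hku : k = u
        · subst hku; exact .refl hu
        · obtain ⟨a1, a2, a3⟩ := hpar k hkK hku
          refine (ih (par k) (by omega) a1 (h2 k hkK hku hkI)).tail (hKD k hkK) (hadj _ k ?_ hkK hku)
          simp [hkK, hku, hkI]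
    have hsub : ((K \ I : FV d) : SV d) ⊆ Kc (cfg (((K.erase u) \ I).image f)) D u := by
      intro k hk
      rw [Finset.mem_coe, Finset.mem_sdiff] at hk
      exact this _ k le_rfl hk.1 hk.2
    have := Set.ncard_le_ncard hsub ((Finset.finite_toSet D).subset Kc_subset)
    rw [Set.ncard_coe_finset] at this
    have hc := Finset.card_sdiff_add_card_eq_card hIK
    refine le_trans ?_ this
    omega
  · refine ⟨i, hKD i hi, ?_⟩
    have : ∀ N k, dep k ≤ N → k ∈ I → connIn (cfg (I.image f)) D i k := by
      intro N
      induction N with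
      | zero =>
        intro k hk hkI
        have := (hpar k (hIK hkI) (hneu k hkI)).2.1; omega
      | succ N ih =>
        intro k hk hkI
        obtain ⟨a1, a2, a3⟩ := hpar k (hIK hkI) (hneu k hkI)
        have hc : connIn (cfg (I.image f)) D i (par k) := by
          rcases h1 k hkI with hp | hp
          · exact ih (par k) (by omega) hp
          · rw [hp]; exact .refl (hKD i hi)
        exact hc.tail (hKD k (hIK hkI)) (hadj _ k hkI (hIK hkI) (hneu k hkI))
    have hsub : ((insert i I : FV d) : SV d) ⊆ Kc (cfg (I.image f)) D i := by
      intro k hk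
      rw [Finset.mem_coe, Finset.mem_insert] at hk
      rcases hk with rfl | hk
      · exact connIn.refl (hKD _ hi)
      · exact this _ k le_rfl hk
    have := Set.ncard_le_ncard hsub ((Finset.finite_toSet D).subset Kc_subset)
    rw [Set.ncard_coe_finset, Finset.card_insert_of_notMem hiI] at this
    exact le_trans h3 this
noncomputable def qq (μ : Measure (Config d)) (D : FV d) (n : ℕ) : ℝ≥0∞ := μ {ω | ∃ v ∈ D, n ≤ sz ω D v}
theorem tight_step (h : IsBer p μ) {D : FV d} {u : V d} (hu : u ∈ D) {n : ℕ} (hn : 1 ≤ n) :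
    μ {ω | 3 * n ≤ sz ω D u} ≤ μ {ω | n ≤ sz ω D u} * qq μ D n := by
  refine (measure_mono ?_).trans (bk_meas h (E := D.sym2) mon_sz (R := fun ω => ∃ v ∈ D, n ≤ sz ω D v) ?_ det_sz ?_)
  · exact fun ω hω => cluster_split hu hn hω
  · rintro ω ω' h ⟨v, hv, h'⟩
    exact ⟨v, hv, mon_sz h h'⟩
  · intro ω ω' h
    simp only [Set.mem_ofPred_eq, sz, Kc_congr h]
theorem tight_pow (h : IsBer p μ) {D : FV d} {u : V d} (hu : u ∈ D) {n : ℕ} (hn : 1 ≤ n) (k : ℕ) :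
    μ {ω | 3 ^ k * n ≤ sz ω D u} ≤ μ {ω | n ≤ sz ω D u} * qq μ D n ^ k := by
  induction k with
  | zero => simp
  | succ k ih =>
    have h1 : 1 ≤ 3 ^ k := Nat.one_le_pow _ _ (by norm_num)
    have h2 : n ≤ 3 ^ k * n := Nat.le_mul_of_pos_left _ (by omega)
    have := tight_step h hu (n := 3 ^ k * n) (by omega)
    rw [pow_succ', mul_assoc]
    refine this.trans ?_
    rw [pow_succ, ← mul_assoc]
    refine mul_le_mul' ih (measure_mono ?_)
    rintro ω ⟨v, hv, h'⟩
    exact ⟨v, hv, h2.trans h'⟩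
theorem meas_sz {D : FV d} {u : V d} : Measurable fun ω : Config d => sz ω D u := by
  classical
  have : (fun ω : Config d => sz ω D u) = fun ω => ∑ y ∈ D, Set.indicator {ω : Config d | connIn ω D u y} (fun _ => 1) ω := by
    ext ω
    have hfin : (Kc ω D u).Finite := (Finset.finite_toSet D).subset Kc_subset
    rw [sz, Set.ncard_eq_toFinset_card _ hfin]
    simp only [Set.indicator_apply, Finset.sum_boole, Nat.cast_id]
    congr 1
    ext y
    simp only [Set.Finite.mem_toFinset, Finset.mem_filter]
    exact ⟨fun h => ⟨h.2.1, h⟩, fun h => h.2⟩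
  rw [this]
  exact Finset.measurable_sum _ fun y _ => measurable_const.indicator meas_connIn
theorem lint_sz {D : FV d} {u : V d} : ∫⁻ ω, (sz ω D u : ℝ≥0∞) ∂μ = ∑' y, tau μ D u y := by
  classical
  have : ∀ ω : Config d, (sz ω D u : ℝ≥0∞) = ∑ y ∈ D, Set.indicator {ω : Config d | connIn ω D u y} (fun _ => 1) ω := by
    intro ω
    have hfin : (Kc ω D u).Finite := (Finset.finite_toSet D).subset Kc_subset
    rw [sz, Set.ncard_eq_toFinset_card _ hfin]
    simp only [Set.indicator_apply, Finset.sum_boole]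
    congr 2
    ext y
    simp only [Set.Finite.mem_toFinset, Finset.mem_filter]
    exact ⟨fun h => ⟨h.2.1, h⟩, fun h => h.2⟩
  simp_rw [this]
  rw [lintegral_finsetSum _ fun y _ => measurable_const.indicator meas_connIn, tsum_tau_eq_sum]
  refine Finset.sum_congr rfl fun y _ => ?_
  rw [lintegral_indicator meas_connIn]; simp [tau]
theorem pow_cover {n s : ℕ} (hn : 1 ≤ n) (h : 3 * n ≤ s) : ∃ k, 3 ^ (k + 1) * n ≤ s ∧ s ≤ 3 ^ (k + 2) * n := by
  have hs : s / n ≠ 0 := by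
    rw [Nat.div_ne_zero_iff]; omega
  have h3 : 3 ≤ s / n := (Nat.le_div_iff_mul_le (by omega)).2 h
  have hlog : 1 ≤ Nat.log 3 (s / n) := (Nat.le_log_iff_pow_le (by norm_num) hs).2 (by simpa using h3)
  refine ⟨Nat.log 3 (s / n) - 1, ?_, ?_⟩
  · rw [Nat.sub_add_cancel hlog, ← Nat.le_div_iff_mul_le (by omega)]
    exact Nat.pow_log_le_self 3 hs
  · rw [show Nat.log 3 (s / n) - 1 + 2 = Nat.log 3 (s / n) + 1 by omega]
    have := Nat.lt_pow_succ_log_self (b := 3) (by norm_num) (s / n)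
    exact ((Nat.div_lt_iff_lt_mul (by omega)).1 this).le
theorem tight (h : IsBer p μ) {D : FV d} {u : V d} (hu : u ∈ D) {n : ℕ} (hn : 1 ≤ n) (hq : qq μ D n ≤ oR (1 / 48)) :
    ∑' y, tau μ D u y ≤ oR (5 / 4) * ∫⁻ ω, (if sz ω D u < 3 * n then (sz ω D u : ℝ≥0∞) else 0) ∂μ := by
  have hpr := h.prob
  have hm : ∀ k, MeasurableSet {ω : Config d | k ≤ sz ω D u} := fun k => meas_sz (measurableSet_Ici (a := k))
  set T := ∑' y, tau μ D u y with hT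
  have hTt : T ≠ ∞ := by
    rw [hT, tsum_tau_eq_sum]
    exact ENNReal.sum_ne_top.2 fun y _ => measure_ne_top _ _
  set X := ∫⁻ ω, (if sz ω D u < 3 * n then (sz ω D u : ℝ≥0∞) else 0) ∂μ
  have hmarkov : (n : ℝ≥0∞) * μ {ω | n ≤ sz ω D u} ≤ T := by
    rw [hT, ← lint_sz]
    refine le_trans (le_of_eq ?_) (mul_meas_ge_le_lintegral₀ (measurable_from_top.comp meas_sz).aemeasurable (n : ℝ≥0∞))
    simp
  have h1 : T ≤ X + ∑' k : ℕ, (3 ^ (k + 2) * n : ℝ≥0∞) * μ {ω | 3 ^ (k + 1) * n ≤ sz ω D u} := by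
    have e : ∑' k : ℕ, (3 ^ (k + 2) * n : ℝ≥0∞) * μ {ω | 3 ^ (k + 1) * n ≤ sz ω D u} =
        ∫⁻ ω, ∑' k : ℕ, (Set.indicator {ω : Config d | 3 ^ (k + 1) * n ≤ sz ω D u} (fun _ => (3 ^ (k + 2) * n : ℝ≥0∞)) ω) ∂μ := by
      rw [lintegral_tsum fun k => (measurable_const.indicator (hm _)).aemeasurable]
      refine tsum_congr fun k => ?_
      rw [lintegral_indicator (hm _)]; simp
    have hX : Measurable fun ω : Config d => (if sz ω D u < 3 * n then (sz ω D u : ℝ≥0∞) else 0) :=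
      (measurable_from_top (f := fun s : ℕ => if s < 3 * n then (s : ℝ≥0∞) else 0)).comp meas_sz
    rw [e, ← lintegral_add_left hX, hT, ← lint_sz]
    refine lintegral_mono fun ω => ?_
    show (sz ω D u : ℝ≥0∞) ≤ (if sz ω D u < 3 * n then (sz ω D u : ℝ≥0∞) else 0) + _
    by_cases hs : sz ω D u < 3 * n
    · simp [hs]
    · obtain ⟨k, hk1, hk2⟩ := pow_cover hn (not_lt.1 hs)
      refine le_trans ?_ (le_add_left (ENNReal.le_tsum k))
      rw [Set.indicator_of_mem (show ω ∈ {ω : Config d | 3 ^ (k + 1) * n ≤ sz ω D u} from hk1)]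
      exact_mod_cast hk2
  have h2 : ∑' k : ℕ, (3 ^ (k + 2) * n : ℝ≥0∞) * μ {ω | 3 ^ (k + 1) * n ≤ sz ω D u} ≤ oR (1 / 5) * T := by
    have : ∀ k : ℕ, (3 ^ (k + 2) * n : ℝ≥0∞) * μ {ω | 3 ^ (k + 1) * n ≤ sz ω D u} ≤ oR (3 / 16) * T * oR (1 / 16) ^ k := by
      intro k
      calc _ ≤ (3 ^ (k + 2) * n : ℝ≥0∞) * (μ {ω | n ≤ sz ω D u} * oR (1 / 48) ^ (k + 1)) := by
            gcongr
            refine (tight_pow h hu hn (k + 1)).trans ?_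
            gcongr
        _ = (3 ^ (k + 2) * oR (1 / 48) ^ (k + 1)) * (n * μ {ω | n ≤ sz ω D u}) := by ring
        _ ≤ (3 ^ (k + 2) * oR (1 / 48) ^ (k + 1)) * T := by gcongr
        _ = _ := by
            have : (3 : ℝ≥0∞) ^ (k + 2) * oR (1 / 48) ^ (k + 1) = oR (3 / 16) * oR (1 / 16) ^ k := by
              rw [show (3 : ℝ≥0∞) = oR 3 by simp, ← ENNReal.ofReal_pow (by norm_num), ← ENNReal.ofReal_pow (by norm_num), ← ENNReal.ofReal_pow (by norm_num),
                ← ofReal_mul (by positivity), ← ofReal_mul (by positivity)]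
              congr 1
              rw [show (1 / 16 : ℝ) = 3 * (1 / 48) by norm_num, mul_pow]
              ring
            rw [this]; ring
    refine (ENNReal.tsum_le_tsum this).trans (le_of_eq ?_)
    rw [ENNReal.tsum_mul_left, ENNReal.tsum_geometric, show (1 : ℝ≥0∞) = oR 1 by simp, ← ENNReal.ofReal_sub _ (by norm_num), ← ENNReal.ofReal_inv_of_pos (by norm_num), mul_right_comm,
      ← ofReal_mul (by norm_num)]
    norm_num
  have h3 := h1.trans (add_le_add le_rfl h2)
  have h4 : X ≠ ∞ := by
    refine ne_top_of_le_ne_top hTt ?_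
    rw [hT, ← lint_sz]
    refine lintegral_mono fun ω => ?_
    dsimp only
    split_ifs <;> simp
  rw [← ofReal_toReal hTt, ← ofReal_toReal h4, ← ofReal_mul (by norm_num), ← ofReal_add (by positivity) (by positivity), ofReal_le_ofReal_iff (by positivity)] at h3
  rw [← ofReal_toReal hTt, ← ofReal_toReal h4, ← ofReal_mul (by norm_num)]
  refine ofReal_le_ofReal ?_
  linarith
end BKm
end Part7
section Part8
section Renorm
variable {d : ℕ} {J : V d → V d → ℝ} {α c C : ℝ} {P : ℝ → Measure (Config d)} {β : ℝ} {μ : Measure (Config d)}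
theorem lint_K (U : FV d) (u : V d) (g : ℕ → ℝ≥0∞) :
    ∫⁻ ω, g (sz ω U u) ∂μ = ∑ A ∈ U.powerset, μ {ω | Kc ω U u = A} * g A.card := by
  classical
  have : ∀ ω : Config d, g (sz ω U u) = ∑ A ∈ U.powerset, Set.indicator {ω : Config d | Kc ω U u = A} (fun _ => g A.card) ω := by
    intro ω
    have hfin : (Kc ω U u).Finite := (Finset.finite_toSet U).subset Kc_subset
    have hmem : hfin.toFinset ∈ U.powerset := by
      rw [Finset.mem_powerset]; intro y hy; exact ((Set.Finite.mem_toFinset hfin).1 hy).2.1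
    rw [Finset.sum_eq_single_of_mem _ hmem]
    · rw [Set.indicator_of_mem (by simp), sz, Set.ncard_eq_toFinset_card _ hfin]
    · intro A _ hA
      rw [Set.indicator_of_notMem]
      intro h
      apply hA
      have h' : Kc ω U u = A := h
      ext y; rw [Set.Finite.mem_toFinset, h']; rfl
  simp_rw [this]
  rw [lintegral_finsetSum _ fun A _ => measurable_const.indicator meas_Kc]
  refine Finset.sum_congr rfl fun A _ => ?_
  rw [lintegral_indicator meas_Kc]; simp [mul_comm]
theorem det_KcIn {U : FV d} {u : V d} {A : SV d} : Det (U.sym2 : Set (Sym2 (V d))) {ω : Config d | Kc ω U u = A} := by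
  intro ω ω' h
  simp only [Set.mem_ofPred_eq, Kc_congr h]
theorem meas_cross (A B : FV d) : MeasurableSet {ω : Config d | ∃ a ∈ A, ∃ b ∈ B, ω s(a, b) = true} := by
  have : {ω : Config d | ∃ a ∈ A, ∃ b ∈ B, ω s(a, b) = true} = ⋃ a ∈ A, ⋃ b ∈ B, {ω | ω s(a, b) = true} := by
    ext ω; simp
  rw [this]
  exact Finset.measurableSet_biUnion _ fun a _ => Finset.measurableSet_biUnion _ fun b _ =>
    (measurable_pi_apply (s(a, b)) : Measurable fun ω : Config d => ω s(a, b)) (measurableSet_singleton true)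
theorem cross_prob (hJ : KernelHyp d J α c C) (hP : IsLRP J P) (hβ : 0 ≤ β) {A B : FV d} (hAB : Disjoint A B)
    {κ : ℝ} (hκ : ∀ a ∈ A, ∀ b ∈ B, κ ≤ β * J a b) :
    oR (1 - Real.exp (-(κ * A.card * B.card))) ≤ P β {ω | ∃ a ∈ A, ∃ b ∈ B, ω s(a, b) = true} := by
  classical
  have hB := isBer hJ hP hβ
  have hpr := hB.prob
  set E : Finset (Sym2 (V d)) := (A ×ˢ B).image fun x => s(x.1, x.2)
  have hm := meas_cross A B
  have hc : {ω : Config d | ∃ a ∈ A, ∃ b ∈ B, ω s(a, b) = true}ᶜ = {ω | ∀ e ∈ E, ω e = (fun _ => false) e} := by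
    ext ω
    simp only [Set.mem_compl_iff, Set.mem_ofPred_eq, E, Finset.mem_image, Finset.mem_product, Prod.exists]
    push Not
    constructor
    · rintro h e ⟨a, b, ⟨ha, hb⟩, rfl⟩
      simpa using h a ha b hb
    · intro h a ha b hb
      simp [h _ ⟨a, b, ⟨ha, hb⟩, rfl⟩]
  have h1 := hB.2 E (fun _ => false)
  rw [← hc, prob_compl_eq_one_sub hm] at h1
  have h2 : ∏ e ∈ E, (if (fun _ => false) e = true then pJ J β e else 1 - pJ J β e) ≤ Real.exp (-(κ * A.card * B.card)) := by
    simp only [Bool.false_eq_true, if_false]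
    rw [Finset.prod_image, Finset.prod_product]
    · calc ∏ a ∈ A, ∏ b ∈ B, (1 - pJ J β s(a, b)) ≤ ∏ a ∈ A, ∏ b ∈ B, Real.exp (-κ) := by
            refine Finset.prod_le_prod (fun a _ => Finset.prod_nonneg fun b _ => ?_) fun a ha => Finset.prod_le_prod (fun b _ => ?_) fun b hb => ?_
            · linarith [(pJ_bd hJ hβ s(a, b)).2]
            · linarith [(pJ_bd hJ hβ s(a, b)).2]
            · simp only [pJ, wJ_mk hJ, _root_.sub_sub_cancel]
              exact Real.exp_le_exp.2 (by linarith [hκ a ha b hb])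
        _ = _ := by
            simp only [Finset.prod_const]
            rw [← pow_mul, ← Real.exp_nat_mul]
            congr 1; push_cast; ring
    · rintro ⟨a, b⟩ hab ⟨a', b'⟩ hab' h
      simp only [Finset.coe_product, Set.mem_prod, Finset.mem_coe] at hab hab'
      simp only [Sym2.eq_iff] at h
      rcases h with ⟨rfl, rfl⟩ | ⟨rfl, rfl⟩
      · rfl
      · exact absurd hab'.2 (Finset.disjoint_left.1 hAB hab.1)
  rw [ENNReal.ofReal_sub _ (Real.exp_pos _).le, ofReal_one, tsub_le_iff_right]
  calc (1 : ℝ≥0∞) ≤ P β {ω | ∃ a ∈ A, ∃ b ∈ B, ω s(a, b) = true} + (1 - P β {ω | ∃ a ∈ A, ∃ b ∈ B, ω s(a, b) = true}) := le_add_tsub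
    _ ≤ _ := by
        gcongr
        rw [h1]
        exact ofReal_le_ofReal h2
theorem pair_bound (hJ : KernelHyp d J α c C) (hP : IsLRP J P) (hβ : 0 ≤ β) {U W D : FV d} (hUW : Disjoint U W)
    (hU : U ⊆ D) (hW : W ⊆ D) {κ : ℝ} (hκ : ∀ a ∈ U, ∀ b ∈ W, κ ≤ β * J a b) {g : ℕ → ℝ≥0∞} {k : ℝ≥0∞}
    (hg : ∀ a b : ℕ, k * g a * g b ≤ oR (1 - Real.exp (-(κ * a * b)))) (u v : V d) :
    k * (∫⁻ ω, g (sz ω U u) ∂(P β)) * (∫⁻ ω, g (sz ω W v) ∂(P β)) ≤ tau (P β) D u v := by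
  classical
  have hB := isBer hJ hP hβ
  set μ := P β
  rw [lint_K, lint_K]
  set X : FV d → FV d → Set (Config d) := fun A B => {ω | Kc ω U u = A} ∩ ({ω | Kc ω W v = B} ∩ {ω | ∃ a ∈ A, ∃ b ∈ B, ω s(a, b) = true})
  have hm : ∀ A B : FV d, MeasurableSet {ω : Config d | ∃ a ∈ A, ∃ b ∈ B, ω s(a, b) = true} := meas_cross
  have hX : ∀ A ∈ U.powerset, ∀ B ∈ W.powerset, k * (μ {ω | Kc ω U u = A} * g A.card) * (μ {ω | Kc ω W v = B} * g B.card) ≤ μ (X A B) := by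
    intro A hA B hB'
    rw [Finset.mem_powerset] at hA hB'
    have hcr : Det {e : Sym2 (V d) | ∃ a ∈ U, ∃ b ∈ W, e = s(a, b)} {ω : Config d | ∃ a ∈ A, ∃ b ∈ B, ω s(a, b) = true} := by
      intro ω ω' h
      refine exists_congr fun a => and_congr_right fun ha => exists_congr fun b => and_congr_right fun hb => ?_
      rw [h _ ⟨a, hA ha, b, hB' hb, rfl⟩]
    have hd1 : Disjoint (W.sym2 : Set (Sym2 (V d))) {e : Sym2 (V d) | ∃ a ∈ U, ∃ b ∈ W, e = s(a, b)} := by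
      rw [Set.disjoint_left]
      rintro e he ⟨a, ha, b, hb, rfl⟩
      simp only [Finset.mem_coe, Finset.mk_mem_sym2_iff] at he
      exact Finset.disjoint_left.1 hUW ha he.1
    have hd2 : Disjoint (U.sym2 : Set (Sym2 (V d))) ((W.sym2 : Set (Sym2 (V d))) ∪ {e : Sym2 (V d) | ∃ a ∈ U, ∃ b ∈ W, e = s(a, b)}) := by
      rw [Set.disjoint_left]
      rintro e he (he2 | ⟨a, ha, b, hb, rfl⟩)
      · induction e with | _ a b =>
        simp only [Finset.mem_coe, Finset.mk_mem_sym2_iff] at he he2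
        exact Finset.disjoint_left.1 hUW he.1 he2.1
      · simp only [Finset.mem_coe, Finset.mk_mem_sym2_iff] at he
        exact Finset.disjoint_left.1 hUW he.2 hb
    have hdet : Det ((W.sym2 : Set (Sym2 (V d))) ∪ {e : Sym2 (V d) | ∃ a ∈ U, ∃ b ∈ W, e = s(a, b)})
        ({ω : Config d | Kc ω W v = B} ∩ {ω | ∃ a ∈ A, ∃ b ∈ B, ω s(a, b) = true}) := fun ω ω' h =>
      and_congr (det_KcIn ω ω' fun e he => h e (Or.inl he)) (hcr ω ω' fun e he => h e (Or.inr he))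
    simp only [X]
    rw [hB.indep meas_Kc (meas_Kc.inter (hm A B)) det_KcIn hdet hd2, hB.indep meas_Kc (hm A B) det_KcIn hcr hd1]
    calc _ = μ {ω | Kc ω U u = A} * (μ {ω | Kc ω W v = B} * (k * g A.card * g B.card)) := by ring
      _ ≤ _ := by
        gcongr
        refine (hg _ _).trans (cross_prob hJ hP hβ (hUW.mono hA hB') fun a ha b hb => hκ a (hA ha) b (hB' hb))
  calc _ = ∑ A ∈ U.powerset, ∑ B ∈ W.powerset, k * (μ {ω | Kc ω U u = A} * g A.card) * (μ {ω | Kc ω W v = B} * g B.card) := by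
        rw [mul_assoc, Finset.sum_mul_sum, Finset.mul_sum]
        refine Finset.sum_congr rfl fun A _ => ?_
        rw [Finset.mul_sum]
        refine Finset.sum_congr rfl fun B _ => ?_
        ring
    _ ≤ ∑ A ∈ U.powerset, ∑ B ∈ W.powerset, μ (X A B) := Finset.sum_le_sum fun A hA => Finset.sum_le_sum fun B hB => hX A hA B hB
    _ = μ (⋃ x ∈ U.powerset ×ˢ W.powerset, X x.1 x.2) := by
        rw [← Finset.sum_product', measure_biUnion_finset]
        · rintro ⟨A, B⟩ _ ⟨A', B'⟩ _ hne
          refine Set.disjoint_left.2 ?_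
          rintro ω ⟨h1, h2, _⟩ ⟨h3, h4, _⟩
          exact hne (Prod.ext (Finset.coe_injective (h1.symm.trans h3)) (Finset.coe_injective (h2.symm.trans h4)))
        · rintro ⟨A, B⟩ _
          exact meas_Kc.inter (meas_Kc.inter (hm A B))
    _ ≤ _ := by
        refine measure_mono ?_
        intro ω hω
        simp only [Set.mem_iUnion] at hω
        obtain ⟨⟨A, B⟩, hx, h1, h2, a, ha, b, hb, hab⟩ := hω
        have h1' : Kc ω U u = A := h1
        have h2' : Kc ω W v = B := h2
        have ha' : connIn ω U u a := by have : a ∈ Kc ω U u := by rw [h1']; exact ha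
                                        exact this
        have hb' : connIn ω W v b := by have : b ∈ Kc ω W v := by rw [h2']; exact hb
                                        exact this
        have hne : a ≠ b := fun h => Finset.disjoint_left.1 hUW ha'.2.1 (h ▸ hb'.2.1)
        exact ((ha'.mono (Finset.coe_subset.2 hU)).tail (hW hb'.2.1) ⟨hne, hab⟩).trans (hb'.mono (Finset.coe_subset.2 hW)).symm
noncomputable def xx (μ : Measure (Config d)) (D : FV d) : ℝ≥0∞ := ∑ u ∈ D, ∑' v, tau μ D u v
noncomputable def blk (m : ℕ) (i : V d) : FV d := Fintype.piFinset fun k => Finset.Ico (m * i k) (m * i k + m)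
theorem mem_blk {m : ℕ} {i u : V d} : u ∈ blk m i ↔ ∀ k, m * i k ≤ u k ∧ u k < m * i k + m := by
  rw [blk, Fintype.mem_piFinset]
  simp
theorem card_blk (m : ℕ) : (blk m 0 : FV d).card = m ^ d := by
  simp [blk]
theorem lint_shift {p : Sym2 (V d) → ℝ} (h : IsBer p μ) (ht : TI p) (D D' : FV d) (z u : V d)
    (hD : ∀ v, v ∈ D' ↔ v - z ∈ D) (g : ℕ → ℝ≥0∞) : ∫⁻ ω, g (sz ω D' (u + z)) ∂μ = ∫⁻ ω, g (sz ω D u) ∂μ := by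
  conv_rhs => rw [← map_shift (z := z) h ht]
  have hmg : Measurable fun ω : Config d => g (sz ω D u) := (measurable_from_top (f := g)).comp meas_sz
  rw [lintegral_map hmg meas_shift]
  refine lintegral_congr fun ω => ?_
  congr 1
  have : Kc ω D' (u + z) = (· + z) '' Kc (shift z ω) D u := by
    have hs : (D' : SV d) = {v | v - z ∈ (D : SV d)} := by ext v; simp [hD]
    ext y
    simp only [Set.mem_image, Kc, Set.mem_ofPred_eq, connIn_shift, hs]
    constructor
    · intro hy; exact ⟨y - z, by simpa using hy, by simp⟩
    · rintro ⟨y, hy, rfl⟩; exact hy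
  rw [sz, sz, this, Set.ncard_image_of_injective _ (add_left_injective z)]
end Renorm
end Part8
section Part9
section Renorm2
variable {d : ℕ} {J : V d → V d → ℝ} {α c C : ℝ} {P : ℝ → Measure (Config d)} {β : ℝ} {μ : Measure (Config d)}
theorem blk_sub {M m : ℕ} {i : V d} (hi : i ∈ blk M 0) : blk m i ⊆ blk (M * m) 0 := by
  intro u hu
  rw [mem_blk] at *
  intro k
  have h1 := hi k
  have h2 := hu k
  simp only [Pi.zero_apply, mul_zero, zero_add, Nat.cast_mul] at *
  constructor
  · exact le_trans (mul_nonneg (by positivity) h1.1) h2.1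
  · have : (m:ℤ) * i k + m ≤ M * m := by nlinarith [h1.2]
    omega
theorem blk_disj {m : ℕ} {i j : V d} (hij : i ≠ j) : Disjoint (blk m i) (blk m j) := by
  rw [Finset.disjoint_left]
  intro u hu hv
  rw [mem_blk] at *
  apply hij
  ext k
  have h1 := hu k
  have h2 := hv k
  have hm : (0:ℤ) < m := by omega
  by_contra h
  rcases lt_or_gt_of_ne h with h | h
  · nlinarith
  · nlinarith
theorem xx_ge (hJ : KernelHyp d J α c C) (hP : IsLRP J P) (hβ : 0 ≤ β) {M m : ℕ} {κ : ℝ}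
    (hκ : ∀ a ∈ blk (M * m) 0, ∀ b ∈ blk (M * m) 0, a ≠ b → κ ≤ β * J a b) {g : ℕ → ℝ≥0∞} {k : ℝ≥0∞}
    (hg : ∀ a b : ℕ, k * g a * g b ≤ oR (1 - Real.exp (-(κ * a * b)))) :
    ((M ^ d * M ^ d - M ^ d : ℕ) : ℝ≥0∞) * (k * (∑ u ∈ blk m 0, ∫⁻ ω, g (sz ω (blk m 0 : FV d) u) ∂(P β)) ^ 2) ≤ xx (P β) (blk (M * m) 0) := by
  classical
  have hB := isBer hJ hP hβ
  set D : FV d := blk (M * m) 0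
  set G := ∑ u ∈ blk m 0, ∫⁻ ω, g (sz ω (blk m 0 : FV d) u) ∂(P β) with hG
  set I : FV d := blk M 0
  have hdis : Set.PairwiseDisjoint (I : SV d) (fun i => blk m i) := fun i _ j _ h => blk_disj h
  have hsub : ∀ f : V d → ℝ≥0∞, ∑ i ∈ I, ∑ u ∈ blk m i, f u ≤ ∑ u ∈ D, f u := by
    intro f
    rw [← Finset.sum_biUnion hdis]
    exact Finset.sum_le_sum_of_subset (Finset.biUnion_subset.2 fun i hi => blk_sub hi)
  have hGi : ∀ i : V d, ∑ u ∈ blk m i, ∫⁻ ω, g (sz ω (blk m i : FV d) u) ∂(P β) = G := by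
    intro i
    have him : (blk m i : FV d) = (blk m 0).image (fun u => u + fun k => m * i k) := by
      ext u
      rw [Finset.mem_image]
      constructor
      · intro hu
        refine ⟨u - fun k => m * i k, ?_, by simp⟩
        rw [mem_blk] at *
        intro k; have := hu k; simp; omega
      · rintro ⟨v, hv, rfl⟩
        rw [mem_blk] at *
        intro k; have := hv k; simp at *; omega
    rw [hG]
    conv_lhs => rw [him]
    rw [Finset.sum_image fun a _ b _ h => add_left_injective _ h]
    refine Finset.sum_congr rfl fun u _ => ?_
    refine lint_shift hB (TI_pJ hJ) _ _ _ _ (fun v => ?_) g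
    rw [← him]
    rw [mem_blk, mem_blk]
    refine forall_congr' fun k => ?_
    simp; omega
  calc _ = ∑ x ∈ I.offDiag, k * G * G := by
        rw [Finset.sum_const, Finset.offDiag_card, card_blk, nsmul_eq_mul]; ring
    _ ≤ ∑ x ∈ I.offDiag, ∑ u ∈ blk m x.1, ∑ v ∈ blk m x.2, tau (P β) D u v := by
        refine Finset.sum_le_sum ?_
        rintro ⟨i, j⟩ hij
        rw [Finset.mem_offDiag] at hij
        calc k * G * G = ∑ u ∈ blk m i, ∑ v ∈ blk m j, k * (∫⁻ ω, g (sz ω (blk m i : FV d) u) ∂(P β)) * (∫⁻ ω, g (sz ω (blk m j : FV d) v) ∂(P β)) := by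
              conv_lhs => rw [mul_assoc]
              nth_rw 1 [← hGi i]
              rw [← hGi j, Finset.sum_mul_sum, Finset.mul_sum]
              refine Finset.sum_congr rfl fun u _ => ?_
              rw [Finset.mul_sum]
              refine Finset.sum_congr rfl fun v _ => ?_
              ring
          _ ≤ _ := Finset.sum_le_sum fun u hu => Finset.sum_le_sum fun v hv =>
              pair_bound hJ hP hβ (blk_disj hij.2.2) (blk_sub hij.1) (blk_sub hij.2.1)
                (fun a ha b hb => hκ a (blk_sub hij.1 ha) b (blk_sub hij.2.1 hb) fun h => Finset.disjoint_left.1 (blk_disj hij.2.2) ha (h ▸ hb)) hg u v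
    _ ≤ ∑ x ∈ I ×ˢ I, ∑ u ∈ blk m x.1, ∑ v ∈ blk m x.2, tau (P β) D u v := by
        refine Finset.sum_le_sum_of_subset fun x hx => ?_
        rw [Finset.mem_offDiag] at hx
        exact Finset.mem_product.2 ⟨hx.1, hx.2.1⟩
    _ = ∑ i ∈ I, ∑ u ∈ blk m i, ∑ j ∈ I, ∑ v ∈ blk m j, tau (P β) D u v := by
        rw [Finset.sum_product]
        refine Finset.sum_congr rfl fun i _ => ?_
        rw [Finset.sum_comm]
    _ ≤ ∑ i ∈ I, ∑ u ∈ blk m i, ∑' v, tau (P β) D u v := Finset.sum_le_sum fun i _ => Finset.sum_le_sum fun u _ =>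
        (hsub _).trans (ENNReal.sum_le_tsum D)
    _ ≤ _ := hsub _
theorem sz_eq {ω : Config d} {D : SV d} {u v : V d} (h : connIn ω D u v) : sz ω D u = sz ω D v := by
  have : Kc ω D u = Kc ω D v := by
    ext y; exact ⟨fun hy => h.symm.trans hy, fun hy => h.trans hy⟩
  rw [sz, sz, this]
theorem qq_le {D : FV d} {n : ℕ} : (n : ℝ≥0∞) * qq μ D n ≤ ∑ u ∈ D, ∫⁻ ω, (if n ≤ sz ω D u then 1 else 0) ∂μ := by
  classical
  have hm : ∀ u, Measurable fun ω : Config d => (if n ≤ sz ω D u then (1:ℝ≥0∞) else 0) := fun u =>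
    (measurable_from_top (f := fun s : ℕ => if n ≤ s then (1:ℝ≥0∞) else 0)).comp meas_sz
  rw [← lintegral_finsetSum _ fun u _ => hm u]
  have hms : MeasurableSet {ω : Config d | ∃ v ∈ D, n ≤ sz ω D v} := by
    have : {ω : Config d | ∃ v ∈ D, n ≤ sz ω D v} = ⋃ v ∈ D, {ω | n ≤ sz ω D v} := by ext; simp
    rw [this]
    exact Finset.measurableSet_biUnion _ fun v _ => meas_sz (measurableSet_Ici (a := n))
  rw [qq, ← setLIntegral_const, ← lintegral_indicator hms]
  refine lintegral_mono fun ω => ?_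
  by_cases h : ω ∈ {ω : Config d | ∃ v ∈ D, n ≤ sz ω D v}
  · rw [Set.indicator_of_mem h]
    obtain ⟨v, hv, hn⟩ := h
    have hfin : (Kc ω D v).Finite := (Finset.finite_toSet D).subset Kc_subset
    calc (n : ℝ≥0∞) ≤ (sz ω D v : ℝ≥0∞) := by exact_mod_cast hn
      _ = ∑ u ∈ hfin.toFinset, (1:ℝ≥0∞) := by rw [sz, Set.ncard_eq_toFinset_card _ hfin]; simp
      _ = ∑ u ∈ hfin.toFinset, (if n ≤ sz ω D u then (1:ℝ≥0∞) else 0) := by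
          refine Finset.sum_congr rfl fun u hu => ?_
          rw [if_pos]
          have : connIn ω D v u := (Set.Finite.mem_toFinset hfin).1 hu
          rw [← sz_eq this]; exact hn
      _ ≤ _ := Finset.sum_le_sum_of_subset fun u hu => by
          have : connIn ω D v u := (Set.Finite.mem_toFinset hfin).1 hu
          exact this.2.1
  · rw [Set.indicator_of_notMem h]; exact zero_le
theorem renorm (hJ : KernelHyp d J α c C) (hP : IsLRP J P) (hβ : 0 ≤ β) {M m : ℕ} {κ : ℝ} (hκ0 : 0 < κ) (hκ1 : κ ≤ 1)
    (hκ : ∀ a ∈ blk (M * m) 0, ∀ b ∈ blk (M * m) 0, a ≠ b → κ ≤ β * J a b) :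
    ((M ^ d * M ^ d - M ^ d : ℕ) : ℝ≥0∞) * (oR (1/5000) * min (oR κ⁻¹) (oR κ * xx (P β) (blk m 0) ^ 2)) ≤ xx (P β) (blk (M * m) 0) := by
  have hB := isBer hJ hP hβ
  obtain ⟨n, hn⟩ : ∃ n, n = ⌈(√κ)⁻¹⌉₊ := ⟨_, rfl⟩
  have hs0 : 0 < √κ := Real.sqrt_pos.2 hκ0
  have hs1 : √κ ≤ 1 := Real.sqrt_le_one.2 hκ1
  have hss : √κ * √κ = κ := Real.mul_self_sqrt hκ0.le
  have h1 : 1 ≤ √κ * n := by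
    have := Nat.le_ceil ((√κ)⁻¹); rw [← hn] at this
    calc (1:ℝ) = √κ * (√κ)⁻¹ := (mul_inv_cancel₀ hs0.ne').symm
      _ ≤ _ := by gcongr
  have h2 : √κ * n ≤ 2 := by
    have := Nat.ceil_lt_add_one (inv_nonneg.2 hs0.le); rw [← hn] at this
    calc √κ * n ≤ √κ * ((√κ)⁻¹ + 1) := by gcongr
      _ = 1 + √κ := by field_simp
      _ ≤ 2 := by linarith
  have hn1 : 1 ≤ n := by
    rcases Nat.eq_zero_or_pos n with h | h
    · rw [h] at h1; norm_num at h1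
    · exact h
  have h1' : 1 ≤ κ * n * n := by rw [← hss]; nlinarith
  have h2' : κ * n * n ≤ 4 := by rw [← hss]; nlinarith
  rcases le_or_gt (qq (P β) (blk m 0 : FV d) n) (oR (1/48)) with hq | hq
  · have key := xx_ge hJ hP hβ (M := M) (m := m) hκ (g := fun a => if a < 3 * n then (a:ℝ≥0∞) else 0) (k := oR (κ/37)) (by
      intro a b
      by_cases ha : a < 3 * n
      swap
      · simp [ha]
      by_cases hb : b < 3 * n
      swap
      · simp [hb]
      simp only [ha, hb, if_true]
      rw [← ENNReal.ofReal_natCast a, ← ENNReal.ofReal_natCast b, ← ofReal_mul (by positivity), ← ofReal_mul (by positivity)]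
      apply ofReal_le_ofReal
      set x := κ * a * b with hx
      have ha' : (a:ℝ) ≤ 3 * n := by exact_mod_cast ha.le
      have hb' : (b:ℝ) ≤ 3 * n := by exact_mod_cast hb.le
      have hx0 : 0 ≤ x := by positivity
      have hx1 : x ≤ 36 := by
        calc x ≤ κ * (3 * n) * (3 * n) := by rw [hx]; gcongr
          _ ≤ 36 := by linarith
      have he : Real.exp (-x) ≤ 1 / (1 + x) := by
        rw [Real.exp_neg, ← one_div]
        exact one_div_le_one_div_of_le (by linarith) (by linarith [Real.add_one_le_exp x])
      have : x / 37 ≤ 1 - 1 / (1 + x) := by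
        rw [le_sub_iff_add_le, ← sub_nonneg]
        have : 1 - (x / 37 + 1 / (1 + x)) = x * (36 - x) / (37 * (1 + x)) := by field_simp; ring
        rw [this]
        have : 0 ≤ 36 - x := by linarith
        positivity
      calc κ / 37 * a * b = x / 37 := by rw [hx]; ring
        _ ≤ _ := by linarith)
    refine le_trans ?_ key
    refine mul_le_mul' le_rfl ?_
    set G := ∑ u ∈ blk m 0, ∫⁻ ω, (if sz ω (blk m 0 : FV d) u < 3 * n then (sz ω (blk m 0 : FV d) u : ℝ≥0∞) else 0) ∂(P β)
    have hx : xx (P β) (blk m 0) ≤ oR (5/4) * G := by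
      rw [xx, Finset.mul_sum]
      exact Finset.sum_le_sum fun u hu => tight hB hu hn1 hq
    calc _ ≤ oR (1/5000) * (oR κ * (oR (5/4) * G) ^ 2) := by
          gcongr; exact (min_le_right _ _).trans (by gcongr)
      _ = oR (1/5000 * κ * (5/4)^2) * G ^ 2 := by
          rw [ofReal_mul (by positivity), ofReal_mul (by positivity), ENNReal.ofReal_pow (by positivity)]; ring
      _ ≤ _ := by
          gcongr; linarith
  · have key := xx_ge hJ hP hβ (M := M) (m := m) hκ (g := fun a => if n ≤ a then (1:ℝ≥0∞) else 0) (k := oR (1/2)) (by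
      intro a b
      by_cases ha : n ≤ a
      swap
      · simp [ha]
      by_cases hb : n ≤ b
      swap
      · simp [hb]
      simp only [ha, hb, if_true, mul_one]
      apply ofReal_le_ofReal
      have ha' : (n:ℝ) ≤ a := by exact_mod_cast ha
      have hb' : (n:ℝ) ≤ b := by exact_mod_cast hb
      have : κ * n * n ≤ κ * a * b := by gcongr
      have h3 : Real.exp (-(κ * a * b)) ≤ Real.exp (-1) := Real.exp_le_exp.2 (by linarith)
      have := Real.exp_neg_one_lt_half
      linarith)
    refine le_trans ?_ key
    refine mul_le_mul' le_rfl ?_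
    calc _ ≤ oR (1/5000) * oR κ⁻¹ := by gcongr; exact min_le_left _ _
      _ ≤ oR (1/2) * (n * oR (1/48)) ^ 2 := by
          rw [← ENNReal.ofReal_natCast n, ← ofReal_mul (by positivity), ← ofReal_mul (by positivity), ← ENNReal.ofReal_pow (by positivity), ← ofReal_mul (by positivity)]
          apply ofReal_le_ofReal
          have : κ⁻¹ ≤ n * n := by
            rw [inv_le_iff_one_le_mul₀ hκ0]; linarith
          nlinarith
      _ ≤ _ := by
          gcongr
          exact le_trans (by gcongr) qq_le
theorem xx_le_chi (hJ : KernelHyp d J α c C) (hP : IsLRP J P) (hβ : 0 ≤ β) (n : ℕ) :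
    xx (P β) (blk n 0) ≤ ((n ^ d : ℕ) : ℝ≥0∞) * chi P β := by
  rw [xx, ← card_blk n, ← nsmul_eq_mul, ← Finset.sum_const]
  exact Finset.sum_le_sum fun u _ => chi_D_le hJ hP hβ _ u
theorem xx_step (hJ : KernelHyp d J α c C) (hP : IsLRP J P) {M m : ℕ} (hM : 2 ≤ M) (hM' : 10000 ≤ min c 1 * (M:ℝ) ^ ((d:ℝ) - α))
    (hβ : 0 < β) (hβ' : β ≤ (M:ℝ) ^ ((d:ℝ) + α)) (hm : 1 ≤ m)
    (h : oR ((M:ℝ) ^ ((d:ℝ) + α) / β * (m:ℝ) ^ ((d:ℝ) + α)) ≤ xx (P β) (blk m 0)) :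
    oR ((M:ℝ) ^ ((d:ℝ) + α) / β * ((M * m : ℕ):ℝ) ^ ((d:ℝ) + α)) ≤ xx (P β) (blk (M * m) 0) := by
  have hα := hJ.alpha_pos
  have hs : 0 < (d:ℝ) + α := by positivity
  obtain ⟨e, he⟩ : ∃ e, e = min c 1 := ⟨_, rfl⟩
  have he0 : 0 < e := by rw [he]; exact lt_min hJ.c_pos one_pos
  have he1 : e ≤ 1 := by rw [he]; exact min_le_right _ _
  rw [← he] at hM'
  have hM0 : (0:ℝ) < M := by positivity
  have hm0 : (1:ℝ) ≤ m := by exact_mod_cast hm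
  obtain ⟨A, hA⟩ : ∃ A, A = (M:ℝ) ^ ((d:ℝ) + α) := ⟨_, rfl⟩
  have hA0 : 0 < A := by rw [hA]; positivity
  obtain ⟨B, hB⟩ : ∃ B, B = (m:ℝ) ^ ((d:ℝ) + α) := ⟨_, rfl⟩
  have hB1 : 1 ≤ B := by rw [hB]; exact Real.one_le_rpow hm0 hs.le
  have hMm : ((M * m : ℕ):ℝ) ^ ((d:ℝ) + α) = A * B := by
    rw [hA, hB, Nat.cast_mul, Real.mul_rpow (by positivity) (by positivity)]
  rw [hMm, ← hA]
  rw [← hA, ← hB] at h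
  rw [← hA] at hβ'
  have key := renorm hJ hP hβ.le (M := M) (m := m) (κ := β * e / (A * B)) (by positivity) (by
    rw [div_le_one (by positivity)]
    nlinarith [mul_le_mul hβ' he1 he0.le hA0.le]) (by
    intro a ha b hb hab
    rw [mul_div_assoc]
    refine mul_le_mul_of_nonneg_left (le_trans ?_ (hJ.lower a b hab)) hβ.le
    have hn0 : 0 < normInf (a - b) := Nat.pos_of_ne_zero fun h0 => hab (sub_eq_zero.1 (normInf_eq_zero.1 h0))
    have hn : normInf (a - b) ≤ M * m := by
      rw [mem_blk] at ha hb
      refine Finset.sup_le fun k _ => ?_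
      have := ha k; have := hb k
      simp at *
      have h3 : ((M * m : ℕ) : ℤ) = M * m := by push_cast; rfl
      omega
    rw [← hMm, div_eq_mul_inv, ← Real.rpow_neg (by positivity), show -((d:ℝ) + α) = -d - α by ring]
    refine mul_le_mul (by rw [he]; exact min_le_left _ _) ?_ (by positivity) hJ.c_pos.le
    exact Real.rpow_le_rpow_of_nonpos (by exact_mod_cast hn0) (by exact_mod_cast hn) (by linarith))
  refine le_trans ?_ key
  have hmin : oR (e * A * B / β) ≤ min (oR (β * e / (A * B))⁻¹) (oR (β * e / (A * B)) * xx (P β) (blk m 0) ^ 2) := by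
    refine le_min (ofReal_le_ofReal ?_) (le_trans ?_ (mul_le_mul' le_rfl (pow_le_pow_left' h 2)))
    · rw [inv_div, mul_assoc, mul_comm e, div_le_div_iff₀ (by positivity) (by positivity)]
      have : e * e ≤ 1 := by nlinarith
      calc A * B * e * (β * e) = A * B * β * (e * e) := by ring
        _ ≤ A * B * β * 1 := by gcongr
        _ = _ := by ring
    · rw [← ENNReal.ofReal_pow (by positivity), ← ofReal_mul (by positivity)]
      apply ofReal_le_ofReal
      apply le_of_eq
      field_simp
  refine le_trans ?_ (mul_le_mul' le_rfl (mul_le_mul' le_rfl hmin))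
  have hd := hJ.d_pos
  have hN : 2 ≤ M ^ d := hM.trans (Nat.le_self_pow (by omega) M)
  have hNN : M ^ d ≤ M ^ d * M ^ d := Nat.le_mul_self _
  rw [← ofReal_mul (by positivity), ← ENNReal.ofReal_natCast, ← ofReal_mul (by positivity)]
  apply ofReal_le_ofReal
  rw [Nat.cast_sub hNN, Nat.cast_mul]
  obtain ⟨N, hN'⟩ : ∃ N, N = ((M ^ d : ℕ):ℝ) := ⟨_, rfl⟩
  rw [← hN']
  have hN2 : 2 ≤ N := by rw [hN']; exact_mod_cast hN
  have hkey : 10000 * A ≤ e * (N * N) := by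
    have : N * N = A * (M:ℝ) ^ ((d:ℝ) - α) := by
      rw [hN', hA, ← Real.rpow_add hM0, Nat.cast_pow, ← pow_add, ← Real.rpow_natCast]
      congr 1; push_cast; ring
    rw [this]
    nlinarith
  have h5 : A ≤ (N * N - N) * (1 / 5000 * e) := by nlinarith
  calc A / β * (A * B) = A * (A * B / β) := by ring
    _ ≤ (N * N - N) * (1 / 5000 * e) * (A * B / β) := by gcongr
    _ = _ := by ring
theorem xx_bound (hJ : KernelHyp d J α c C) (hP : IsLRP J P) : ∃ A : ℝ, 0 < A ∧
    (∀ β, 0 < β → β ≤ A → chi P β ≠ ∞ → ∀ m : ℕ, 1 ≤ m → xx (P β) (blk m 0) ≤ oR (A / β * (m:ℝ) ^ ((d:ℝ) + α))) ∧ chi P A = ∞ := by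
  have hα := hJ.alpha_pos
  have hαd := hJ.alpha_lt_d
  have hs : 0 < (d:ℝ) + α := by positivity
  have he0 : 0 < min c 1 := lt_min hJ.c_pos one_pos
  obtain ⟨M, hM2, hM⟩ : ∃ M : ℕ, 2 ≤ M ∧ 10000 ≤ min c 1 * (M:ℝ) ^ ((d:ℝ) - α) := by
    have := ((tendsto_rpow_atTop (sub_pos.2 hαd)).comp tendsto_natCast_atTop_atTop).const_mul_atTop he0
    obtain ⟨M, h1, h2⟩ := ((Filter.eventually_ge_atTop 2).and (this.eventually_ge_atTop 10000)).exists
    exact ⟨M, h1, h2⟩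
  have hM0 : (0:ℝ) < M := by positivity
  have hA0 : 0 < (M:ℝ) ^ ((d:ℝ) + α) := by positivity
  have main : ∀ β, 0 < β → β ≤ (M:ℝ) ^ ((d:ℝ) + α) → ∀ m : ℕ, 1 ≤ m →
      oR ((M:ℝ) ^ ((d:ℝ) + α) / β * (m:ℝ) ^ ((d:ℝ) + α)) ≤ xx (P β) (blk m 0) → chi P β = ∞ := by
    intro β hβ hβ' m hm h
    by_contra hfin
    have it : ∀ k : ℕ, oR ((M:ℝ) ^ ((d:ℝ) + α) / β * ((M ^ k * m : ℕ):ℝ) ^ ((d:ℝ) + α)) ≤ xx (P β) (blk (M ^ k * m) 0) := by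
      intro k
      induction k with
      | zero => simpa using h
      | succ k ih =>
        have := xx_step hJ hP hM2 hM hβ hβ' (Nat.mul_pos (pow_pos (by omega) k) hm) ih
        rwa [← mul_assoc, ← pow_succ'] at this
    have it2 : ∀ k : ℕ, (M:ℝ) ^ ((d:ℝ) + α) / β * ((M ^ k * m : ℕ):ℝ) ^ α ≤ (chi P β).toReal := by
      intro k
      have h1 := (it k).trans (xx_le_chi hJ hP hβ.le _)
      rw [← ofReal_toReal hfin, ← ENNReal.ofReal_natCast, ← ofReal_mul (by positivity), ofReal_le_ofReal_iff (by positivity)] at h1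
      have hp : (0:ℝ) < ((M ^ k * m : ℕ):ℝ) := by exact_mod_cast Nat.mul_pos (pow_pos (by omega) k) hm
      rw [Real.rpow_add hp, Real.rpow_natCast, Nat.cast_pow] at h1
      have hp2 := pow_pos hp d
      refine le_of_mul_le_mul_left ?_ hp2
      calc _ = _ := by ring
        _ ≤ _ := h1
    have ht : Filter.Tendsto (fun k : ℕ => (M:ℝ) ^ ((d:ℝ) + α) / β * ((M ^ k * m : ℕ):ℝ) ^ α) Filter.atTop Filter.atTop := by
      refine Filter.Tendsto.const_mul_atTop (by positivity) ((tendsto_rpow_atTop hα).comp (tendsto_natCast_atTop_atTop.comp ?_))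
      exact Filter.tendsto_atTop_mono (fun k => Nat.le_mul_of_pos_right _ hm) (tendsto_pow_atTop_atTop_of_one_lt (r := M) (by omega))
    obtain ⟨k, hk⟩ := (ht.eventually_gt_atTop (chi P β).toReal).exists
    exact absurd (it2 k) (not_le.2 hk)
  refine ⟨_, hA0, fun β hβ hβ' hfin m hm => ?_, ?_⟩
  · by_contra h
    exact hfin (main β hβ hβ' m hm (not_le.1 h).le)
  · refine main _ hA0 le_rfl 1 le_rfl ?_
    rw [div_self hA0.ne']
    have hpr := (isBer hJ hP hA0.le).prob
    have h0 : (0 : V d) ∈ blk 1 0 := by rw [mem_blk]; intro k; simp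
    rw [xx]
    refine le_trans ?_ (Finset.single_le_sum (f := fun u => ∑' v, tau _ _ u v) (fun _ _ => zero_le) h0)
    refine le_trans ?_ (ENNReal.le_tsum 0)
    have : {ω : Config d | connIn ω (blk 1 0 : FV d) 0 0} = Set.univ := by
      ext ω; simp only [Set.mem_ofPred_eq, Set.mem_univ, iff_true]; exact connIn.refl h0
    rw [tau, this, measure_univ]; simp
end Renorm2
end Part9
section Part10
section Dyadic
variable {d : ℕ}
theorem ofReal_geom {q K : ℝ} (hq0 : 0 ≤ q) (hq : q < 1) (hK : 0 ≤ K) :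
    ∑' k : ℕ, oR (K * q ^ k) = oR (K * (1 - q)⁻¹) := by
  rw [← ENNReal.ofReal_tsum_of_nonneg (fun k => by positivity) ((summable_geometric_of_lt_one hq0 hq).mul_left K),
    tsum_mul_left, tsum_geometric_of_lt_one hq0 hq]
theorem count_ball {r : ℝ} (hr : 0 ≤ r) :
    ∑' w : V d, (if w ≠ 0 ∧ (normInf w : ℝ) ≤ r then (1:ℝ≥0∞) else 0) ≤ oR (3 ^ d * r ^ d) := by
  by_cases h1 : r < 1
  · have : ∀ w : V d, (if w ≠ 0 ∧ (normInf w : ℝ) ≤ r then (1:ℝ≥0∞) else 0) = 0 := by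
      intro w
      rw [if_neg]
      rintro ⟨h2, h3⟩
      have : normInf w < 1 := by exact_mod_cast h3.trans_lt h1
      exact h2 (normInf_eq_zero.1 (by omega))
    simp [this]
  · push Not at h1
    calc _ ≤ ∑' w : V d, (if w ∈ (bx ⌊r⌋₊ : FV d) then (1:ℝ≥0∞) else 0) := by
          refine ENNReal.tsum_le_tsum fun w => ?_
          split_ifs with h2 h3 h3
          · exact le_rfl
          · exact absurd (mem_bx.2 (Nat.le_floor h2.2)) h3
          · exact zero_le
          · exact le_rfl
      _ = ((2 * ⌊r⌋₊ + 1) ^ d : ℕ) := by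
          rw [tsum_eq_sum (s := bx ⌊r⌋₊) (fun w hw => if_neg hw), Finset.sum_congr rfl (fun w hw => if_pos hw), Finset.sum_const, card_bx]; simp
      _ ≤ _ := by
          rw [← ENNReal.ofReal_natCast]
          apply ofReal_le_ofReal
          rw [← mul_pow]; push_cast
          gcongr
          linarith [Nat.floor_le hr]
theorem near_sum {t r : ℝ} (ht : 0 ≤ t) (htd : t < d) (hr : 0 < r) :
    ∑' w : V d, (if w ≠ 0 ∧ (normInf w : ℝ) ≤ r then oR ((normInf w : ℝ) ^ (-t)) else 0)
      ≤ oR (3 ^ d * 2 ^ t * (1 - (2:ℝ) ^ (-((d:ℝ) - t)))⁻¹ * r ^ ((d:ℝ) - t)) := by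
  have hq0 : 0 < (2:ℝ) ^ (-((d:ℝ) - t)) := by positivity
  have hq1 : (2:ℝ) ^ (-((d:ℝ) - t)) < 1 := Real.rpow_lt_one_of_one_lt_of_neg (by norm_num) (by linarith)
  calc _ ≤ ∑' w : V d, ∑' k : ℕ, (if w ≠ 0 ∧ (normInf w : ℝ) ≤ r * (1/2) ^ k then (1:ℝ≥0∞) else 0) * oR ((r * (1/2) ^ k / 2) ^ (-t)) := by
        refine ENNReal.tsum_le_tsum fun w => ?_
        split_ifs with h
        · have hw : (0:ℝ) < normInf w := by
            have : normInf w ≠ 0 := fun h' => h.1 (normInf_eq_zero.1 h')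
            positivity
          obtain ⟨k, h1, h2⟩ := exists_nat_pow_near_of_lt_one (x := normInf w / r) (y := (1/2:ℝ)) (by positivity) ((div_le_one hr).2 h.2) (by norm_num) (by norm_num)
          rw [lt_div_iff₀ hr] at h1
          rw [div_le_iff₀ hr] at h2
          refine le_trans ?_ (ENNReal.le_tsum k)
          rw [if_pos ⟨h.1, by linarith⟩, one_mul]
          apply ofReal_le_ofReal
          refine Real.rpow_le_rpow_of_nonpos (by positivity) ?_ (by linarith)
          rw [pow_succ] at h1; linarith
        · exact zero_le
    _ = ∑' k : ℕ, (∑' w : V d, (if w ≠ 0 ∧ (normInf w : ℝ) ≤ r * (1/2) ^ k then (1:ℝ≥0∞) else 0)) * oR ((r * (1/2) ^ k / 2) ^ (-t)) := by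
        rw [ENNReal.tsum_comm]; simp_rw [ENNReal.tsum_mul_right]
    _ ≤ ∑' k : ℕ, oR (3 ^ d * 2 ^ t * r ^ ((d:ℝ) - t) * ((2:ℝ) ^ (-((d:ℝ) - t))) ^ k) := by
        refine ENNReal.tsum_le_tsum fun k => ?_
        refine (mul_le_mul' (count_ball (by positivity)) le_rfl).trans ?_
        rw [← ofReal_mul (by positivity)]
        apply ofReal_le_ofReal
        apply le_of_eq
        have h1 : (2:ℝ) ^ (-((d:ℝ) - t)) = (1/2:ℝ) ^ ((d:ℝ) - t) := by rw [one_div, Real.inv_rpow (by norm_num), Real.rpow_neg (by norm_num)]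
        rw [h1, ← Real.rpow_natCast (_ ^ _), ← Real.rpow_mul (by norm_num), mul_comm _ (k:ℝ), Real.rpow_mul (by norm_num), Real.rpow_natCast]
        have h2 : 0 < r * (1/2) ^ k := by positivity
        rw [Real.div_rpow h2.le (by norm_num), Real.rpow_neg (by norm_num : (0:ℝ) ≤ 2), div_inv_eq_mul]
        rw [mul_assoc (3 ^ d * 2 ^ t), ← Real.mul_rpow hr.le (by positivity), sub_eq_add_neg, Real.rpow_add h2, Real.rpow_natCast]
        ring
    _ = _ := by
        rw [ofReal_geom hq0.le hq1 (by positivity)]; congr 1; ring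
theorem tail_sum {f : V d → ℝ≥0∞} {G a s : ℝ} (hG : 0 ≤ G) (hs : 0 ≤ s) (has : a < s)
    (hf : ∀ m : ℕ, 1 ≤ m → ∑' w, (if normInf w ≤ m then f w else 0) ≤ oR (G * (m:ℝ) ^ a)) {R : ℕ} (hR : 1 ≤ R) :
    ∑' w, f w * oR (((max R (normInf w) : ℕ) : ℝ) ^ (-s)) ≤
      oR (2 ^ s * (1 - (2:ℝ) ^ (a - s))⁻¹ * G * (R:ℝ) ^ (a - s)) := by
  have hq0 : 0 < (2:ℝ) ^ (a - s) := by positivity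
  have hq1 : (2:ℝ) ^ (a - s) < 1 := Real.rpow_lt_one_of_one_lt_of_neg (by norm_num) (by linarith)
  have hR0 : (0:ℝ) < R := by positivity
  calc _ ≤ ∑' w : V d, ∑' k : ℕ, (if normInf w ≤ 2 ^ k * R then f w else 0) * oR (2 ^ s * ((2 ^ k * R : ℕ):ℝ) ^ (-s)) := by
        refine ENNReal.tsum_le_tsum fun w => ?_
        by_cases h : normInf w ≤ R
        · refine le_trans ?_ (ENNReal.le_tsum 0)
          rw [if_pos (by simpa using h), max_eq_left h]
          gcongr
          simp only [pow_zero, one_mul]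
          exact le_mul_of_one_le_left (by positivity) (Real.one_le_rpow (by norm_num) hs)
        · push Not at h
          have h' : (R:ℝ) < normInf w := by exact_mod_cast h
          obtain ⟨k, h1, h2⟩ := exists_nat_pow_near (x := (normInf w : ℝ) / R) (y := (2:ℝ)) ((one_le_div hR0).2 h'.le) (by norm_num)
          rw [div_lt_iff₀ hR0] at h2
          rw [le_div_iff₀ hR0] at h1
          refine le_trans ?_ (ENNReal.le_tsum (k+1))
          rw [if_pos (by exact_mod_cast h2.le), max_eq_right h.le]
          gcongr
          have h3 : ((2 ^ (k+1) * R : ℕ):ℝ) = 2 * (2 ^ k * R) := by push_cast; ring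
          rw [h3, Real.mul_rpow (by norm_num) (by positivity), ← mul_assoc, ← Real.rpow_add (by norm_num), add_neg_cancel, Real.rpow_zero, one_mul]
          exact Real.rpow_le_rpow_of_nonpos (by positivity) h1 (by linarith)
    _ = ∑' k : ℕ, (∑' w : V d, (if normInf w ≤ 2 ^ k * R then f w else 0)) * oR (2 ^ s * ((2 ^ k * R : ℕ):ℝ) ^ (-s)) := by
        rw [ENNReal.tsum_comm]; simp_rw [ENNReal.tsum_mul_right]
    _ ≤ ∑' k : ℕ, oR (2 ^ s * G * (R:ℝ) ^ (a - s) * ((2:ℝ) ^ (a - s)) ^ k) := by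
        refine ENNReal.tsum_le_tsum fun k => ?_
        refine (mul_le_mul' (hf _ (Nat.mul_pos (by positivity) hR)) le_rfl).trans ?_
        rw [← ofReal_mul (by positivity)]
        apply ofReal_le_ofReal
        apply le_of_eq
        have h2 : (0:ℝ) < 2 ^ k := by positivity
        rw [← Real.rpow_natCast (_ ^ _), ← Real.rpow_mul (by norm_num), mul_comm _ (k:ℝ), Real.rpow_mul (by norm_num), Real.rpow_natCast]
        push_cast
        rw [mul_assoc _ ((R:ℝ) ^ _), ← Real.mul_rpow hR0.le h2.le, mul_comm (R:ℝ), sub_eq_add_neg, Real.rpow_add (by positivity)]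
        ring
    _ = _ := by
        rw [ofReal_geom hq0.le hq1 (by positivity)]; congr 1; ring
end Dyadic
section Pt
variable {d : ℕ} {J : V d → V d → ℝ} {α c C : ℝ} {P : ℝ → Measure (Config d)} {β : ℝ} {μ : Measure (Config d)}
theorem F_le (hJ : KernelHyp d J α c C) (hP : IsLRP J P) (hβ : 0 ≤ β) (n : ℕ) :
    (((n + 1) ^ d : ℕ) : ℝ≥0∞) * ∑' y, tau (P β) (bx n : FV d) 0 y ≤ xx (P β) (blk (3 * n + 1) 0) := by
  classical
  rw [← card_blk (n + 1), ← nsmul_eq_mul, ← Finset.sum_const]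
  calc _ ≤ ∑ u ∈ blk (n + 1) 0, ∑' v, tau (P β) (blk (3 * n + 1) 0 : FV d) (u + fun _ => (n:ℤ)) v := by
        refine Finset.sum_le_sum fun u hu => ?_
        set z : V d := u + fun _ => (n:ℤ) with hz
        conv_rhs => rw [← (Equiv.addRight z).tsum_eq]
        refine ENNReal.tsum_le_tsum fun y => ?_
        rw [← tau_shift (isBer hJ hP hβ) (TI_pJ hJ) z, zero_add, Equiv.coe_addRight]
        refine tau_mono fun v hv => ?_
        have hv' : v - z ∈ bx n := hv
        rw [mem_bx, normInf_le] at hv'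
        rw [Finset.mem_coe, mem_blk]
        rw [mem_blk] at hu
        intro k
        have h1 := hv' k; have h2 := hu k
        simp [hz] at *
        omega
    _ = ∑ u ∈ (blk (n + 1) 0).image (fun u => u + fun _ => (n:ℤ)), ∑' v, tau (P β) (blk (3 * n + 1) 0 : FV d) u v := by
        rw [Finset.sum_image fun a _ b _ h => add_left_injective _ h]
    _ ≤ _ := by
        refine Finset.sum_le_sum_of_subset fun u hu => ?_
        rw [Finset.mem_image] at hu
        obtain ⟨v, hv, rfl⟩ := hu
        rw [mem_blk] at *
        intro k; have := hv k; simp at *; omega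
theorem F_bound (hJ : KernelHyp d J α c C) (hP : IsLRP J P) : ∃ A : ℝ, 0 < A ∧ chi P A = ∞ ∧
    ∀ β, 0 < β → β ≤ A → chi P β ≠ ∞ → ∀ n : ℕ, ∑' y, tau (P β) (bx n : FV d) 0 y ≤
      oR (A / β * 3 ^ ((d:ℝ) + α) * ((n:ℝ) + 1) ^ α) := by
  obtain ⟨A, hA, h1, h2⟩ := xx_bound hJ hP
  refine ⟨A, hA, h2, fun β hβ hβ' hfin n => ?_⟩
  have hα := hJ.alpha_pos
  have h3 := (F_le hJ hP hβ.le n).trans (h1 β hβ hβ' hfin (3 * n + 1) (by omega))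
  have h4 : ((n + 1) ^ d : ℕ) ≠ 0 := by positivity
  rw [mul_comm, ← ENNReal.le_div_iff_mul_le (Or.inl (by exact_mod_cast h4)) (Or.inl (ENNReal.natCast_ne_top _))] at h3
  refine h3.trans ?_
  rw [← ENNReal.ofReal_natCast, ← ENNReal.ofReal_div_of_pos (by exact_mod_cast Nat.pos_of_ne_zero h4)]
  apply ofReal_le_ofReal
  rw [div_le_iff₀ (by exact_mod_cast Nat.pos_of_ne_zero h4), mul_assoc, mul_assoc]
  gcongr
  have : ((n:ℝ) + 1) ^ α * (((n + 1) ^ d : ℕ) : ℝ) = ((n:ℝ) + 1) ^ ((d:ℝ) + α) := by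
    rw [add_comm (d:ℝ), Real.rpow_add (by positivity), Real.rpow_natCast]; push_cast; rfl
  rw [this, ← Real.mul_rpow (by norm_num) (by positivity)]
  refine Real.rpow_le_rpow (by positivity) ?_ (by positivity)
  push_cast; linarith
noncomputable def nu (J : V d → V d → ℝ) (μ : Measure (Config d)) (β : ℝ) (R : ℕ) (z : V d) : ℝ≥0∞ :=
  ∑' y, tau μ (bx (2 * R) : FV d) 0 y * (oR (β * J y z) * ((min R (normInf (y - z)) : ℕ) : ℝ≥0∞))
theorem avg_exit (hJ : KernelHyp d J α c C) (hP : IsLRP J P) (hβ : 0 ≤ β) (R : ℕ) (D : SV d) (x : V d) :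
    (R : ℝ≥0∞) * tau (P β) D 0 x ≤ R * tau (P β) (bx (2 * R) : FV d) 0 x +
      ∑' z, (if R < normInf z then nu J (P β) β R z else 0) * tau (P β) D z x := by
  classical
  have hB := isBer hJ hP hβ
  have h1 : ∀ ρ ∈ Finset.Ico R (2 * R), tau (P β) D 0 x ≤ tau (P β) (bx (2 * R) : FV d) 0 x +
      ∑' z, ∑' y, (if normInf y ≤ ρ ∧ ρ < normInf z then 1 else 0) * (if R < normInf z then tau (P β) (bx (2 * R) : FV d) 0 y * oR (β * J y z) else 0) * tau (P β) D z x := by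
    intro ρ hρ
    rw [Finset.mem_Ico] at hρ
    have hsub : ((bx ρ : FV d) : SV d) ⊆ (bx (2 * R) : FV d) := Finset.coe_subset.2 (bx_mono (by omega))
    refine (exit_lemma hB (U := (bx ρ : FV d)) (Finset.mem_coe.2 (zero_mem_bx ρ)) (Filter.Eventually.of_forall fun ω => (Finset.finite_toSet _).subset Kc_subset)).trans ?_
    refine add_le_add (tau_mono hsub) (ENNReal.tsum_le_tsum fun z => ?_)
    by_cases hz : z ∈ ((bx ρ : FV d) : SV d)
    · rw [if_pos hz]; exact zero_le
    rw [if_neg hz]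
    have hz' : ρ < normInf z := by rw [Finset.mem_coe, mem_bx] at hz; omega
    have hz0 : (0 : V d) ≠ z := by rintro rfl; exact hz (Finset.mem_coe.2 (zero_mem_bx ρ))
    rw [ENNReal.tsum_mul_right]
    refine mul_le_mul' ((exit_prob hB hz).trans ?_) (tau_mono Set.sdiff_subset)
    rw [if_neg hz0, zero_add]
    refine ENNReal.tsum_le_tsum fun y => ?_
    by_cases hy : y ∈ (bx ρ : FV d)
    · rw [if_pos ⟨mem_bx.1 hy, hz'⟩, one_mul, if_pos (by omega)]
      exact mul_le_mul' (tau_mono hsub) (ofReal_le_ofReal (pJ_le hJ y z))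
    · rw [tau_notMem (by simpa using hy)]; simp
  have h2 := Finset.sum_le_sum h1
  rw [Finset.sum_const, Nat.card_Ico, Finset.sum_add_distrib, Finset.sum_const, Nat.card_Ico, show 2 * R - R = R by omega, nsmul_eq_mul, nsmul_eq_mul] at h2
  refine h2.trans (add_le_add le_rfl ?_)
  rw [← Summable.tsum_finsetSum fun _ _ => ENNReal.summable]
  refine ENNReal.tsum_le_tsum fun z => ?_
  rw [← Summable.tsum_finsetSum fun _ _ => ENNReal.summable]
  simp_rw [← Finset.sum_mul]
  rw [ENNReal.tsum_mul_right]
  gcongr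
  split_ifs with hz
  · refine ENNReal.tsum_le_tsum fun y => ?_
    rw [mul_comm, mul_assoc]
    gcongr
    rw [← Finset.sum_filter, Finset.sum_const, nsmul_one]
    have ht := normInf_tri z y 0
    simp only [sub_zero] at ht
    rw [normInf_sub_comm z y] at ht
    refine Nat.cast_le.2 (le_min ?_ ?_)
    · exact (Finset.card_filter_le _ _).trans (by simp; omega)
    · refine (Finset.card_le_card (t := Finset.Ico (normInf y) (normInf z)) fun ρ hρ => ?_).trans (by simp; omega)
      rw [Finset.mem_filter] at hρ
      exact Finset.mem_Ico.2 hρ.2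
  · simp
end Pt
end Part10
section Part11
section Pt
variable {d : ℕ} {J : V d → V d → ℝ} {α c C : ℝ} {P : ℝ → Measure (Config d)} {β : ℝ} {μ : Measure (Config d)}
theorem C_pos (hJ : KernelHyp d J α c C) : 0 < C := hJ.c_pos.trans_le hJ.c_le_C
theorem nu_bound (hJ : KernelHyp d J α c C) (hα1 : α < 1) : ∃ K : ℝ, 0 ≤ K ∧ ∀ (μ : Measure (Config d)) (β : ℝ) (R : ℕ) (a F δ : ℝ),
    0 ≤ β → 1 ≤ R → 0 ≤ a → 0 ≤ F → 0 < δ → δ ≤ 1/2 →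
    (∀ y, normInf y ≤ 2 * R → 2 * R ≤ 8 * normInf y → tau μ (bx (2 * R) : FV d) 0 y ≤ oR (a * ((2 * R : ℕ):ℝ) ^ (α - d))) →
    (∑' y, tau μ (bx (2 * R) : FV d) 0 y ≤ oR (F * (((2 * R : ℕ):ℝ) + 1) ^ α)) →
    ∀ z, R < normInf z → nu J μ β R z ≤ oR (β * K * (a * δ ^ (1 - α) + F * δ ^ (-((d:ℝ) + α))) * (R:ℝ) ^ (1 - (d:ℝ))) := by
  have hα := hJ.alpha_pos
  have hαd := hJ.alpha_lt_d
  have hd : (1:ℝ) ≤ d := by exact_mod_cast hJ.d_pos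
  have hC := C_pos hJ
  obtain ⟨Cn, hCn0, hCn⟩ : ∃ Cn : ℝ, 0 ≤ Cn ∧ ∀ r : ℝ, 0 < r →
      ∑' w : V d, (if w ≠ 0 ∧ (normInf w : ℝ) ≤ r then oR ((normInf w : ℝ) ^ (-((d:ℝ) + α - 1))) else 0) ≤ oR (Cn * r ^ (1 - α)) := by
    refine ⟨3 ^ d * 2 ^ ((d:ℝ) + α - 1) * (1 - (2:ℝ) ^ (-(1 - α)))⁻¹, ?_, fun r hr => (near_sum (t := (d:ℝ) + α - 1) (by linarith) (by linarith) hr).trans (le_of_eq ?_)⟩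
    rotate_left
    · rw [show (d:ℝ) - ((d:ℝ) + α - 1) = 1 - α by ring]
    · have : (2:ℝ) ^ (-(1 - α)) < 1 := Real.rpow_lt_one_of_one_lt_of_neg (by norm_num) (by linarith)
      have : 0 ≤ 1 - (2:ℝ) ^ (-(1 - α)) := by linarith
      positivity
  refine ⟨C * (Cn + 3 ^ α), by positivity, ?_⟩
  intro μ β R a F δ hβ hR ha hF hδ hδ2 hS hsum z hz
  have hR0 : (1:ℝ) ≤ R := by exact_mod_cast hR
  have hR' : (0:ℝ) < R := by positivity
  have hz' : (R:ℝ) < normInf z := by exact_mod_cast hz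
  have hterm : ∀ y : V d, tau μ (bx (2 * R) : FV d) 0 y * (oR (β * J y z) * ((min R (normInf (y - z)) : ℕ) : ℝ≥0∞)) ≤
      oR (a * (R:ℝ) ^ (α - d) * (β * C)) * (if y - z ≠ 0 ∧ (normInf (y - z) : ℝ) ≤ δ * R then oR ((normInf (y - z) : ℝ) ^ (-((d:ℝ) + α - 1))) else 0)
      + tau μ (bx (2 * R) : FV d) 0 y * oR (β * C * (δ * R) ^ (-((d:ℝ) + α)) * R) := by
    intro y
    by_cases hyz : y = z
    · subst hyz; simp [normInf_eq_zero.2]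
    have hn0 : (0:ℝ) < normInf (y - z) := by
      have : normInf (y - z) ≠ 0 := fun h => hyz (sub_eq_zero.1 (normInf_eq_zero.1 h))
      positivity
    have hup := hJ.upper y z hyz
    rw [← ENNReal.ofReal_natCast, ← ofReal_mul (mul_nonneg hβ (hJ.nonneg _ _))]
    by_cases hle : (normInf (y - z) : ℝ) ≤ δ * R
    · refine le_trans ?_ (le_add_of_nonneg_right zero_le)
      rw [if_pos ⟨sub_ne_zero.2 hyz, hle⟩, ofReal_mul (p := a * (R:ℝ) ^ (α - d)) (by positivity), mul_assoc (oR _), ← ofReal_mul (by positivity)]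
      refine mul_le_mul' ?_ (ofReal_le_ofReal ?_)
      · by_cases hy : normInf y ≤ 2 * R
        · refine (hS y hy ?_).trans (ofReal_le_ofReal ?_)
          · have ht := normInf_tri z y 0
            simp only [sub_zero] at ht
            rw [normInf_sub_comm z y] at ht
            have ht' : (normInf z : ℝ) ≤ normInf (y - z) + normInf y := by exact_mod_cast ht
            have : δ * R ≤ 1/2 * R := by gcongr
            have : (2:ℝ) * R ≤ 8 * normInf y := by linarith
            exact_mod_cast this
          · exact mul_le_mul_of_nonneg_left (Real.rpow_le_rpow_of_nonpos hR' (by push_cast; linarith) (by linarith)) ha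
        · rw [tau_notMem (by rw [Finset.mem_coe, mem_bx]; exact hy)]; exact zero_le
      · calc β * J y z * ((min R (normInf (y - z)) : ℕ) : ℝ) ≤ β * (C * (normInf (y - z) : ℝ) ^ (-(d:ℝ) - α)) * normInf (y - z) := by
              gcongr
              exact_mod_cast min_le_right _ _
          _ = β * C * (normInf (y - z) : ℝ) ^ (-((d:ℝ) + α - 1)) := by
              rw [show -((d:ℝ) + α - 1) = (-(d:ℝ) - α) + 1 by ring, Real.rpow_add_one hn0.ne']; ring
    · push Not at hle
      refine le_trans ?_ (le_add_of_nonneg_left zero_le)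
      refine mul_le_mul' le_rfl (ofReal_le_ofReal ?_)
      calc β * J y z * ((min R (normInf (y - z)) : ℕ) : ℝ) ≤ β * (C * (normInf (y - z) : ℝ) ^ (-(d:ℝ) - α)) * R := by
            gcongr
            exact_mod_cast min_le_left _ _
        _ ≤ β * (C * (δ * R) ^ (-(d:ℝ) - α)) * R := by
            gcongr β * (C * ?_) * R
            exact Real.rpow_le_rpow_of_nonpos (by positivity) hle.le (by linarith)
        _ = β * C * (δ * R) ^ (-((d:ℝ) + α)) * R := by rw [neg_add']; ring
  refine (ENNReal.tsum_le_tsum hterm).trans ?_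
  rw [ENNReal.tsum_add, ENNReal.tsum_mul_left, ENNReal.tsum_mul_right]
  refine (add_le_add (mul_le_mul' le_rfl (((Equiv.subRight z).tsum_eq (fun w : V d => if w ≠ 0 ∧ (normInf w : ℝ) ≤ δ * R then oR ((normInf w : ℝ) ^ (-((d:ℝ) + α - 1))) else 0)).le.trans (hCn (δ * R) (by positivity)))) (mul_le_mul' hsum le_rfl)).trans ?_
  rw [← ofReal_mul (by positivity), ← ofReal_mul (by positivity), ← ofReal_add (by positivity) (by positivity)]
  apply ofReal_le_ofReal
  have e1 : (R:ℝ) ^ (α - d) * (R:ℝ) ^ (1 - α) = (R:ℝ) ^ (1 - (d:ℝ)) := by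
    rw [← Real.rpow_add hR']; congr 1; ring
  have e2 : (R:ℝ) ^ (-((d:ℝ) + α)) * R * (R:ℝ) ^ α = (R:ℝ) ^ (1 - (d:ℝ)) := by
    rw [← Real.rpow_add_one hR'.ne', ← Real.rpow_add hR']; congr 1; ring
  rw [Real.mul_rpow hδ.le hR'.le, Real.mul_rpow hδ.le hR'.le]
  have e3 : (((2 * R : ℕ):ℝ) + 1) ^ α ≤ 3 ^ α * (R:ℝ) ^ α := by
    rw [← Real.mul_rpow (by norm_num) hR'.le]
    exact Real.rpow_le_rpow (by positivity) (by push_cast; linarith) hα.le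
  calc _ ≤ a * (R:ℝ) ^ (α - d) * (β * C) * (Cn * (δ ^ (1 - α) * (R:ℝ) ^ (1 - α))) + F * (3 ^ α * (R:ℝ) ^ α) * (β * C * (δ ^ (-((d:ℝ) + α)) * (R:ℝ) ^ (-((d:ℝ) + α))) * R) := by gcongr
    _ = β * C * (Cn * (a * δ ^ (1 - α)) * ((R:ℝ) ^ (α - d) * (R:ℝ) ^ (1 - α)) + 3 ^ α * (F * δ ^ (-((d:ℝ) + α))) * ((R:ℝ) ^ (-((d:ℝ) + α)) * R * (R:ℝ) ^ α)) := by ring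
    _ ≤ β * C * ((Cn + 3 ^ α) * (a * δ ^ (1 - α)) * (R:ℝ) ^ (1 - (d:ℝ)) + (Cn + 3 ^ α) * (F * δ ^ (-((d:ℝ) + α))) * (R:ℝ) ^ (1 - (d:ℝ))) := by
        rw [e1, e2]
        gcongr
        · linarith [show (0:ℝ) < 3 ^ α by positivity]
        · linarith
    _ = _ := by ring
theorem F_center (hJ : KernelHyp d J α c C) (hP : IsLRP J P) (hβ : 0 ≤ β) {N : ℕ} {x : V d} (hx : normInf x ≤ N) :
    ∑' z, tau (P β) (bx N : FV d) z x ≤ ∑' z, tau (P β) (bx (2 * N) : FV d) 0 z := by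
  conv_rhs => rw [← (Equiv.subRight x).tsum_eq]
  refine ENNReal.tsum_le_tsum fun z => ?_
  rw [tau_symm, ← tau_shift (isBer hJ hP hβ) (TI_pJ hJ) (-x)]
  have : x + -x = 0 := by simp
  rw [this, Equiv.subRight_apply, ← sub_eq_add_neg]
  refine tau_mono fun v hv => ?_
  have hv' : v - -x ∈ bx N := hv
  rw [Finset.mem_coe, mem_bx]
  rw [mem_bx] at hv'
  have := normInf_add_le (v - -x) (-x)
  rw [normInf_neg] at this
  simp at *
  omega
theorem S_bound (hJ : KernelHyp d J α c C) (hP : IsLRP J P) (hα1 : α < 1) {A F : ℝ} (hA : 0 < A) (hF : 0 < F) : ∃ a : ℝ, 0 < a ∧ ∀ β, 0 ≤ β → β ≤ A →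
    (∀ n : ℕ, ∑' y, tau (P β) (bx n : FV d) 0 y ≤ oR (F * ((n:ℝ) + 1) ^ α)) →
    ∀ (N : ℕ) (x : V d), 1 ≤ N → normInf x ≤ N → N ≤ 8 * normInf x → tau (P β) (bx N : FV d) 0 x ≤ oR (a * (N:ℝ) ^ (α - d)) := by
  obtain ⟨K, hK0, hK⟩ := nu_bound hJ hα1
  have hα := hJ.alpha_pos
  have hαd := hJ.alpha_lt_d
  have hd : (1:ℝ) ≤ d := by exact_mod_cast hJ.d_pos
  set Q : ℝ := A * K * F * 3 ^ α * 64 ^ (d:ℝ) with hQ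
  have hQ0 : 0 ≤ Q := by positivity
  set η : ℝ := 1 / (2 * Q + 2) with hη
  have hη0 : 0 < η := by positivity
  have hη2 : η ≤ 1/2 := by rw [hη]; exact one_div_le_one_div_of_le (by norm_num) (by linarith)
  have hQη : Q * η ≤ 1/2 := by
    rw [hη, mul_one_div, div_le_div_iff₀ (by positivity) (by norm_num)]; linarith
  set δ : ℝ := η ^ (1 / (1 - α)) with hδ
  have hδ0 : 0 < δ := by positivity
  have h1α : 0 < 1 - α := by linarith
  have hδ2 : δ ≤ 1/2 := by
    refine le_trans ?_ hη2
    calc δ ≤ η ^ (1:ℝ) := Real.rpow_le_rpow_of_exponent_ge hη0 (by linarith) (by rw [le_div_iff₀ h1α]; linarith)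
      _ = η := Real.rpow_one _
  have hδη : δ ^ (1 - α) = η := by
    rw [hδ, ← Real.rpow_mul hη0.le, one_div_mul_cancel h1α.ne', Real.rpow_one]
  set a : ℝ := 2 * Q * F * δ ^ (-((d:ℝ) + α)) + 32 ^ (d:ℝ) with ha
  have ha0 : 0 < a := by positivity
  have hfin : Q * (a * δ ^ (1 - α) + F * δ ^ (-((d:ℝ) + α))) ≤ a := by
    rw [hδη]
    have : Q * (a * η) ≤ 1/2 * a := by nlinarith
    have h2 : 2 * (Q * (F * δ ^ (-((d:ℝ) + α)))) ≤ a := by rw [ha]; nlinarith [show (0:ℝ) < 32 ^ (d:ℝ) by positivity]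
    linarith
  refine ⟨a, ha0, fun β hβ hβA hFn => ?_⟩
  intro N
  induction N using Nat.strong_induction_on with
  | _ N ih =>
  intro x hN hxN hNx
  have hN0 : (0:ℝ) < N := by positivity
  by_cases hN32 : N < 32
  · refine (tau_le_one hJ hP hβ).trans ?_
    rw [← ofReal_one]
    apply ofReal_le_ofReal
    have h1 : (32:ℝ) ^ (-(d:ℝ)) ≤ (N:ℝ) ^ (α - d) := by
      calc (32:ℝ) ^ (-(d:ℝ)) ≤ (N:ℝ) ^ (-(d:ℝ)) := Real.rpow_le_rpow_of_nonpos hN0 (by exact_mod_cast hN32.le) (by linarith)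
        _ ≤ _ := Real.rpow_le_rpow_of_exponent_le (by exact_mod_cast hN) (by linarith)
    calc (1:ℝ) = 32 ^ (d:ℝ) * 32 ^ (-(d:ℝ)) := by rw [← Real.rpow_add (by norm_num)]; simp
      _ ≤ a * (N:ℝ) ^ (α - d) := by
        gcongr
        rw [ha]; linarith [show 0 ≤ 2 * Q * F * δ ^ (-((d:ℝ) + α)) by positivity]
  · push Not at hN32
    obtain ⟨R, hR⟩ : ∃ R, R = N / 32 := ⟨_, rfl⟩
    have hR1 : 1 ≤ R := by omega
    have hR0 : (0:ℝ) < R := by positivity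
    have hz := hK (P β) β R a F δ hβ hR1 ha0.le hF.le hδ0 hδ2 (fun y hy1 hy2 => ih (2 * R) (by omega) y (by omega) hy1 hy2) (hFn (2 * R))
    have h1 := avg_exit hJ hP hβ R ((bx N : FV d) : SV d) x
    rw [tau_notMem (D := ((bx (2 * R) : FV d) : SV d)) (by rw [Finset.mem_coe, mem_bx]; omega), mul_zero, zero_add] at h1
    set Mu := β * K * (a * δ ^ (1 - α) + F * δ ^ (-((d:ℝ) + α))) with hMu
    have hMu0 : 0 ≤ Mu := by positivity
    have h2 : (R:ℝ≥0∞) * tau (P β) (bx N : FV d) 0 x ≤ oR (Mu * (R:ℝ) ^ (1 - (d:ℝ))) * oR (F * (((2 * N : ℕ):ℝ) + 1) ^ α) := by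
      refine h1.trans ?_
      calc _ ≤ ∑' z, oR (Mu * (R:ℝ) ^ (1 - (d:ℝ))) * tau (P β) (bx N : FV d) z x := by
            refine ENNReal.tsum_le_tsum fun z => mul_le_mul' ?_ le_rfl
            split_ifs with h
            · exact hz z h
            · exact zero_le
        _ ≤ _ := by
            rw [ENNReal.tsum_mul_left]
            exact mul_le_mul' le_rfl ((F_center hJ hP hβ hxN).trans (hFn (2 * N)))
    rw [mul_comm, ← ENNReal.le_div_iff_mul_le (Or.inl (by simp; omega)) (Or.inl (by simp)), ← ofReal_mul (by positivity), ← ENNReal.ofReal_natCast, ← ENNReal.ofReal_div_of_pos hR0] at h2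
    refine h2.trans (ofReal_le_ofReal ?_)
    rw [div_le_iff₀ hR0]
    have hRN : (R:ℝ) ^ (1 - (d:ℝ)) ≤ R * (64 ^ (d:ℝ) * (N:ℝ) ^ (-(d:ℝ))) := by
      rw [sub_eq_add_neg, Real.rpow_add hR0, Real.rpow_one]
      gcongr
      have h64 : (N:ℝ) / 64 ≤ R := by
        rw [div_le_iff₀ (by norm_num)]
        have : N ≤ R * 64 := by omega
        exact_mod_cast this
      calc (R:ℝ) ^ (-(d:ℝ)) ≤ ((N:ℝ) / 64) ^ (-(d:ℝ)) := Real.rpow_le_rpow_of_nonpos (by positivity) h64 (by linarith)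
        _ = _ := by rw [Real.div_rpow hN0.le (by norm_num), Real.rpow_neg (by norm_num : (0:ℝ) ≤ 64), div_inv_eq_mul]; ring
    have e3 : (((2 * N : ℕ):ℝ) + 1) ^ α ≤ 3 ^ α * (N:ℝ) ^ α := by
      rw [← Real.mul_rpow (by norm_num) hN0.le]
      refine Real.rpow_le_rpow (by positivity) ?_ hα.le
      have : (1:ℝ) ≤ N := by exact_mod_cast hN
      push_cast; linarith
    calc Mu * (R:ℝ) ^ (1 - (d:ℝ)) * (F * (((2 * N : ℕ):ℝ) + 1) ^ α) ≤ (A * K * (a * δ ^ (1 - α) + F * δ ^ (-((d:ℝ) + α)))) * (R * (64 ^ (d:ℝ) * (N:ℝ) ^ (-(d:ℝ)))) * (F * (3 ^ α * (N:ℝ) ^ α)) := by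
          rw [hMu]; gcongr
      _ = Q * (a * δ ^ (1 - α) + F * δ ^ (-((d:ℝ) + α))) * ((N:ℝ) ^ α * (N:ℝ) ^ (-(d:ℝ))) * R := by rw [hQ]; ring
      _ ≤ a * (N:ℝ) ^ (α - d) * R := by
          rw [← Real.rpow_add hN0, ← sub_eq_add_neg]; gcongr
end Pt
end Part11
section Part12
section Pt2
variable {d : ℕ} {J : V d → V d → ℝ} {α c C : ℝ} {P : ℝ → Measure (Config d)} {β : ℝ}
noncomputable def tt (P : ℝ → Measure (Config d)) (β : ℝ) (x : V d) : ℝ≥0∞ := tau (P β) Set.univ 0 x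
theorem tau_tt (hJ : KernelHyp d J α c C) (hP : IsLRP J P) (hβ : 0 ≤ β) (x y : V d) : tau (P β) Set.univ x y = tt P β (y - x) :=
  tau_univ (isBer hJ hP hβ) (TI_pJ hJ)
theorem nu_far (hJ : KernelHyp d J α c C) (hP : IsLRP J P) (hα1 : α < 1) {A F : ℝ} (hA : 0 < A) (hF : 0 < F) :
    ∃ K : ℝ, 0 ≤ K ∧ ∀ β, 0 ≤ β → β ≤ A →
    (∀ n : ℕ, ∑' y, tau (P β) (bx n : FV d) 0 y ≤ oR (F * ((n:ℝ) + 1) ^ α)) →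
    ∀ (R : ℕ) (z : V d), 1 ≤ R → R < normInf z →
      nu J (P β) β R z ≤ oR (R * (K * (R:ℝ) ^ α * (normInf z : ℝ) ^ (-((d:ℝ) + α)))) := by
  obtain ⟨K, hK0, hK⟩ := nu_bound hJ hα1
  obtain ⟨a, ha0, ha⟩ := S_bound hJ hP hα1 hA hF
  have hα := hJ.alpha_pos
  have hC := C_pos hJ
  set M := a * (1/2 : ℝ) ^ (1 - α) + F * (1/2 : ℝ) ^ (-((d:ℝ) + α)) with hM
  have hM0 : 0 ≤ M := by positivity
  refine ⟨A * K * M * 4 ^ ((d:ℝ) + α) + A * C * 2 ^ ((d:ℝ) + α) * F * 3 ^ α, by positivity, ?_⟩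
  intro β hβ hβA hFn R z hR hz
  have hR1 : (1:ℝ) ≤ R := by exact_mod_cast hR
  have hR0 : (0:ℝ) < R := by positivity
  have hz' : (R:ℝ) < normInf z := by exact_mod_cast hz
  have hz0 : (0:ℝ) < normInf z := by linarith
  have hsc : ∀ k : ℝ, 0 < k → ((normInf z : ℝ) / k) ^ (-((d:ℝ) + α)) = k ^ ((d:ℝ) + α) * (normInf z : ℝ) ^ (-((d:ℝ) + α)) := by
    intro k hk
    rw [Real.div_rpow hz0.le hk.le, Real.rpow_neg hk.le, div_inv_eq_mul, mul_comm]
  have hpos : ∀ t : ℝ, 0 ≤ A * K * M * 4 ^ ((d:ℝ) + α) := fun t => by positivity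
  by_cases h4 : normInf z ≤ 4 * R
  · refine (hK (P β) β R a F (1/2) hβ hR ha0.le hF.le (by norm_num) le_rfl (fun y h1 h2 => ha β hβ hβA hFn _ y (by omega) h1 h2) (hFn _) z hz).trans (ofReal_le_ofReal ?_)
    have h4' : (normInf z : ℝ) / 4 ≤ R := by
      rw [div_le_iff₀ (by norm_num)]; exact_mod_cast (by omega : normInf z ≤ R * 4)
    calc β * K * M * (R:ℝ) ^ (1 - (d:ℝ)) = β * K * M * (R * (R:ℝ) ^ α * (R:ℝ) ^ (-((d:ℝ) + α))) := by
          rw [mul_assoc (R:ℝ), ← Real.rpow_add hR0, show 1 - (d:ℝ) = 1 + (α + -((d:ℝ) + α)) by ring, Real.rpow_add hR0, Real.rpow_one]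
      _ ≤ A * K * M * (R * (R:ℝ) ^ α * (4 ^ ((d:ℝ) + α) * (normInf z : ℝ) ^ (-((d:ℝ) + α)))) := by
          rw [← hsc 4 (by norm_num)]
          have := Real.rpow_le_rpow_of_nonpos (z := -((d:ℝ) + α)) (by positivity) h4' (by linarith [hJ.alpha_lt_d])
          gcongr
      _ = R * (A * K * M * 4 ^ ((d:ℝ) + α) * (R:ℝ) ^ α * (normInf z : ℝ) ^ (-((d:ℝ) + α))) := by ring
      _ ≤ _ := by gcongr; exact le_add_of_nonneg_right (by positivity)
  · push Not at h4
    calc nu J (P β) β R z ≤ ∑' y, tau (P β) (bx (2 * R) : FV d) 0 y * oR (A * (C * (2 ^ ((d:ℝ) + α) * (normInf z : ℝ) ^ (-((d:ℝ) + α)))) * R) := by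
          refine ENNReal.tsum_le_tsum fun y => ?_
          by_cases hy : y ∈ bx (2 * R)
          · rw [mem_bx] at hy
            have ht := normInf_tri z y 0
            simp only [sub_zero] at ht
            rw [normInf_sub_comm z y] at ht
            have h2 : (normInf z : ℝ) / 2 ≤ normInf (y - z) := by
              rw [div_le_iff₀ (by norm_num)]; exact_mod_cast (by omega : normInf z ≤ normInf (y - z) * 2)
            have hyz : y ≠ z := by rintro rfl; omega
            refine mul_le_mul' le_rfl ?_
            rw [← ENNReal.ofReal_natCast, ← ofReal_mul (mul_nonneg hβ (hJ.nonneg _ _))]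
            apply ofReal_le_ofReal
            rw [← hsc 2 (by norm_num)]
            have h5 := Real.rpow_le_rpow_of_nonpos (z := -((d:ℝ) + α)) (by positivity) h2 (by linarith [hJ.alpha_lt_d])
            have h6 := hJ.upper y z hyz
            rw [← neg_add'] at h6
            gcongr
            · exact hJ.nonneg _ _
            · exact h6.trans (by gcongr)
            · exact min_le_left _ _
          · rw [tau_notMem (by simpa using hy)]; simp
      _ ≤ oR (F * (3 ^ α * (R:ℝ) ^ α)) * oR (A * (C * (2 ^ ((d:ℝ) + α) * (normInf z : ℝ) ^ (-((d:ℝ) + α)))) * R) := by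
          rw [ENNReal.tsum_mul_right]
          refine mul_le_mul' ((hFn _).trans (ofReal_le_ofReal ?_)) le_rfl
          rw [← Real.mul_rpow (by norm_num) hR0.le]
          gcongr; push_cast; linarith
      _ ≤ _ := by
          rw [← ofReal_mul (by positivity)]
          apply ofReal_le_ofReal
          calc _ = R * (A * C * 2 ^ ((d:ℝ) + α) * F * 3 ^ α * (R:ℝ) ^ α * (normInf z : ℝ) ^ (-((d:ℝ) + α))) := by ring
            _ ≤ _ := by gcongr; exact le_add_of_nonneg_left (by positivity)
theorem full_exit (hJ : KernelHyp d J α c C) (hP : IsLRP J P) (hα1 : α < 1) {A F : ℝ} (hA : 0 < A) (hF : 0 < F) :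
    ∃ K : ℝ, 0 < K ∧ ∀ β, 0 ≤ β → β ≤ A →
    (∀ n : ℕ, ∑' y, tau (P β) (bx n : FV d) 0 y ≤ oR (F * ((n:ℝ) + 1) ^ α)) →
    ∀ (G : ℝ), 0 ≤ G → (∀ m : ℕ, 1 ≤ m → ∑' w, (if normInf w ≤ m then tt P β w else 0) ≤ oR (G * (m:ℝ) ^ α)) →
    ∀ (R : ℕ) (x : V d), 1 ≤ R → normInf x ≤ 7 * R → tt P β x ≤ tau (P β) (bx (2 * R) : FV d) 0 x + oR (K * G * (R:ℝ) ^ (α - d)) := by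
  obtain ⟨K, hK0, hK⟩ := nu_far hJ hP hα1 hA hF
  have hα := hJ.alpha_pos
  have hd : (1:ℝ) ≤ d := by exact_mod_cast hJ.d_pos
  have hq : (2:ℝ) ^ (-(d:ℝ)) < 1 := Real.rpow_lt_one_of_one_lt_of_neg (by norm_num) (by linarith)
  have hq' : 0 ≤ (1 - (2:ℝ) ^ (-(d:ℝ)))⁻¹ := inv_nonneg.2 (by linarith)
  refine ⟨K * 8 ^ ((d:ℝ) + α) * (2 ^ ((d:ℝ) + α) * (1 - (2:ℝ) ^ (-(d:ℝ)))⁻¹) + 1, by positivity, ?_⟩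
  intro β hβ hβA hFn G hG hGm R x hR hx
  have hR0 : (0:ℝ) < R := by positivity
  have h1 := avg_exit hJ hP hβ R Set.univ x
  have h2 := tail_sum hG (s := (d:ℝ) + α) (by positivity) (by linarith) hGm hR
  rw [show α - ((d:ℝ) + α) = -(d:ℝ) by ring] at h2
  have h3 : ∑' z, (if R < normInf z then nu J (P β) β R z else 0) * tau (P β) Set.univ z x ≤
      R * (oR (K * 8 ^ ((d:ℝ) + α) * (R:ℝ) ^ α) * ∑' w, tt P β w * oR (((max R (normInf w) : ℕ) : ℝ) ^ (-((d:ℝ) + α)))) := by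
    rw [← ENNReal.tsum_mul_left, ← ENNReal.tsum_mul_left, ← (Equiv.subLeft x).tsum_eq]
    refine ENNReal.tsum_le_tsum fun z => ?_
    rw [Equiv.subLeft_apply, tau_tt hJ hP hβ, _root_.sub_sub_cancel]
    rw [mul_comm (tt P β z), ← mul_assoc, ← mul_assoc]
    refine mul_le_mul' ?_ le_rfl
    by_cases hz : R < normInf (x - z)
    · rw [if_pos hz]
      refine (hK β hβ hβA hFn R (x - z) hR hz).trans ?_
      rw [← ENNReal.ofReal_natCast, ← ofReal_mul (by positivity), ← ofReal_mul (by positivity)]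
      apply ofReal_le_ofReal
      have ht := normInf_tri z x 0
      simp only [sub_zero] at ht
      rw [normInf_sub_comm z x] at ht
      have hm : ((max R (normInf z) : ℕ):ℝ) / 8 ≤ normInf (x - z) := by
        rw [div_le_iff₀ (by norm_num)]; exact_mod_cast (by omega : max R (normInf z) ≤ normInf (x - z) * 8)
      have hm0 : (0:ℝ) < ((max R (normInf z) : ℕ):ℝ) := by exact_mod_cast (by omega : 0 < max R (normInf z))
      have h5 := Real.rpow_le_rpow_of_nonpos (z := -((d:ℝ) + α)) (by positivity) hm (by linarith)
      rw [Real.div_rpow hm0.le (by norm_num), Real.rpow_neg (by norm_num : (0:ℝ) ≤ 8), div_inv_eq_mul] at h5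
      calc _ ≤ (R:ℝ) * (K * (R:ℝ) ^ α * (((max R (normInf z) : ℕ):ℝ) ^ (-((d:ℝ) + α)) * 8 ^ ((d:ℝ) + α))) := by gcongr
        _ = _ := by ring
    · rw [if_neg hz]; exact zero_le
  have h4 := h1.trans (add_le_add le_rfl (h3.trans (mul_le_mul' le_rfl (mul_le_mul' le_rfl h2))))
  rw [← mul_add, ENNReal.mul_le_mul_iff_right (by simp; omega) (by simp)] at h4
  refine h4.trans (add_le_add le_rfl ?_)
  rw [← ofReal_mul (by positivity)]
  apply ofReal_le_ofReal
  calc _ = K * 8 ^ ((d:ℝ) + α) * (2 ^ ((d:ℝ) + α) * (1 - (2:ℝ) ^ (-(d:ℝ)))⁻¹) * G * ((R:ℝ) ^ α * (R:ℝ) ^ (-(d:ℝ))) := by ring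
    _ = K * 8 ^ ((d:ℝ) + α) * (2 ^ ((d:ℝ) + α) * (1 - (2:ℝ) ^ (-(d:ℝ)))⁻¹) * G * (R:ℝ) ^ (α - d) := by
        rw [sub_eq_add_neg α, Real.rpow_add hR0]
    _ ≤ _ := by gcongr; linarith
theorem pointwise (hJ : KernelHyp d J α c C) (hP : IsLRP J P) (hα1 : α < 1) {b0 : ℝ} (hb0 : 0 < b0) :
    ∃ K G : ℝ, 0 < K ∧ 0 < G ∧ ∀ β, b0 ≤ β → chi P β ≠ ∞ →
      (∀ x, tt P β x ≤ oR (K * ((normInf x : ℝ) + 1) ^ (α - d))) ∧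
      ∀ m : ℕ, 1 ≤ m → ∑' w, (if normInf w ≤ m then tt P β w else 0) ≤ oR (G * (m:ℝ) ^ α) := by
  obtain ⟨A, hA, hAinf, hAF⟩ := F_bound hJ hP
  have hα := hJ.alpha_pos
  have hαd := hJ.alpha_lt_d
  set F := A / b0 * 3 ^ ((d:ℝ) + α) with hF
  have hF0 : 0 < F := by positivity
  obtain ⟨K, hK0, hK⟩ := full_exit hJ hP hα1 hA hF0
  obtain ⟨L, hL1, hL⟩ : ∃ L : ℕ, 1 ≤ L ∧ 3 ^ d * K * (L:ℝ) ^ (α - d) ≤ 1/2 := by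
    have ht : Filter.Tendsto (fun n : ℕ => 3 ^ d * K * (n:ℝ) ^ (α - d)) Filter.atTop (nhds (3 ^ d * K * 0)) := by
      refine Filter.Tendsto.const_mul _ ?_
      rw [show α - d = -((d:ℝ) - α) by ring]
      exact (tendsto_rpow_neg_atTop (by linarith)).comp tendsto_natCast_atTop_atTop
    rw [mul_zero] at ht
    obtain ⟨L, h1, h2⟩ := ((ht.eventually (ge_mem_nhds (by norm_num : (0:ℝ) < 1/2))).and (Filter.eventually_ge_atTop 1)).exists
    exact ⟨L, h2, h1⟩
  set B := F * 3 ^ α * (L:ℝ) ^ α with hB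
  have hL0 : (0:ℝ) < L := by positivity
  have hB0 : 0 < B := by positivity
  refine ⟨8 ^ ((d:ℝ) - α) * (K * (2 * B + 1) + 1), 2 * B + 1, by positivity, by positivity, fun β hβ hfin => ?_⟩
  have hβ0 : 0 < β := hb0.trans_le hβ
  have hβA : β ≤ A := by
    by_contra h
    push Not at h
    exact hfin (top_le_iff.1 (hAinf ▸ chi_mono hJ hP hA.le h.le))
  have hFn : ∀ n : ℕ, ∑' y, tau (P β) (bx n : FV d) 0 y ≤ oR (F * ((n:ℝ) + 1) ^ α) := fun n =>
    (hAF β hβ0 hβA hfin n).trans (ofReal_le_ofReal (by rw [hF]; gcongr))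
  have hstep : ∀ G : ℝ, 0 ≤ G → (∀ m : ℕ, 1 ≤ m → ∑' w, (if normInf w ≤ m then tt P β w else 0) ≤ oR (G * (m:ℝ) ^ α)) →
      ∀ m : ℕ, 1 ≤ m → ∑' w, (if normInf w ≤ m then tt P β w else 0) ≤ oR ((B + G / 2) * (m:ℝ) ^ α) := by
    intro G hG hGm m hm
    have hm0 : (0:ℝ) < m := by positivity
    have hm1 : (1:ℝ) ≤ m := by exact_mod_cast hm
    have hLm : 1 ≤ L * m := Nat.mul_pos hL1 hm
    have hLm1 : (1:ℝ) ≤ L * m := by exact_mod_cast hLm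
    have hmL : m ≤ L * m := Nat.le_mul_of_pos_left m hL1
    have h1 : ∑' w : V d, (if normInf w ≤ m then tt P β w else 0) ≤ ∑' w : V d, (tau (P β) (bx (2 * (L * m)) : FV d) 0 w + (if normInf w ≤ m then oR (K * G * ((L * m : ℕ):ℝ) ^ (α - d)) else 0)) := by
      refine ENNReal.tsum_le_tsum fun w => ?_
      by_cases hw : normInf w ≤ m
      · rw [if_pos hw, if_pos hw]
        exact hK β hβ0.le hβA hFn G hG hGm (L * m) w hLm (by omega)
      · rw [if_neg hw]; exact zero_le
    have h2 : ∑' w : V d, (if normInf w ≤ m then oR (K * G * ((L * m : ℕ):ℝ) ^ (α - d)) else 0) = oR ((2 * m + 1) ^ d * (K * G * ((L * m : ℕ):ℝ) ^ (α - d))) := by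
      rw [tsum_eq_sum (s := bx m) (fun w hw => if_neg (by simpa [mem_bx] using hw)), Finset.sum_congr rfl (fun w hw => if_pos (mem_bx.1 hw)), Finset.sum_const, card_bx, nsmul_eq_mul, ofReal_mul (p := (2 * (m:ℝ) + 1) ^ d) (by positivity), ← ENNReal.ofReal_natCast]
      push_cast; rfl
    refine h1.trans ?_
    rw [ENNReal.tsum_add, h2]
    refine (add_le_add (hFn _) le_rfl).trans ?_
    rw [← ofReal_add (by positivity) (by positivity)]
    apply ofReal_le_ofReal
    have e1 : (((2 * (L * m) : ℕ):ℝ) + 1) ^ α ≤ 3 ^ α * (L:ℝ) ^ α * (m:ℝ) ^ α := by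
      rw [← Real.mul_rpow (by norm_num) hL0.le, ← Real.mul_rpow (by positivity) hm0.le]
      refine Real.rpow_le_rpow (by positivity) ?_ hα.le
      push_cast; linarith
    have e2 : ((2:ℝ) * m + 1) ^ d ≤ 3 ^ d * (m:ℝ) ^ (d:ℝ) := by
      rw [Real.rpow_natCast, ← mul_pow]; gcongr; linarith
    calc _ ≤ F * (3 ^ α * (L:ℝ) ^ α * (m:ℝ) ^ α) + 3 ^ d * (m:ℝ) ^ (d:ℝ) * (K * G * ((L:ℝ) ^ (α - d) * (m:ℝ) ^ (α - d))) := by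
          rw [Nat.cast_mul L m, Real.mul_rpow hL0.le hm0.le]; gcongr
      _ = B * (m:ℝ) ^ α + (3 ^ d * K * (L:ℝ) ^ (α - d)) * G * ((m:ℝ) ^ (d:ℝ) * (m:ℝ) ^ (α - d)) := by rw [hB]; ring
      _ ≤ B * (m:ℝ) ^ α + 1/2 * G * (m:ℝ) ^ α := by
          rw [← Real.rpow_add hm0, show (d:ℝ) + (α - d) = α by ring]; gcongr
      _ = _ := by ring
  have hiter : ∀ k : ℕ, ∀ m : ℕ, 1 ≤ m → ∑' w, (if normInf w ≤ m then tt P β w else 0) ≤ oR (((chi P β).toReal * (1/2) ^ k + 2 * B) * (m:ℝ) ^ α) := by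
    intro k
    induction k with
    | zero =>
      intro m hm
      have h1 : ∑' w, (if normInf w ≤ m then tt P β w else 0) ≤ chi P β := by
        rw [chi_eq]; exact ENNReal.tsum_le_tsum fun w => by split_ifs; exacts [le_rfl, zero_le]
      refine h1.trans ?_
      rw [← ofReal_toReal hfin]
      apply ofReal_le_ofReal
      have : (1:ℝ) ≤ (m:ℝ) ^ α := Real.one_le_rpow (by exact_mod_cast hm) hα.le
      have h0 := ENNReal.toReal_nonneg (a := chi P β)
      rw [ENNReal.toReal_ofReal h0]
      nlinarith
    | succ k ih =>
      intro m hm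
      have h0 := ENNReal.toReal_nonneg (a := chi P β)
      refine (hstep _ (by positivity) ih m hm).trans (ofReal_le_ofReal (le_of_eq ?_))
      rw [pow_succ]; ring
  have hG : ∀ m : ℕ, 1 ≤ m → ∑' w, (if normInf w ≤ m then tt P β w else 0) ≤ oR ((2 * B + 1) * (m:ℝ) ^ α) := by
    intro m hm
    obtain ⟨k, hk⟩ := exists_pow_lt_of_lt_one (show (0:ℝ) < 1 / ((chi P β).toReal + 1) by positivity) (by norm_num : (1/2:ℝ) < 1)
    refine (hiter k m hm).trans (ofReal_le_ofReal ?_)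
    have h0 := ENNReal.toReal_nonneg (a := chi P β)
    rw [lt_div_iff₀ (by positivity)] at hk
    refine mul_le_mul_of_nonneg_right ?_ (by positivity)
    nlinarith [show (0:ℝ) < (1/2) ^ k by positivity]
  refine ⟨fun x => ?_, hG⟩
  have h8 : ∀ r : ℝ, 0 < r → (normInf x : ℝ) + 1 ≤ 8 * r → r ^ (α - d) ≤ 8 ^ ((d:ℝ) - α) * ((normInf x : ℝ) + 1) ^ (α - d) := by
    intro r hr h
    have h5 := Real.rpow_le_rpow_of_nonpos (z := α - d) (by positivity) ((div_le_iff₀' (by norm_num)).2 h) (by linarith)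
    rw [Real.div_rpow (by positivity) (by norm_num), div_eq_mul_inv, ← Real.rpow_neg (by norm_num), neg_sub, mul_comm] at h5
    exact h5
  by_cases hx : normInf x < 4
  · refine (tau_le_one hJ hP hβ0.le).trans ?_
    rw [← ofReal_one]
    apply ofReal_le_ofReal
    have h6 := h8 1 one_pos (by rw [mul_one]; exact_mod_cast (by omega : normInf x + 1 ≤ 8))
    rw [Real.one_rpow] at h6
    calc (1:ℝ) ≤ 1 * (8 ^ ((d:ℝ) - α) * ((normInf x : ℝ) + 1) ^ (α - d)) := by linarith
      _ ≤ (K * (2 * B + 1) + 1) * (8 ^ ((d:ℝ) - α) * ((normInf x : ℝ) + 1) ^ (α - d)) := by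
          gcongr; linarith [show 0 ≤ K * (2 * B + 1) by positivity]
      _ = _ := by ring
  · obtain ⟨R, hR⟩ : ∃ R, R = normInf x / 4 := ⟨_, rfl⟩
    have hR1 : 1 ≤ R := by omega
    have h1 := hK β hβ0.le hβA hFn _ (by positivity) hG R x hR1 (by omega)
    rw [tau_notMem (by rw [Finset.mem_coe, mem_bx]; omega), zero_add] at h1
    refine h1.trans (ofReal_le_ofReal ?_)
    have h6 := h8 R (by positivity) (by exact_mod_cast (by omega : normInf x + 1 ≤ 8 * R))
    calc _ ≤ K * (2 * B + 1) * (8 ^ ((d:ℝ) - α) * ((normInf x : ℝ) + 1) ^ (α - d)) := by gcongr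
      _ ≤ (K * (2 * B + 1) + 1) * (8 ^ ((d:ℝ) - α) * ((normInf x : ℝ) + 1) ^ (α - d)) := by
          gcongr; linarith
      _ = _ := by ring
end Pt2
end Part12
section Part13
section Log
variable {d : ℕ} {J : V d → V d → ℝ} {α c C : ℝ} {P : ℝ → Measure (Config d)} {β : ℝ}
theorem log_sum {f h : V d → ℝ≥0∞} {M θ X : ℝ} (hM : 0 ≤ M) (hθ : 0 < θ) (hX : 1 ≤ X)
    (h1 : ∀ x, f x ≤ oR (M * ((normInf x : ℝ) + 1) ^ (-(d:ℝ))))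
    (h2 : ∀ x, f x ≤ h x * oR (M * ((normInf x : ℝ) + 1) ^ (-θ))) (h3 : ∑' x, h x ≤ oR X) :
    ∑' x, f x ≤ oR (M * (5 ^ d * (Real.log X / (θ * Real.log 2) + 1) + 1)) := by
  have hl2 : 0 < Real.log 2 := Real.log_pos (by norm_num)
  have hlX := Real.log_nonneg hX
  obtain ⟨n, hn⟩ : ∃ n, n = ⌈Real.log X / (θ * Real.log 2)⌉₊ := ⟨_, rfl⟩
  have hn1 : Real.log X / (θ * Real.log 2) ≤ n := hn ▸ Nat.le_ceil _
  have hn2 : (n:ℝ) ≤ Real.log X / (θ * Real.log 2) + 1 := hn ▸ (Nat.ceil_lt_add_one (by positivity)).le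
  have hXn : X * ((2:ℝ) ^ n) ^ (-θ) ≤ 1 := by
    rw [← Real.log_nonpos_iff (by positivity), Real.log_mul (by positivity) (by positivity), Real.log_rpow (by positivity), Real.log_pow]
    rw [div_le_iff₀ (by positivity)] at hn1
    linarith
  have hpt : ∀ x, f x ≤ ∑ k ∈ Finset.range n, (if normInf x ≤ 2 ^ (k + 1) then oR (M * ((2:ℝ) ^ k) ^ (-(d:ℝ))) else 0) + h x * oR (M * ((2:ℝ) ^ n) ^ (-θ)) := by
    intro x
    have hk1 := Nat.pow_log_le_self 2 (Nat.succ_ne_zero (normInf x))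
    have hk2 := Nat.lt_pow_succ_log_self (by norm_num : 1 < 2) (normInf x).succ
    obtain ⟨k, hk⟩ : ∃ k, k = Nat.log 2 (normInf x).succ := ⟨_, rfl⟩
    rw [← hk] at hk1 hk2
    have hk1' : (2:ℝ) ^ k ≤ (normInf x : ℝ) + 1 := by exact_mod_cast hk1
    by_cases hkn : k < n
    · refine le_trans ((h1 x).trans ?_) (le_add_of_nonneg_right zero_le)
      refine le_trans ?_ (Finset.single_le_sum (fun _ _ => zero_le) (Finset.mem_range.2 hkn))
      rw [if_pos (by omega)]
      exact ofReal_le_ofReal (mul_le_mul_of_nonneg_left (Real.rpow_le_rpow_of_nonpos (by positivity) hk1' (by simp)) hM)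
    · refine le_trans ((h2 x).trans ?_) (le_add_of_nonneg_left zero_le)
      have : (2:ℝ) ^ n ≤ (normInf x : ℝ) + 1 := le_trans (pow_le_pow_right₀ (by norm_num) (by omega)) hk1'
      exact mul_le_mul' le_rfl (ofReal_le_ofReal (mul_le_mul_of_nonneg_left (Real.rpow_le_rpow_of_nonpos (by positivity) this (by linarith)) hM))
  refine (ENNReal.tsum_le_tsum hpt).trans ?_
  rw [ENNReal.tsum_add, ENNReal.tsum_mul_right, Summable.tsum_finsetSum (fun _ _ => ENNReal.summable)]
  have hsh : ∀ k ∈ Finset.range n, ∑' x : V d, (if normInf x ≤ 2 ^ (k + 1) then oR (M * ((2:ℝ) ^ k) ^ (-(d:ℝ))) else 0) ≤ oR (M * 5 ^ d) := by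
    intro k _
    rw [tsum_eq_sum (s := bx (2 ^ (k + 1))) (fun w hw => if_neg (by simpa [mem_bx] using hw)), Finset.sum_congr rfl (fun w hw => if_pos (mem_bx.1 hw)), Finset.sum_const, card_bx, nsmul_eq_mul, ← ENNReal.ofReal_natCast, ← ofReal_mul (by positivity)]
    apply ofReal_le_ofReal
    have hk : (1:ℝ) ≤ 2 ^ k := one_le_pow₀ (by norm_num)
    calc _ ≤ (5 * 2 ^ k) ^ d * (M * ((2:ℝ) ^ k) ^ (-(d:ℝ))) := by
          push_cast; gcongr; rw [pow_succ]; linarith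
      _ = M * 5 ^ d * (((2:ℝ) ^ k) ^ d * (((2:ℝ) ^ k) ^ d)⁻¹) := by rw [mul_pow, Real.rpow_neg (by positivity), Real.rpow_natCast]; ring
      _ = M * 5 ^ d := by rw [mul_inv_cancel₀ (by positivity), mul_one]
  refine (add_le_add (Finset.sum_le_sum hsh) (mul_le_mul' h3 le_rfl)).trans ?_
  rw [Finset.sum_const, Finset.card_range, nsmul_eq_mul, ← ENNReal.ofReal_natCast, ← ofReal_mul (by positivity), ← ofReal_mul (by positivity), ← ofReal_add (by positivity) (by positivity)]
  apply ofReal_le_ofReal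
  calc _ = M * (5 ^ d * n + X * ((2:ℝ) ^ n) ^ (-θ)) := by ring
    _ ≤ _ := by gcongr
noncomputable def t2 (P : ℝ → Measure (Config d)) (β : ℝ) (x : V d) : ℝ≥0∞ := ∑' y, tt P β y * tt P β (x - y)
noncomputable def t3 (P : ℝ → Measure (Config d)) (β : ℝ) (a : V d) : ℝ≥0∞ := ∑' y, tt P β (a - y) * t2 P β y
theorem tsum_shift (f : V d → ℝ≥0∞) (z : V d) : ∑' x, f (x - z) = ∑' x, f x := (Equiv.subRight z).tsum_eq f
theorem tsum_refl (f : V d → ℝ≥0∞) (z : V d) : ∑' x, f (z - x) = ∑' x, f x := (Equiv.subLeft z).tsum_eq f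
theorem tsum_t2 : ∑' x, t2 P β x = chi P β * chi P β := by
  unfold t2
  rw [ENNReal.tsum_comm]
  simp_rw [ENNReal.tsum_mul_left, tsum_shift (tt P β)]
  rw [ENNReal.tsum_mul_right, chi_eq]; rfl
theorem t2_bound {K G : ℝ} (hα : 0 < α) (hαd : 2 * α < d) (hK : 0 < K) (hG : 0 < G) (h1 : ∀ x, tt P β x ≤ oR (K * ((normInf x : ℝ) + 1) ^ (α - d)))
    (h2 : ∀ m : ℕ, 1 ≤ m → ∑' w, (if normInf w ≤ m then tt P β w else 0) ≤ oR (G * (m:ℝ) ^ α)) (x : V d) :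
    t2 P β x ≤ oR (2 * K * (2 ^ ((d:ℝ) - α) * (1 - (2:ℝ) ^ (2 * α - d))⁻¹ * G) * 2 ^ ((d:ℝ) - 2 * α) * ((normInf x : ℝ) + 1) ^ (2 * α - d)) := by
  obtain ⟨R, hR⟩ : ∃ R, R = (normInf x + 2) / 2 := ⟨_, rfl⟩
  have hR1 : 1 ≤ R := by omega
  have hR0 : (0:ℝ) < R := by positivity
  have hT := tail_sum hG.le (s := (d:ℝ) - α) (by linarith) (by linarith) h2 hR1
  rw [show α - ((d:ℝ) - α) = 2 * α - d by ring] at hT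
  set g : V d → ℝ≥0∞ := fun w => tt P β w * oR (((max R (normInf w) : ℕ) : ℝ) ^ (-((d:ℝ) - α))) with hg
  have key : ∀ u v : V d, normInf u ≤ normInf v → normInf x ≤ 2 * normInf v → tt P β u * tt P β v ≤ oR K * g u := by
    intro u v huv hv
    rw [hg]
    simp only
    rw [mul_left_comm, ← ofReal_mul hK.le]
    refine mul_le_mul' le_rfl ((h1 v).trans (ofReal_le_ofReal (mul_le_mul_of_nonneg_left ?_ hK.le)))
    rw [← neg_sub (d:ℝ) α]
    refine Real.rpow_le_rpow_of_nonpos (by exact_mod_cast (by omega : 0 < max R (normInf u))) ?_ (by linarith)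
    exact_mod_cast (by omega : max R (normInf u) ≤ normInf v + 1)
  have hpt : ∀ y, tt P β y * tt P β (x - y) ≤ oR K * g y + oR K * g (x - y) := by
    intro y
    have ht := normInf_tri x y 0
    simp only [sub_zero] at ht
    by_cases h : normInf y ≤ normInf (x - y)
    · exact (key y (x - y) h (by omega)).trans (le_add_of_nonneg_right zero_le)
    · rw [mul_comm]
      exact (key (x - y) y (by omega) (by omega)).trans (le_add_of_nonneg_left zero_le)
  refine (ENNReal.tsum_le_tsum hpt).trans ?_
  rw [ENNReal.tsum_add, ENNReal.tsum_mul_left, ENNReal.tsum_mul_left, tsum_refl g, ← mul_add, ← two_mul]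
  refine (mul_le_mul' le_rfl (mul_le_mul' le_rfl hT)).trans ?_
  have hq : (2:ℝ) ^ (2 * α - d) < 1 := Real.rpow_lt_one_of_one_lt_of_neg (by norm_num) (by linarith)
  have hq' : 0 ≤ (1 - (2:ℝ) ^ (2 * α - d))⁻¹ := inv_nonneg.2 (by linarith)
  rw [show (2:ℝ≥0∞) = oR 2 by simp, ← ofReal_mul (by norm_num), ← ofReal_mul hK.le]
  apply ofReal_le_ofReal
  have h5 : (R:ℝ) ^ (2 * α - d) ≤ 2 ^ ((d:ℝ) - 2 * α) * ((normInf x : ℝ) + 1) ^ (2 * α - d) := by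
    have h4 : ((normInf x : ℝ) + 1) / 2 ≤ R := by
      rw [div_le_iff₀ (by norm_num)]; exact_mod_cast (by omega : normInf x + 1 ≤ R * 2)
    have h5 := Real.rpow_le_rpow_of_nonpos (z := 2 * α - d) (by positivity) h4 (by linarith)
    rwa [Real.div_rpow (by positivity) (by norm_num), div_eq_mul_inv, ← Real.rpow_neg (by norm_num), neg_sub, mul_comm (_ ^ _)] at h5
  calc _ = 2 * K * (2 ^ ((d:ℝ) - α) * (1 - (2:ℝ) ^ (2 * α - d))⁻¹ * G) * (R:ℝ) ^ (2 * α - d) := by ring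
    _ ≤ 2 * K * (2 ^ ((d:ℝ) - α) * (1 - (2:ℝ) ^ (2 * α - d))⁻¹ * G) * (2 ^ ((d:ℝ) - 2 * α) * ((normInf x : ℝ) + 1) ^ (2 * α - d)) := by gcongr
    _ = _ := by ring
theorem log_bounds (hJ : KernelHyp d J α c C) (hP : IsLRP J P) (hα1 : α < 1) (hα3 : α = (d:ℝ) / 3) {b0 : ℝ} (hb0 : 0 < b0) :
    ∃ M : ℝ, 0 < M ∧ ∀ β, b0 ≤ β → chi P β ≠ ∞ →
      (∀ a, t3 P β a ≤ oR (M * (1 + Real.log (chi P β).toReal))) ∧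
      ∑' x, t2 P β x ^ 3 ≤ oR (M * (1 + Real.log (chi P β).toReal)) := by
  obtain ⟨K, G, hK, hG, hKG⟩ := pointwise hJ hP hα1 hb0
  have hα := hJ.alpha_pos
  have hd : (1:ℝ) ≤ d := by exact_mod_cast hJ.d_pos
  obtain ⟨K', hK', hK2⟩ : ∃ K', 0 < K' ∧ ∀ β, b0 ≤ β → chi P β ≠ ∞ → ∀ x, t2 P β x ≤ oR (K' * ((normInf x : ℝ) + 1) ^ (2 * α - d)) := by
    refine ⟨_, ?_, fun β hβ hfin x => t2_bound hα (by linarith) hK hG (hKG β hβ hfin).1 (hKG β hβ hfin).2 x⟩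
    have hq : (2:ℝ) ^ (2 * α - d) < 1 := Real.rpow_lt_one_of_one_lt_of_neg (by norm_num) (by linarith)
    have : 0 < 1 - (2:ℝ) ^ (2 * α - d) := by linarith
    positivity
  have hl2 : 0 < Real.log 2 := Real.log_pos (by norm_num)
  set m := K + K' + K * K' + K' ^ 2 + K' ^ 3 with hm
  have hm0 : 0 < m := by positivity
  set q := m * (5 ^ d * (6 / Real.log 2 + 1) + 1) with hq
  have hq0 : 0 < q := by positivity
  refine ⟨2 * q, by positivity, fun β hβ hfin => ?_⟩
  have hβ0 : 0 ≤ β := hb0.le.trans hβ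
  have h1 := (hKG β hβ hfin).1
  have h2 := hK2 β hβ hfin
  have hχ : chi P β = oR (chi P β).toReal := (ofReal_toReal hfin).symm
  have hχ1 : 1 ≤ (chi P β).toReal := by
    rw [← ofReal_le_ofReal_iff ENNReal.toReal_nonneg, ← hχ, ofReal_one]; exact one_le_chi hJ hP hβ0
  set X := (chi P β).toReal
  have hlX := Real.log_nonneg hχ1
  have hN : ∀ x : V d, (0:ℝ) < (normInf x : ℝ) + 1 := fun x => by positivity
  have e1 : ∀ x : V d, ((normInf x : ℝ) + 1) ^ (2 * α - d) = ((normInf x : ℝ) + 1) ^ (-(d:ℝ) / 3) := fun x => by rw [hα3]; congr 1; ring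
  have e2 : ∀ x : V d, ((normInf x : ℝ) + 1) ^ (α - d) = ((normInf x : ℝ) + 1) ^ (-(d:ℝ) / 3) * ((normInf x : ℝ) + 1) ^ (-(d:ℝ) / 3) := fun x => by rw [← Real.rpow_add (hN x), hα3]; congr 1; ring
  have e3 : ∀ x : V d, ((normInf x : ℝ) + 1) ^ (-(d:ℝ)) = ((normInf x : ℝ) + 1) ^ (-(d:ℝ) / 3) * ((normInf x : ℝ) + 1) ^ (-(d:ℝ) / 3) * ((normInf x : ℝ) + 1) ^ (-(d:ℝ) / 3) := fun x => by rw [← Real.rpow_add (hN x), ← Real.rpow_add (hN x)]; congr 1; ring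
  have e4 : ∀ x : V d, ((normInf x : ℝ) + 1) ^ (-((d:ℝ) / 3)) = ((normInf x : ℝ) + 1) ^ (-(d:ℝ) / 3) := fun x => by congr 1; ring
  have e5 : ∀ x : V d, ((normInf x : ℝ) + 1) ^ (-(2 * (d:ℝ) / 3)) = ((normInf x : ℝ) + 1) ^ (-(d:ℝ) / 3) * ((normInf x : ℝ) + 1) ^ (-(d:ℝ) / 3) := fun x => by rw [← Real.rpow_add (hN x)]; congr 1; ring
  have hn : ∀ x : V d, (0:ℝ) < ((normInf x : ℝ) + 1) ^ (-(d:ℝ) / 3) := fun x => by positivity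
  simp_rw [e1] at h2
  simp_rw [e2] at h1
  set n : V d → ℝ := fun x => ((normInf x : ℝ) + 1) ^ (-(d:ℝ) / 3) with hndef
  have hs2 : ∑' x, t2 P β x ≤ oR (X ^ 2) := by
    rw [tsum_t2, sq, ofReal_mul (by linarith), ← hχ]
  have hs1 : ∑' x, tt P β x ≤ oR X := by rw [← hχ, chi_eq]; rfl
  have m1 : K * K' ≤ m := by rw [hm]; linarith [sq_nonneg K', pow_pos hK' 3]
  have m2 : K ≤ m := by rw [hm]; linarith [sq_nonneg K', pow_pos hK' 3, mul_pos hK hK']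
  have m3 : K' ≤ m := by rw [hm]; linarith [sq_nonneg K', pow_pos hK' 3, mul_pos hK hK']
  have m4 : K' ^ 2 ≤ m := by rw [hm]; linarith [sq_nonneg K', pow_pos hK' 3, mul_pos hK hK']
  have m5 : K' ^ 3 ≤ m := by rw [hm]; linarith [sq_nonneg K', pow_pos hK' 3, mul_pos hK hK']
  have fin : ∀ (f h : V d → ℝ≥0∞) (θ Y : ℝ), (d:ℝ) / 3 ≤ θ → 1 ≤ Y → Y ≤ X ^ 2 →
      (∀ x, f x ≤ oR (m * (n x * n x * n x))) → (∀ x, f x ≤ h x * oR (m * ((normInf x : ℝ) + 1) ^ (-θ))) →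
      ∑' x, h x ≤ oR Y → ∑' x, f x ≤ oR (q * (1 + Real.log X)) := by
    intro f h θ Y hθ hY hYX f1 f2 f3
    refine (log_sum (θ := θ) hm0.le (by linarith) hY (fun x => by rw [e3]; exact f1 x) f2 f3).trans (ofReal_le_ofReal ?_)
    have hl : Real.log Y ≤ 2 * Real.log X := by
      have := Real.log_le_log (by linarith) hYX
      rwa [Real.log_pow] at this
    have hdiv : Real.log Y / (θ * Real.log 2) ≤ 6 / Real.log 2 * Real.log X := by
      rw [div_le_iff₀ (mul_pos (by linarith) hl2)]
      have : 6 / Real.log 2 * Real.log X * (θ * Real.log 2) = 6 * θ * Real.log X := by field_simp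
      rw [this]
      nlinarith
    calc _ ≤ m * (5 ^ d * (6 / Real.log 2 * Real.log X + 1) + 1) := by gcongr
      _ ≤ m * (5 ^ d * ((6 / Real.log 2 + 1) * (1 + Real.log X)) + 1 * (1 + Real.log X)) := by
          have : 0 < 6 / Real.log 2 := by positivity
          gcongr
          · nlinarith
          · linarith
      _ = _ := by rw [hq]; ring
  have F1 : ∑' x, t2 P β x * oR (K * (n x * n x)) ≤ oR (q * (1 + Real.log X)) := by
    refine fin _ (t2 P β) (2 * d / 3) (X ^ 2) (by linarith) (by nlinarith) le_rfl (fun x => ?_) (fun x => ?_) hs2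
    · refine (mul_le_mul' (h2 x) le_rfl).trans ?_
      have := hn x
      rw [← ofReal_mul (by positivity)]
      apply ofReal_le_ofReal
      calc _ = (K * K') * (n x * n x * n x) := by ring
        _ ≤ _ := by gcongr
    · rw [e5]
      have := hn x
      exact mul_le_mul' le_rfl (ofReal_le_ofReal (by gcongr))
  have F2 : ∑' x, tt P β x * oR (K' * n x) ≤ oR (q * (1 + Real.log X)) := by
    refine fin _ (tt P β) (d / 3) X (by linarith) hχ1 (by nlinarith) (fun x => ?_) (fun x => ?_) hs1
    · refine (mul_le_mul' (h1 x) le_rfl).trans ?_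
      have := hn x
      rw [← ofReal_mul (by positivity)]
      apply ofReal_le_ofReal
      calc _ = (K * K') * (n x * n x * n x) := by ring
        _ ≤ _ := by gcongr
    · rw [e4]
      have := hn x
      exact mul_le_mul' le_rfl (ofReal_le_ofReal (by gcongr))
  have hmono : ∀ u v : V d, normInf u ≤ normInf v → n v ≤ n u := fun u v huv =>
    Real.rpow_le_rpow_of_nonpos (hN u) (by exact_mod_cast Nat.succ_le_succ huv) (by linarith)
  constructor
  · intro a
    have hpt : ∀ y, tt P β (a - y) * t2 P β y ≤ t2 P β y * oR (K * (n y * n y)) + tt P β (a - y) * oR (K' * n (a - y)) := by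
      intro y
      by_cases h : normInf y ≤ normInf (a - y)
      · refine le_trans ?_ (le_add_of_nonneg_right zero_le)
        rw [mul_comm]
        have := hmono _ _ h
        have h0 := hn (a - y)
        exact mul_le_mul' le_rfl ((h1 _).trans (ofReal_le_ofReal (mul_le_mul_of_nonneg_left (mul_le_mul this this h0.le (hn y).le) hK.le)))
      · refine le_trans ?_ (le_add_of_nonneg_left zero_le)
        exact mul_le_mul' le_rfl ((h2 _).trans (ofReal_le_ofReal (mul_le_mul_of_nonneg_left (hmono _ _ (by omega)) hK'.le)))
    refine (ENNReal.tsum_le_tsum hpt).trans ?_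
    rw [ENNReal.tsum_add, tsum_refl (fun x => tt P β x * oR (K' * n x))]
    refine (add_le_add F1 F2).trans ?_
    rw [← ofReal_add (by positivity) (by positivity)]
    exact ofReal_le_ofReal (by linarith)
  · refine (fin _ (t2 P β) (2 * d / 3) (X ^ 2) (by linarith) (by nlinarith) le_rfl (fun x => ?_) (fun x => ?_) hs2).trans (ofReal_le_ofReal (by nlinarith))
    · have := hn x
      refine (pow_le_pow_left' (h2 x) 3).trans ?_
      rw [← ENNReal.ofReal_pow (by positivity)]
      apply ofReal_le_ofReal
      calc _ = K' ^ 3 * (n x * n x * n x) := by ring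
        _ ≤ _ := by gcongr
    · have := hn x
      rw [e5, pow_succ']
      refine mul_le_mul' le_rfl ((pow_le_pow_left' (h2 x) 2).trans ?_)
      rw [← ENNReal.ofReal_pow (by positivity)]
      apply ofReal_le_ofReal
      calc _ = K' ^ 2 * (n x * n x) := by ring
        _ ≤ _ := by gcongr
end Log
end Part13
section Part14
section Four
variable {d : ℕ} {J : V d → V d → ℝ} {α c C : ℝ} {P : ℝ → Measure (Config d)} {β : ℝ}
variable {p : Sym2 (V d) → ℝ} {μ : Measure (Config d)} {ω : Config d} {D W : SV d} {x y : V d}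
def Wk (ω : Config d) (D : SV d) (v : ℕ → V d) (n : ℕ) : Prop :=
  (∀ i ≤ n, v i ∈ D) ∧ (∀ i < n, adj ω (v i) (v (i + 1))) ∧ ∀ i ≤ n, ∀ j ≤ n, v i = v j → i = j
theorem exists_wk (h : connIn ω D x y) : ∃ v n, v 0 = x ∧ v n = y ∧ Wk ω D v n := by
  refine h.induct (Q := fun y => ∃ v n, v 0 = x ∧ v n = y ∧ Wk ω D v n) ⟨fun _ => x, 0, rfl, rfl, fun _ _ => h.1, fun i hi => by omega, fun i hi j hj _ => by omega⟩ ?_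
  rintro y z - ⟨v, n, h0, hn, h1, h2, h3⟩ hz hyz
  by_cases hex : ∃ i ≤ n, v i = z
  · obtain ⟨i, hi, rfl⟩ := hex
    exact ⟨v, i, h0, rfl, fun j hj => h1 j (by omega), fun j hj => h2 j (by omega), fun j hj k hk => h3 j (by omega) k (by omega)⟩
  · push Not at hex
    refine ⟨fun k => if k ≤ n then v k else z, n + 1, by simpa using h0, by simp, ?_, ?_, ?_⟩
    · intro i _
      by_cases hi : i ≤ n
      · simpa [hi] using h1 i hi
      · simpa [hi] using hz
    · intro i hi
      by_cases hi' : i + 1 ≤ n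
      · have := h2 i (by omega)
        simpa [hi', (by omega : i ≤ n)] using this
      · obtain rfl : i = n := by omega
        simpa [hn] using hyz
    · intro i hi j hj hij
      by_cases hi' : i ≤ n <;> by_cases hj' : j ≤ n
      · simp only [hi', hj', if_true] at hij; exact h3 i hi' j hj' hij
      · simp only [hi', hj', if_true, if_false] at hij; exact absurd hij (hex i hi')
      · simp only [hi', hj', if_true, if_false] at hij; exact absurd hij.symm (hex j hj')
      · omega
open Classical in
noncomputable def eds (v : ℕ → V d) (i j : ℕ) : Finset (Sym2 (V d)) := (Finset.Ico i j).image fun k => s(v k, v (k + 1))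
theorem eds_open {v : ℕ → V d} {n i j : ℕ} (h : Wk ω D v n) (hj : j ≤ n) : ∀ e ∈ eds v i j, ω e = true := by
  intro e he
  obtain ⟨k, hk, rfl⟩ := Finset.mem_image.1 he
  exact (h.2.1 k (by simp at hk; omega)).2
theorem eds_conn {v : ℕ → V d} {n i j : ℕ} (h : Wk ω D v n) (hij : i ≤ j) (hj : j ≤ n) : connIn (cfg (eds v i j)) D (v i) (v j) := by
  have : ∀ k, i ≤ k → k ≤ j → connIn (cfg (eds v i j)) D (v i) (v k) := by
    intro k hk
    induction k, hk using Nat.le_induction with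
    | base => exact fun _ => .refl (h.1 i (by omega))
    | succ k hk ih =>
      intro hkj
      refine (ih (by omega)).tail (h.1 _ (by omega)) ⟨(h.2.1 k (by omega)).1, ?_⟩
      simp only [cfg, decide_eq_true_eq]
      exact Finset.mem_image.2 ⟨k, by simp; omega, rfl⟩
  exact this j hij le_rfl
theorem eds_disj {v : ℕ → V d} {n i j k l : ℕ} (h : Wk ω D v n) (hjk : j ≤ k) (hl : l ≤ n) : Disjoint (eds v i j) (eds v k l) := by
  rw [Finset.disjoint_left]
  intro e h1 h2
  obtain ⟨a, ha, rfl⟩ := Finset.mem_image.1 h1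
  obtain ⟨b, hb, hab⟩ := Finset.mem_image.1 h2
  rw [Finset.mem_Ico] at ha hb
  rw [Sym2.eq_iff] at hab
  rcases hab with ⟨h1, _⟩ | ⟨h1, h2⟩
  · have := h.2.2 b (by omega) a (by omega) h1; omega
  · have := h.2.2 b (by omega) (a + 1) (by omega) h1
    have := h.2.2 (b + 1) (by omega) a (by omega) h2
    omega
theorem eds_disj' {v u : ℕ → V d} {a : V d} {m i j k l : ℕ} (h : Wk ω (insert a (D \ W)) u m) (hl : l ≤ m)
    (hv : ∀ i' ≤ j, v i' ∈ W) : Disjoint (eds v i j) (eds u k l) := by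
  rw [Finset.disjoint_left]
  intro e h1 h2
  obtain ⟨b, hb, rfl⟩ := Finset.mem_image.1 h1
  obtain ⟨b', hb', hab⟩ := Finset.mem_image.1 h2
  rw [Finset.mem_Ico] at hb hb'
  have key : ∀ q ≤ m, u q ∈ W → u q = a := fun q hq hw => (h.1 q hq).resolve_right fun hh => hh.2 hw
  have e1 := hv b (by omega)
  have e2 := hv (b + 1) (by omega)
  have hne := (h.2.1 b' (by omega)).1
  rw [Sym2.eq_iff] at hab
  rcases hab with ⟨h1, h2⟩ | ⟨h1, h2⟩ <;>
  exact hne ((key b' (by omega) (by rw [h1]; assumption)).trans (key (b' + 1) (by omega) (by rw [h2]; assumption)).symm)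
theorem last_exit (h : connIn ω D x y) (hx : x ∈ W) : ∃ a ∈ W, a ∈ D ∧ connIn ω (insert a (D \ W)) a y := by
  refine h.induct (Q := fun y => ∃ a ∈ W, a ∈ D ∧ connIn ω (insert a (D \ W)) a y) ⟨x, hx, h.1, .refl (Set.mem_insert _ _)⟩ ?_
  rintro y z - ⟨a, haW, haD, ha⟩ hz hyz
  by_cases hzW : z ∈ W
  · exact ⟨z, hzW, hz, .refl (Set.mem_insert _ _)⟩
  · exact ⟨a, haW, haD, ha.tail (Or.inr ⟨hz, hzW⟩) hyz⟩
def DL (D : SV d) : List (V d × V d) → Config d → Prop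
  | [] => fun _ => True
  | q :: l => DO (fun ω => connIn ω D q.1 q.2) (DL D l)
theorem DL_mon {l : List (V d × V d)} : Mon (DL D l) := by
  cases l with
  | nil => exact fun _ _ _ h => h
  | cons q l => exact DO.mon
theorem DL_det {D : FV d} (l : List (V d × V d)) : Det (D.sym2 : Set (Sym2 (V d))) {ω : Config d | DL (D : SV d) l ω} := by
  induction l with
  | nil => exact fun _ _ _ => Iff.rfl
  | cons q l ih => exact DO.det det_fin ih
theorem DL_prob (h : IsBer p μ) {D : FV d} (l : List (V d × V d)) :
    μ {ω | DL (D : SV d) l ω} ≤ (l.map fun q => tau μ Set.univ q.1 q.2).prod := by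
  induction l with
  | nil => have := h.prob; simpa using prob_le_one
  | cons q l ih =>
    rw [List.map_cons, List.prod_cons]
    exact (bk_meas h mon_connIn DL_mon det_fin (DL_det l)).trans (mul_le_mul' (tau_mono (Set.subset_univ _)) ih)
theorem DL_cons {l : List (V d × V d)} {S S' : Finset (Sym2 (V d))} (h1 : connIn (cfg S) D x y) (h2 : Disjoint S S')
    (h3 : DL D l (cfg S')) : DL D ((x, y) :: l) (cfg (S ∪ S')) :=
  ⟨S, S', h2, fun e he => by simp [cfg, he], fun e he => by simp [cfg, he], h1, h3⟩
theorem DL_five {a1 a2 a3 a4 a5 b1 b2 b3 b4 b5 : V d} {S1 S2 S3 S4 S5 : Finset (Sym2 (V d))}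
    (c1 : connIn (cfg S1) D a1 b1) (c2 : connIn (cfg S2) D a2 b2) (c3 : connIn (cfg S3) D a3 b3) (c4 : connIn (cfg S4) D a4 b4) (c5 : connIn (cfg S5) D a5 b5)
    (h12 : Disjoint S1 S2) (h13 : Disjoint S1 S3) (h14 : Disjoint S1 S4) (h15 : Disjoint S1 S5) (h23 : Disjoint S2 S3) (h24 : Disjoint S2 S4)
    (h25 : Disjoint S2 S5) (h34 : Disjoint S3 S4) (h35 : Disjoint S3 S5) (h45 : Disjoint S4 S5)
    (o1 : ∀ e ∈ S1, ω e = true) (o2 : ∀ e ∈ S2, ω e = true) (o3 : ∀ e ∈ S3, ω e = true) (o4 : ∀ e ∈ S4, ω e = true) (o5 : ∀ e ∈ S5, ω e = true) :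
    DL D [(a1, b1), (a2, b2), (a3, b3), (a4, b4), (a5, b5)] ω := by
  have key := DL_cons c1 (S' := S2 ∪ (S3 ∪ (S4 ∪ (S5 ∪ ∅)))) (by simp [Finset.disjoint_union_right, *]) <| DL_cons c2 (by simp [Finset.disjoint_union_right, *]) <|
    DL_cons c3 (by simp [Finset.disjoint_union_right, *]) <| DL_cons c4 (by simp [*]) <| DL_cons c5 (S' := ∅) (by simp) (l := []) trivial
  refine DL_mon (fun e he => ?_) key
  simp only [cfg, decide_eq_true_eq, Finset.mem_union, Finset.notMem_empty, or_false] at he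
  rcases he with h | h | h | h | h
  exacts [o1 e h, o2 e h, o3 e h, o4 e h, o5 e h]
theorem four_det {o w w' : V d} (h1 : connIn ω D o w) (h2 : connIn ω D o w') (h3 : connIn ω D o x) : ∃ a b : V d, a ∈ D ∧ b ∈ D ∧
    (DL D [(o, b), (b, a), (a, w), (a, w'), (b, x)] ω ∨ DL D [(o, a), (a, b), (b, w), (a, w'), (b, x)] ω ∨
      DL D [(o, a), (a, w), (a, b), (b, w'), (b, x)] ω) := by
  obtain ⟨v, n, rfl, rfl, hv⟩ := exists_wk h1
  obtain ⟨a, ⟨i, hi, rfl⟩, haD, ha⟩ := last_exit (W := {z | ∃ i ≤ n, v i = z}) h2 ⟨0, by omega, rfl⟩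
  obtain ⟨u, m, hu0, rfl, hu⟩ := exists_wk ha
  obtain ⟨b, hb, hbD, hbx⟩ := last_exit (W := {z | (∃ i ≤ n, v i = z) ∨ ∃ i ≤ m, u i = z}) h3 (Or.inl ⟨0, by omega, rfl⟩)
  obtain ⟨r, k, hr0, rfl, hr⟩ := exists_wk hbx
  have hsub : ∀ (z : V d) (W : SV d), z ∈ D → insert z (D \ W) ⊆ D := fun z W hz => Set.insert_subset hz Set.sdiff_subset
  have d1 : ∀ i' j', j' ≤ n → Disjoint (eds v i' j') (eds r 0 k) := fun i' j' hj => eds_disj' hr le_rfl fun q hq => Or.inl ⟨q, by omega, rfl⟩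
  have d2 : ∀ i' j', j' ≤ m → Disjoint (eds u i' j') (eds r 0 k) := fun i' j' hj => eds_disj' hr le_rfl fun q hq => Or.inr ⟨q, by omega, rfl⟩
  have d3 : ∀ i' j' k' l', j' ≤ n → l' ≤ m → Disjoint (eds v i' j') (eds u k' l') := fun i' j' k' l' hj hl => eds_disj' hu hl fun q hq => ⟨q, by omega, rfl⟩
  have cr := (eds_conn hr (Nat.zero_le k) le_rfl).mono (hsub _ _ hbD)
  have cu : ∀ i' j', i' ≤ j' → j' ≤ m → connIn (cfg (eds u i' j')) D (u i') (u j') := fun i' j' h1 h2 => (eds_conn hu h1 h2).mono (hsub _ _ haD)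
  have ou := fun i' j' hj => eds_open hu (i := i') (j := j') hj
  have ov := fun i' j' hj => eds_open hv (i := i') (j := j') hj
  have cu0 := cu 0 m (Nat.zero_le m) le_rfl
  rw [hr0] at cr
  rw [hu0] at cu0
  have or := eds_open hr (i := 0) le_rfl
  rcases hb with ⟨j, hj, rfl⟩ | ⟨j, hj, rfl⟩
  · refine ⟨v i, v j, haD, hbD, ?_⟩
    by_cases hji : j ≤ i
    · exact Or.inl (DL_five (eds_conn hv (by omega) hj) (eds_conn hv hji hi) (eds_conn hv hi le_rfl) cu0 cr
        (eds_disj hv le_rfl hi) (eds_disj hv hji le_rfl) (d3 _ _ _ _ hj le_rfl) (d1 _ _ hj) (eds_disj hv le_rfl le_rfl) (d3 _ _ _ _ hi le_rfl) (d1 _ _ hi)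
        (d3 _ _ _ _ le_rfl le_rfl) (d1 _ _ le_rfl) (d2 _ _ le_rfl) (ov _ _ hj) (ov _ _ hi) (ov _ _ le_rfl) (ou _ _ le_rfl) or)
    · have hij : i ≤ j := by omega
      exact Or.inr (Or.inl (DL_five (eds_conn hv (by omega) hi) (eds_conn hv hij hj) (eds_conn hv hj le_rfl) cu0 cr
        (eds_disj hv le_rfl hj) (eds_disj hv hij le_rfl) (d3 _ _ _ _ hi le_rfl) (d1 _ _ hi) (eds_disj hv le_rfl le_rfl) (d3 _ _ _ _ hj le_rfl) (d1 _ _ hj)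
        (d3 _ _ _ _ le_rfl le_rfl) (d1 _ _ le_rfl) (d2 _ _ le_rfl) (ov _ _ hi) (ov _ _ hj) (ov _ _ le_rfl) (ou _ _ le_rfl) or))
  · refine ⟨v i, u j, haD, hbD, ?_⟩
    have c2 := cu 0 j (Nat.zero_le j) hj
    rw [hu0] at c2
    exact Or.inr (Or.inr (DL_five (eds_conn hv (by omega) hi) (eds_conn hv hi le_rfl) c2 (cu _ _ hj le_rfl) cr
      (eds_disj hv le_rfl le_rfl) (d3 _ _ _ _ hi hj) (d3 _ _ _ _ hi le_rfl) (d1 _ _ hi) (d3 _ _ _ _ le_rfl hj) (d3 _ _ _ _ le_rfl le_rfl) (d1 _ _ le_rfl)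
      (eds_disj hu le_rfl le_rfl) (d2 _ _ hj) (d2 _ _ le_rfl) (ov _ _ hi) (ov _ _ le_rfl) (ou _ _ hj) (ou _ _ le_rfl) or))
end Four
end Part14
section Part15
section Mom
variable {d : ℕ} {J : V d → V d → ℝ} {α c C : ℝ} {P : ℝ → Measure (Config d)} {β : ℝ}
def E3 (D : SV d) (w w' x : V d) : Set (Config d) := {ω | connIn ω D 0 w ∧ connIn ω D 0 w' ∧ connIn ω D 0 x}
theorem tt_neg (hJ : KernelHyp d J α c C) (hP : IsLRP J P) (hβ : 0 ≤ β) (x y : V d) : tt P β (x - y) = tt P β (y - x) := by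
  rw [← tau_tt hJ hP hβ, ← tau_tt hJ hP hβ, tau_symm]
theorem four_prob (hJ : KernelHyp d J α c C) (hP : IsLRP J P) (hβ : 0 ≤ β) (w w' x : V d) : P β (E3 Set.univ w w' x) ≤
    ∑' r : V d × V d, (tt P β r.2 * tt P β (r.1 - r.2) * (tt P β (w - r.1) * tt P β (w' - r.1) * tt P β (x - r.2)) +
      tt P β r.1 * tt P β (r.2 - r.1) * (tt P β (w - r.2) * tt P β (w' - r.1) * tt P β (x - r.2)) +
      tt P β r.1 * tt P β (r.2 - r.1) * (tt P β (w - r.1) * tt P β (w' - r.2) * tt P β (x - r.2))) := by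
  have hE : E3 Set.univ w w' x = ⋃ n : ℕ, E3 ((bx n : FV d) : SV d) w w' x := by
    ext ω
    simp only [E3, Set.mem_ofPred_eq, Set.mem_iUnion, connIn_exhaust]
    constructor
    · rintro ⟨⟨n1, h1⟩, ⟨n2, h2⟩, ⟨n3, h3⟩⟩
      have hs : ∀ {m n : ℕ}, m ≤ n → ((bx m : FV d) : SV d) ⊆ (bx n : FV d) := fun h => Finset.coe_subset.2 (bx_mono h)
      exact ⟨max n1 (max n2 n3), h1.mono (hs (by omega)), h2.mono (hs (by omega)), h3.mono (hs (by omega))⟩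
    · rintro ⟨n, h1, h2, h3⟩
      exact ⟨⟨n, h1⟩, ⟨n, h2⟩, ⟨n, h3⟩⟩
  rw [hE, Monotone.measure_iUnion]
  swap
  · intro m n h ω hω
    have hs := Finset.coe_subset.2 (bx_mono (d := d) h)
    exact ⟨hω.1.mono hs, hω.2.1.mono hs, hω.2.2.mono hs⟩
  refine iSup_le fun n => ?_
  refine le_trans (measure_mono (t := ⋃ r : V d × V d, ({ω | DL (bx n : FV d) [(0, r.2), (r.2, r.1), (r.1, w), (r.1, w'), (r.2, x)] ω} ∪
    {ω | DL (bx n : FV d) [(0, r.1), (r.1, r.2), (r.2, w), (r.1, w'), (r.2, x)] ω}) ∪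
    {ω | DL (bx n : FV d) [(0, r.1), (r.1, w), (r.1, r.2), (r.2, w'), (r.2, x)] ω}) ?_) ((measure_iUnion_le _).trans (ENNReal.tsum_le_tsum fun r => ?_))
  · rintro ω ⟨h1, h2, h3⟩
    obtain ⟨a, b, -, -, h⟩ := four_det h1 h2 h3
    refine Set.mem_iUnion.2 ⟨(a, b), ?_⟩
    rcases h with h | h | h
    exacts [Or.inl (Or.inl h), Or.inl (Or.inr h), Or.inr h]
  · have hB := isBer hJ hP hβ
    refine (measure_union_le _ _).trans (add_le_add ((measure_union_le _ _).trans (add_le_add ?_ ?_)) ?_) <;>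
    · refine (DL_prob hB _).trans (le_of_eq ?_)
      simp only [List.map_cons, List.map_nil, List.prod_cons, List.prod_nil, tau_tt hJ hP hβ, sub_zero]
      ring
theorem fact3 (f g h : V d → ℝ≥0∞) : ∑' q : V d × V d × V d, f q.1 * g q.2.1 * h q.2.2 = (∑' x, f x) * (∑' x, g x) * ∑' x, h x := by
  rw [ENNReal.tsum_prod']
  simp_rw [ENNReal.tsum_prod', ENNReal.tsum_mul_left, ENNReal.tsum_mul_right]
  simp_rw [ENNReal.tsum_mul_left, ENNReal.tsum_mul_right]
theorem moment (hJ : KernelHyp d J α c C) (hP : IsLRP J P) (hβ : 0 ≤ β) {T : ℝ≥0∞} (hT : ∀ a, t3 P β a ≤ T) :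
    ∑' q : V d × V d × V d, tt P β q.1 * tt P β q.2.1 * P β (E3 Set.univ q.1 q.2.1 q.2.2) ≤ chi P β * (∑' x, t2 P β x ^ 3 + 2 * (T * T)) := by
  have hs := tt_neg hJ hP hβ
  have e2 : ∀ a, ∑' w, tt P β w * tt P β (w - a) = t2 P β a := fun a => tsum_congr fun w => by rw [hs w a]
  have e1 : ∀ a, ∑' w, tt P β (w - a) = chi P β := fun a => (tsum_shift _ a).trans chi_eq.symm
  have eT : ∑' r : V d × V d, tt P β r.1 * tt P β (r.2 - r.1) * (t2 P β r.1 * t2 P β r.2) ≤ T * T := by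
    rw [ENNReal.tsum_prod']
    have : ∀ a, ∑' b, tt P β a * tt P β (b - a) * (t2 P β a * t2 P β b) ≤ tt P β (0 - a) * t2 P β a * T := by
      intro a
      have h0 : tt P β (0 - a) = tt P β a := by rw [hs, sub_zero]
      refine le_trans (le_of_eq ?_) (mul_le_mul' (le_refl (tt P β (0 - a) * t2 P β a)) (hT a))
      rw [t3, h0, ← ENNReal.tsum_mul_left]
      exact tsum_congr fun b => by rw [hs b a]; ring
    refine (ENNReal.tsum_le_tsum this).trans ?_
    rw [ENNReal.tsum_mul_right]
    exact mul_le_mul' (hT 0) le_rfl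
  refine le_trans (ENNReal.tsum_le_tsum fun q => mul_le_mul' le_rfl (four_prob hJ hP hβ q.1 q.2.1 q.2.2)) ?_
  simp_rw [← ENNReal.tsum_mul_left]
  rw [ENNReal.tsum_comm]
  have key : ∀ r : V d × V d, ∑' q : V d × V d × V d, tt P β q.1 * tt P β q.2.1 * (tt P β r.2 * tt P β (r.1 - r.2) * (tt P β (q.1 - r.1) * tt P β (q.2.1 - r.1) * tt P β (q.2.2 - r.2)) +
      tt P β r.1 * tt P β (r.2 - r.1) * (tt P β (q.1 - r.2) * tt P β (q.2.1 - r.1) * tt P β (q.2.2 - r.2)) +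
      tt P β r.1 * tt P β (r.2 - r.1) * (tt P β (q.1 - r.1) * tt P β (q.2.1 - r.2) * tt P β (q.2.2 - r.2))) =
      chi P β * (tt P β r.2 * tt P β (r.1 - r.2) * t2 P β r.1 ^ 2 + 2 * (tt P β r.1 * tt P β (r.2 - r.1) * (t2 P β r.1 * t2 P β r.2))) := by
    rintro ⟨a, b⟩
    have k : ∀ a1 a2, ∑' q : V d × V d × V d, (tt P β q.1 * tt P β (q.1 - a1)) * (tt P β q.2.1 * tt P β (q.2.1 - a2)) * tt P β (q.2.2 - b) = t2 P β a1 * t2 P β a2 * chi P β := by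
      intro a1 a2
      rw [fact3 (fun w => tt P β w * tt P β (w - a1)) (fun w => tt P β w * tt P β (w - a2)) (fun x => tt P β (x - b)), e2, e2, e1]
    trans ∑' q : V d × V d × V d, (tt P β b * tt P β (a - b) * ((tt P β q.1 * tt P β (q.1 - a)) * (tt P β q.2.1 * tt P β (q.2.1 - a)) * tt P β (q.2.2 - b)) +
      tt P β a * tt P β (b - a) * ((tt P β q.1 * tt P β (q.1 - b)) * (tt P β q.2.1 * tt P β (q.2.1 - a)) * tt P β (q.2.2 - b)) +
      tt P β a * tt P β (b - a) * ((tt P β q.1 * tt P β (q.1 - a)) * (tt P β q.2.1 * tt P β (q.2.1 - b)) * tt P β (q.2.2 - b)))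
    · exact tsum_congr fun q => by ring
    · rw [ENNReal.tsum_add, ENNReal.tsum_add, ENNReal.tsum_mul_left, ENNReal.tsum_mul_left, ENNReal.tsum_mul_left, k, k, k]
      ring
  rw [tsum_congr key, ENNReal.tsum_mul_left, ENNReal.tsum_add, ENNReal.tsum_mul_left]
  refine mul_le_mul' le_rfl (add_le_add (le_of_eq ?_) (mul_le_mul' le_rfl eT))
  rw [ENNReal.tsum_prod']
  simp_rw [ENNReal.tsum_mul_right]
  exact tsum_congr fun a => by rw [pow_succ', mul_comm]; unfold t2; ring
end Mom
end Part15
section Part16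
section Diff
variable {d : ℕ} {J : V d → V d → ℝ} {α c C : ℝ} {P : ℝ → Measure (Config d)} {β : ℝ}
variable {p : Sym2 (V d) → ℝ} {μ : Measure (Config d)}
noncomputable def pi' (μ : Measure (Config d)) (A : FV d) : ℝ≥0∞ := μ {ω | Kc ω Set.univ 0 = (A : SV d)}
theorem pi_sum (hf : ∀ᵐ ω ∂μ, (Kc ω Set.univ 0).Finite) {F : Set (Config d)} (mF : MeasurableSet F) :
    ∑' A : FV d, μ ({ω | Kc ω Set.univ 0 = (A : SV d)} ∩ F) = μ F := by
  rw [← measure_iUnion]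
  · refine measure_congr (ae_eq_set.2 ⟨?_, ?_⟩)
    · rw [Set.sdiff_eq_empty.2 (Set.iUnion_subset fun A => Set.inter_subset_right), measure_empty]
    · refine measure_mono_null (fun ω hω => ?_) (ae_iff.1 hf)
      intro hfin
      exact hω.2 (Set.mem_iUnion.2 ⟨hfin.toFinset, by simp, hω.1⟩)
  · intro A B hAB
    refine Set.disjoint_left.2 fun ω h1 h2 => hAB ?_
    exact Finset.coe_injective (h1.1.symm.trans h2.1)
  · exact fun A => meas_Kc.inter mF
open Classical in
theorem pi_tau (hf : ∀ᵐ ω ∂μ, (Kc ω Set.univ 0).Finite) (x : V d) : ∑' A : FV d, (if x ∈ A then pi' μ A else 0) = tau μ Set.univ 0 x := by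
  rw [tau, ← pi_sum hf meas_connIn]
  refine tsum_congr fun A => ?_
  by_cases hx : x ∈ A
  · rw [if_pos hx]
    refine congrArg μ (Set.ext fun ω => ⟨fun h => ⟨h, ?_⟩, fun h => h.1⟩)
    have : x ∈ Kc ω Set.univ 0 := by rw [show Kc ω Set.univ 0 = A from h]; exact hx
    exact this
  · rw [if_neg hx, eq_comm]
    refine measure_mono_null (t := ∅) (fun ω h => hx ?_) measure_empty
    have : x ∈ Kc ω Set.univ 0 := h.2
    rwa [h.1, Finset.mem_coe] at this
def sh (B : FV d) (w : V d) : FV d := (Equiv.subRight w).finsetCongr B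
theorem mem_sh {B : FV d} {w x : V d} : x ∈ sh B w ↔ x + w ∈ B := by
  simp only [sh, Equiv.finsetCongr_apply, Finset.mem_map_equiv, Equiv.subRight_symm_apply]
theorem sh_tau (h : IsBer p μ) (ht : TI p) (B : FV d) (w x y : V d) : tau μ ((sh B w : SV d)ᶜ) x y = tau μ ((B : SV d)ᶜ) (x + w) (y + w) := by
  rw [← tau_shift h ht w]
  congr 1
  ext v; simp [mem_sh]
theorem sh_tau' (h : IsBer p μ) (ht : TI p) (B : FV d) (w y : V d) :
    tau μ (insert (-w) (sh B w : SV d)ᶜ) (-w) y = tau μ (insert 0 (B : SV d)ᶜ) 0 (y + w) := by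
  rw [← tau_shift h ht w, neg_add_cancel]
  congr 1
  ext v; simp [mem_sh, sub_eq_neg_self]
open Classical in
theorem recenter (h : IsBer p μ) (ht : TI p) (f : FV d → V d → ℝ≥0∞) :
    ∑' A : FV d, pi' μ A * ∑' w, (if w ∈ A then f A w else 0) ≤ ∑' A : FV d, pi' μ A * ∑' w, (if w ∈ A then f (sh A w) (-w) else 0) := by
  simp_rw [← ENNReal.tsum_mul_left]
  rw [ENNReal.tsum_comm, ENNReal.tsum_comm (f := fun A : FV d => fun w : V d => pi' μ A * _), ← (Equiv.neg (V d)).tsum_eq]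
  refine ENNReal.tsum_le_tsum fun w => ?_
  rw [← ((Equiv.subRight w).finsetCongr : FV d ≃ FV d).tsum_eq]
  refine ENNReal.tsum_le_tsum fun B => ?_
  change pi' μ (sh B w) * (if -w ∈ sh B w then f (sh B w) (-w) else 0) ≤ _
  have hz : ∀ A : FV d, (0 : V d) ∉ A → pi' μ A = 0 := by
    intro A hA
    refine measure_mono_null (t := ∅) (fun ω h => hA ?_) measure_empty
    have h0 : (0 : V d) ∈ Kc ω Set.univ 0 := connIn.refl trivial
    rwa [show Kc ω Set.univ 0 = A from h] at h0
  by_cases hw : w ∈ B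
  swap
  · rw [hz (sh B w) (by rw [mem_sh, zero_add]; exact hw)]; simp
  rw [if_pos hw]
  by_cases h0 : -w ∈ sh B w
  swap
  · rw [if_neg h0]; simp
  rw [if_pos h0]
  refine mul_le_mul' ?_ le_rfl
  rw [mem_sh, neg_add_cancel] at h0
  have : pi' μ (sh B w) = μ.map (shift w) {ω | Kc ω Set.univ 0 = (sh B w : SV d)} := by rw [map_shift h ht]; rfl
  rw [this, Measure.map_apply meas_shift meas_Kc]
  refine measure_mono fun ω hω => ?_
  have hω' : ∀ y, connIn ω Set.univ w (y + w) ↔ y + w ∈ B := by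
    intro y
    rw [← mem_sh, ← Finset.mem_coe, ← (show Kc (shift w ω) Set.univ 0 = (sh B w : SV d) from hω)]
    change _ ↔ connIn (shift w ω) Set.univ 0 y
    rw [connIn_shift, zero_add]
    simp
  have h0w : connIn ω Set.univ w 0 := by simpa using (hω' (-w)).2 (by simpa using h0)
  refine Set.ext fun y => ?_
  have := hω' (y - w)
  rw [sub_add_cancel] at this
  rw [Finset.mem_coe, ← this]
  exact ⟨fun h => h0w.trans h, fun h => h0w.symm.trans h⟩
theorem am_gm (a b : ℝ≥0∞) : 2 * (a * b) ≤ a * a + b * b := by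
  rcases le_total a b with h | h <;>
  · obtain ⟨k, rfl⟩ := exists_add_of_le h
    calc _ ≤ _ + k * k := le_self_add
      _ = _ := by ring
noncomputable def ss (μ : Measure (Config d)) (A : FV d) (a : V d) : ℝ≥0∞ := ∑' x, tau μ (insert a (A : SV d)ᶜ) a x
open Classical in
theorem chi_exit (hJ : KernelHyp d J α c C) (hP : IsLRP J P) (hβ : 0 ≤ β) (hfin : chi P β ≠ ∞) (A : FV d) (h0 : (0 : V d) ∈ A) :
    chi P β ≤ ∑' w, (if w ∈ A then tt P β w * ss (P β) A w else 0) := by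
  have hB := isBer hJ hP hβ
  have hpr := hB.prob
  have key : ∀ x, tt P β x ≤ ∑' w, (if w ∈ A then tt P β w * tau (P β) (insert w (A : SV d)ᶜ) w x else 0) := by
    intro x
    by_cases hx : x ∈ A
    · refine le_trans (le_of_eq ?_) (ENNReal.le_tsum x)
      have : {ω : Config d | connIn ω (insert x (A : SV d)ᶜ) x x} = Set.univ := Set.eq_univ_of_forall fun ω => .refl (Set.mem_insert _ _)
      rw [if_pos hx, tau, this, measure_univ, mul_one]
    · have := exit_lemma (D := Set.univ) (y := 0) hB (x := x) (U := (A : SV d)ᶜ) (by simpa using hx) (ae_fin (ne_top_of_le_ne_top hfin (chi_D_le hJ hP hβ _ x)))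
      rw [tau_notMem (D := (A : SV d)ᶜ) (by simpa using h0), zero_add, tau_symm] at this
      refine this.trans (ENNReal.tsum_le_tsum fun w => ?_)
      by_cases hw : w ∈ A
      · rw [if_neg (by simpa using hw), if_pos hw, mul_comm, tau_symm (x := x)]
        refine mul_le_mul' ((tau_mono (Set.subset_univ _)).trans (le_of_eq ?_)) le_rfl
        rw [tau_symm]; rfl
      · rw [if_pos (by simpa using hw)]; exact zero_le
  rw [chi_eq]
  refine (ENNReal.tsum_le_tsum key).trans (le_of_eq ?_)
  rw [ENNReal.tsum_comm]
  refine tsum_congr fun w => ?_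
  by_cases hw : w ∈ A
  · simp only [if_pos hw, ss, ENNReal.tsum_mul_left]
  · simp [if_neg hw]
theorem ss_first (hJ : KernelHyp d J α c C) (hP : IsLRP J P) (hβ : 0 ≤ β) (A : FV d) (h0 : (0 : V d) ∈ A) :
    ss (P β) A 0 ≤ 1 + oR β * ∑' a, ∑' x, oR (J 0 a) * tau (P β) (A : SV d)ᶜ a x := by
  have hB := isBer hJ hP hβ
  have hpr := hB.prob
  have hfin : ∀ᵐ ω ∂(P β), (Kc ω {(0 : V d)} 0).Finite := ae_of_all _ fun ω => (Set.finite_singleton _).subset Kc_subset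
  have h1 : ∀ x : V d, x ≠ 0 → tau (P β) {(0 : V d)} 0 x = 0 := fun x hx => tau_notMem (by simpa using hx)
  have hone : ∀ D (x y : V d), tau (P β) D x y ≤ 1 := fun D x y => prob_le_one
  have h2 : ∀ a : V d, a ≠ 0 → tau (P β) (insert a {0}) 0 a ≤ oR β * oR (J 0 a) := by
    intro a ha
    refine (exit_prob hB (by simpa using ha)).trans ?_
    rw [if_neg (Ne.symm ha), zero_add, tsum_eq_single 0 fun b hb => by rw [h1 b hb, zero_mul], ← ofReal_mul (p := β) hβ]
    refine (mul_le_mul' (hone _ _ _) (ofReal_le_ofReal (pJ_le hJ 0 a))).trans (one_mul _).le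
  have h3 : ∀ x, tau (P β) (insert 0 (A : SV d)ᶜ) 0 x ≤ tau (P β) {(0 : V d)} 0 x + ∑' a, oR β * (oR (J 0 a) * tau (P β) (A : SV d)ᶜ a x) := by
    intro x
    refine (exit_lemma hB (Set.mem_singleton 0) hfin).trans (add_le_add le_rfl (ENNReal.tsum_le_tsum fun a => ?_))
    by_cases ha : a = 0
    · rw [if_pos (by simpa using ha)]; exact zero_le
    · rw [if_neg (by simpa using ha), ← mul_assoc]
      refine mul_le_mul' (h2 a ha) (tau_mono ?_)
      rintro v ⟨rfl | hv, hv'⟩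
      · exact absurd rfl hv'
      · exact hv
  refine (ENNReal.tsum_le_tsum h3).trans ?_
  rw [ENNReal.tsum_add, ENNReal.tsum_comm, tsum_eq_single 0 h1]
  simp_rw [ENNReal.tsum_mul_left]
  exact add_le_add (hone _ _ _) le_rfl
noncomputable def DD (J : V d → V d → ℝ) (μ : Measure (Config d)) : ℝ≥0∞ :=
  ∑' u, ∑' v, ∑' y, oR (J u v) * μ {ω | connIn ω Set.univ 0 u ∧ connIn ω Set.univ v y ∧ ¬ connIn ω Set.univ 0 v}
open Classical in
theorem dd_bound (hJ : KernelHyp d J α c C) (hP : IsLRP J P) (hβ : 0 ≤ β) (hf : ∀ᵐ ω ∂(P β), (Kc ω Set.univ 0).Finite) :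
    ∑' A : FV d, pi' (P β) A * ∑' w, (if w ∈ A then ∑' a, ∑' x, oR (J 0 a) * tau (P β) (A : SV d)ᶜ a x else 0) ≤ DD J (P β) := by
  have hB := isBer hJ hP hβ
  have hT := TI_pJ (β := β) hJ
  refine (recenter hB hT fun A _ => ∑' a, ∑' x, oR (J 0 a) * tau (P β) (A : SV d)ᶜ a x).trans ?_
  simp_rw [← ENNReal.tsum_mul_left]
  rw [ENNReal.tsum_comm]
  refine ENNReal.tsum_le_tsum fun w => ?_
  have e : ∀ A : FV d, ∑' a, ∑' x, oR (J 0 a) * tau (P β) (sh A w : SV d)ᶜ a x = ∑' a, ∑' x, oR (J w a) * tau (P β) (A : SV d)ᶜ a x := by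
    intro A
    simp_rw [sh_tau hB hT, ENNReal.tsum_mul_left]
    rw [← (Equiv.addRight w).tsum_eq (fun a => oR (J w a) * ∑' x, tau (P β) (A : SV d)ᶜ a x)]
    refine tsum_congr fun a => ?_
    rw [← (Equiv.addRight w).tsum_eq (fun x => tau (P β) (A : SV d)ᶜ (Equiv.addRight w a) x)]
    simp only [Equiv.coe_addRight]
    rw [J_sub hJ w, add_sub_cancel_right]
  have e2 : ∀ A : FV d, pi' (P β) A * (if w ∈ A then ∑' a, ∑' x, oR (J 0 a) * tau (P β) (sh A w : SV d)ᶜ a x else 0) ≤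
      ∑' v, ∑' y, oR (J w v) * P β ({ω | Kc ω Set.univ 0 = (A : SV d)} ∩ {ω | connIn ω Set.univ 0 w ∧ connIn ω Set.univ v y ∧ ¬ connIn ω Set.univ 0 v}) := by
    intro A
    by_cases hw : w ∈ A
    swap
    · rw [if_neg hw, mul_zero]; exact zero_le
    rw [if_pos hw, e]
    simp_rw [← ENNReal.tsum_mul_left]
    refine ENNReal.tsum_le_tsum fun v => ENNReal.tsum_le_tsum fun y => ?_
    rw [mul_left_comm]
    refine mul_le_mul' le_rfl ?_
    have := explore (u := v) (v := y) (U := Set.univ) (x := 0) hB (B := (A : SV d)) trivial disjoint_compl_right MeasurableSet.univ (fun _ _ _ => Iff.rfl)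
    rw [Set.inter_univ] at this
    rw [pi', ← this]
    refine measure_mono fun ω hω => ⟨hω.1, ?_, hω.2.mono (Set.subset_univ _), fun h => ?_⟩
    · have : w ∈ Kc ω Set.univ 0 := by rw [hω.1]; exact hw
      exact this
    · have h' : v ∈ Kc ω Set.univ 0 := h
      rw [hω.1] at h'
      exact hω.2.1 h'
  refine (ENNReal.tsum_le_tsum e2).trans (le_of_eq ?_)
  rw [ENNReal.tsum_comm]
  refine tsum_congr fun v => ?_
  rw [ENNReal.tsum_comm]
  refine tsum_congr fun y => ?_
  rw [ENNReal.tsum_mul_left, pi_sum hf]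
  exact meas_connIn.inter (meas_connIn.inter meas_connIn.compl)
theorem pi_card (hf : ∀ᵐ ω ∂(P β), (Kc ω Set.univ 0).Finite) : ∑' A : FV d, pi' (P β) A * (A.card : ℝ≥0∞) = chi P β := by
  classical
  rw [chi_eq]
  simp_rw [← pi_tau hf]
  rw [ENNReal.tsum_comm]
  refine tsum_congr fun A => ?_
  rw [tsum_eq_sum (s := A) fun x hx => if_neg hx, Finset.sum_congr rfl fun x hx => if_pos hx, Finset.sum_const, nsmul_eq_mul, mul_comm]
open Classical in
theorem dstep (hJ : KernelHyp d J α c C) (hP : IsLRP J P) (hβ : 0 ≤ β) (hfin : chi P β ≠ ∞) {T : ℝ≥0∞} (hT : ∀ a, t3 P β a ≤ T) {m : ℝ} (hm : 0 < m)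
    (hm' : ∑' x, t2 P β x ^ 3 + 2 * (T * T) ≤ oR m) : chi P β * chi P β ≤ oR m * (chi P β + oR β * DD J (P β)) := by
  have hB := isBer hJ hP hβ
  have hTI := TI_pJ (β := β) hJ
  have hf : ∀ᵐ ω ∂(P β), (Kc ω Set.univ 0).Finite := ae_fin (ne_top_of_le_ne_top hfin (chi_D_le hJ hP hβ _ 0))
  have hz : ∀ A : FV d, (0 : V d) ∉ A → pi' (P β) A = 0 := by
    intro A hA
    refine measure_mono_null (t := ∅) (fun ω h => hA ?_) measure_empty
    have h0 : (0 : V d) ∈ Kc ω Set.univ 0 := connIn.refl trivial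
    rwa [show Kc ω Set.univ 0 = A from h] at h0
  obtain ⟨X, hX⟩ : ∃ X, X = chi P β := ⟨_, rfl⟩
  obtain ⟨S, hS⟩ : ∃ S, S = ∑' A : FV d, pi' (P β) A * (A.card : ℝ≥0∞) * ss (P β) A 0 := ⟨_, rfl⟩
  have hssX : ∀ A : FV d, ss (P β) A 0 ≤ X := fun A => (chi_D_le hJ hP hβ _ 0).trans_eq hX.symm
  obtain ⟨Q, hQ⟩ : ∃ Q : FV d → ℝ≥0∞, Q = fun A => ∑' w, (if w ∈ A then tt P β w else 0) := ⟨_, rfl⟩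
  have s1 : X * X ≤ ∑' A : FV d, pi' (P β) A * (A.card : ℝ≥0∞) * (ss (P β) A 0 * Q A) := by
    calc X * X = ∑' A : FV d, pi' (P β) A * (A.card : ℝ≥0∞) * X := by rw [ENNReal.tsum_mul_right, pi_card hf, hX]
      _ ≤ ∑' A : FV d, pi' (P β) A * ∑' w, (if w ∈ A then (A.card : ℝ≥0∞) * (tt P β w * ss (P β) A w) else 0) := by
        refine ENNReal.tsum_le_tsum fun A => ?_
        by_cases h0 : (0 : V d) ∈ A
        · rw [mul_assoc]
          refine mul_le_mul' le_rfl ((mul_le_mul' le_rfl (hX.trans_le (chi_exit hJ hP hβ hfin A h0))).trans_eq ?_)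
          rw [← ENNReal.tsum_mul_left]
          exact tsum_congr fun w => by rw [mul_ite, mul_zero]
        · rw [hz A h0, zero_mul, zero_mul]; exact zero_le
      _ ≤ _ := recenter hB hTI fun A w => (A.card : ℝ≥0∞) * (tt P β w * ss (P β) A w)
      _ = _ := by
        refine tsum_congr fun A => ?_
        rw [mul_assoc, hQ]
        beta_reduce
        refine congrArg _ ?_
        rw [← ENNReal.tsum_mul_left, ← ENNReal.tsum_mul_left]
        refine tsum_congr fun w => ?_
        by_cases hw : w ∈ A
        · have hc : (sh A w).card = A.card := by simp [sh]
          have hs : ss (P β) (sh A w) (-w) = ss (P β) A 0 := by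
            simp only [ss, sh_tau' hB hTI]
            exact (Equiv.addRight w).tsum_eq (fun y => tau (P β) (insert 0 (A : SV d)ᶜ) 0 y)
          have ht := tt_neg hJ hP hβ 0 w
          rw [zero_sub, sub_zero] at ht
          rw [if_pos hw, if_pos hw, hc, hs, ht]
          ring
        · rw [if_neg hw, if_neg hw]; simp
  have s2 : ∑' A : FV d, pi' (P β) A * (A.card : ℝ≥0∞) * (Q A * Q A) ≤ X * oR m := by
    refine le_trans ?_ ((moment hJ hP hβ hT).trans (by rw [hX]; exact mul_le_mul' le_rfl hm'))
    have e : ∀ A : FV d, pi' (P β) A * (A.card : ℝ≥0∞) * (Q A * Q A) ≤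
        ∑' q : V d × V d × V d, tt P β q.1 * tt P β q.2.1 * P β ({ω | Kc ω Set.univ 0 = (A : SV d)} ∩ E3 Set.univ q.1 q.2.1 q.2.2) := by
      intro A
      have hc : (A.card : ℝ≥0∞) = ∑' x : V d, (if x ∈ A then 1 else 0) := by
        rw [tsum_eq_sum (s := A) fun x hx => if_neg hx, Finset.sum_congr rfl fun x hx => if_pos hx]; simp
      rw [mul_assoc, mul_comm (A.card : ℝ≥0∞), hc, hQ, ← fact3, ← ENNReal.tsum_mul_left]
      refine ENNReal.tsum_le_tsum fun q => ?_
      by_cases h1 : q.1 ∈ A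
      swap
      · rw [if_neg h1]; simp
      by_cases h2 : q.2.1 ∈ A
      swap
      · rw [if_neg h2]; simp
      by_cases h3 : q.2.2 ∈ A
      swap
      · rw [if_neg h3]; simp
      rw [if_pos h1, if_pos h2, if_pos h3, mul_one, mul_comm]
      refine mul_le_mul' le_rfl (measure_mono fun ω hω => ⟨hω, ?_⟩)
      have hk : ∀ x ∈ A, connIn ω Set.univ 0 x := fun x hx => by
        have : x ∈ Kc ω Set.univ 0 := by rw [show Kc ω Set.univ 0 = A from hω]; exact hx
        exact this
      exact ⟨hk _ h1, hk _ h2, hk _ h3⟩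
    refine (ENNReal.tsum_le_tsum e).trans (le_of_eq ?_)
    rw [ENNReal.tsum_comm]
    refine tsum_congr fun q => ?_
    rw [ENNReal.tsum_mul_left, pi_sum hf]
    exact meas_connIn.inter (meas_connIn.inter meas_connIn)
  have s3 : ∀ k : ℝ≥0∞, 2 * (k * (X * X)) ≤ k * k * (X * S) + X * oR m := by
    intro k
    refine le_trans ?_ (add_le_add le_rfl s2)
    refine (mul_le_mul' le_rfl (mul_le_mul' le_rfl s1)).trans ?_
    rw [hS, ← ENNReal.tsum_mul_left, ← ENNReal.tsum_mul_left, ← ENNReal.tsum_mul_left, ← ENNReal.tsum_mul_left, ← ENNReal.tsum_add]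
    refine ENNReal.tsum_le_tsum fun A => ?_
    calc _ = pi' (P β) A * (A.card : ℝ≥0∞) * (2 * ((k * ss (P β) A 0) * Q A)) := by ring
      _ ≤ pi' (P β) A * (A.card : ℝ≥0∞) * ((k * ss (P β) A 0) * (k * X) + Q A * Q A) :=
        mul_le_mul' le_rfl ((am_gm _ _).trans (add_le_add (mul_le_mul' le_rfl (mul_le_mul' le_rfl (hssX A))) le_rfl))
      _ = _ := by ring
  have hSX : S ≤ X * X := by
    rw [hS]
    refine (ENNReal.tsum_le_tsum fun A => mul_le_mul' le_rfl (hssX A)).trans_eq ?_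
    rw [ENNReal.tsum_mul_right, pi_card hf, hX]
  have s4 : S ≤ X + oR β * DD J (P β) := by
    have := dd_bound hJ hP hβ hf
    refine le_trans ?_ (add_le_add le_rfl (mul_le_mul' le_rfl this))
    rw [hS, hX, ← pi_card hf, ← ENNReal.tsum_mul_left, ← ENNReal.tsum_add]
    refine ENNReal.tsum_le_tsum fun A => ?_
    by_cases h0 : (0 : V d) ∈ A
    · refine (mul_le_mul' le_rfl (ss_first hJ hP hβ A h0)).trans_eq ?_
      rw [tsum_eq_sum (s := A) fun x hx => if_neg hx, Finset.sum_congr rfl fun x hx => if_pos hx, Finset.sum_const, nsmul_eq_mul]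
      ring
    · rw [hz A h0, zero_mul, zero_mul]; exact zero_le
  rw [← hX] at hfin ⊢
  refine le_trans ?_ (mul_le_mul' le_rfl s4)
  have hX1 : 1 ≤ X := hX ▸ one_le_chi hJ hP hβ
  have hSf : S ≠ ∞ := ne_top_of_le_ne_top (ENNReal.mul_ne_top hfin hfin) hSX
  obtain ⟨a, ha0, rfl⟩ : ∃ a : ℝ, 0 ≤ a ∧ X = oR a := ⟨X.toReal, toReal_nonneg, (ofReal_toReal hfin).symm⟩
  obtain ⟨b, hb0, rfl⟩ : ∃ a : ℝ, 0 ≤ a ∧ S = oR a := ⟨S.toReal, toReal_nonneg, (ofReal_toReal hSf).symm⟩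
  have ha1 : 1 ≤ a := by rw [← ofReal_one, ofReal_le_ofReal_iff ha0] at hX1; exact hX1
  have := s3 (oR (m / a))
  have hq : 0 ≤ m / a := by positivity
  rw [show (2 : ℝ≥0∞) = oR 2 by simp, ← ofReal_mul ha0, ← ofReal_mul hq, ← ofReal_mul (by norm_num), ← ofReal_mul hq, ← ofReal_mul ha0,
    ← ofReal_mul (by positivity), ← ofReal_mul ha0, ← ofReal_add (by positivity) (by positivity), ofReal_le_ofReal_iff (by positivity)] at this
  rw [← ofReal_mul ha0, ← ofReal_mul hm.le]
  refine ofReal_le_ofReal ?_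
  have ha' : a ≠ 0 := by positivity
  field_simp at this
  nlinarith
end Diff
end Part16
section Part17
section Integ
variable {d : ℕ} {J : V d → V d → ℝ} {α c C : ℝ} {P : ℝ → Measure (Config d)} {β : ℝ}
def FF (D : SV d) (u v y : V d) : Set (Config d) := {ω | connIn ω D 0 u ∧ connIn ω D v y ∧ ¬ connIn ω Set.univ 0 v}
theorem tsum_sup {ι : Type*} (f : ℕ → ι → ℝ≥0∞) (hf : Monotone f) : ∑' i, ⨆ n, f n i = ⨆ n, ∑' i, f n i := by
  simp_rw [ENNReal.tsum_eq_iSup_sum]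
  rw [iSup_comm]
  congr 1; ext s
  exact ENNReal.finsetSum_iSup_of_monotone fun i => fun _ _ h => hf h i
theorem DD_iSup (μ : Measure (Config d)) : DD J μ = ⨆ n : ℕ, ∑' u, ∑' v, ∑' y, oR (J u v) * μ (FF ((bx n : FV d) : SV d) u v y) := by
  have hFm : ∀ u v y, Monotone fun n : ℕ => FF ((bx n : FV d) : SV d) u v y := by
    intro u v y m n h ω hω
    have hs := Finset.coe_subset.2 (bx_mono (d := d) h)
    exact ⟨hω.1.mono hs, hω.2.1.mono hs, hω.2.2⟩
  have hF : ∀ u v y : V d, {ω : Config d | connIn ω Set.univ 0 u ∧ connIn ω Set.univ v y ∧ ¬ connIn ω Set.univ 0 v} = ⋃ n : ℕ, FF ((bx n : FV d) : SV d) u v y := by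
    intro u v y
    ext ω
    simp only [FF, Set.mem_iUnion, Set.mem_ofPred_eq]
    constructor
    · rintro ⟨h1, h2, h3⟩
      obtain ⟨m, hm⟩ := connIn_exhaust.1 h1
      obtain ⟨n, hn⟩ := connIn_exhaust.1 h2
      exact ⟨max m n, hm.mono (Finset.coe_subset.2 (bx_mono (le_max_left _ _))), hn.mono (Finset.coe_subset.2 (bx_mono (le_max_right _ _))), h3⟩
    · rintro ⟨n, h1, h2, h3⟩
      exact ⟨h1.mono (Set.subset_univ _), h2.mono (Set.subset_univ _), h3⟩
  have hm : ∀ u v y, Monotone fun n : ℕ => oR (J u v) * μ (FF ((bx n : FV d) : SV d) u v y) :=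
    fun u v y m n h => mul_le_mul' le_rfl (measure_mono (hFm u v y h))
  rw [DD, ← tsum_sup]
  swap
  · exact fun m n h u => ENNReal.tsum_le_tsum fun v => ENNReal.tsum_le_tsum fun y => hm u v y h
  refine tsum_congr fun u => ?_
  rw [← tsum_sup]
  swap
  · exact fun m n h v => ENNReal.tsum_le_tsum fun y => hm u v y h
  refine tsum_congr fun v => ?_
  rw [← tsum_sup]
  swap
  · exact fun m n h y => hm u v y h
  refine tsum_congr fun y => ?_
  rw [hF, (hFm u v y).measure_iUnion, ENNReal.mul_iSup]
theorem HG (hJ : KernelHyp d J α c C) (μ : Measure (Config d)) (D : FV d) : ∑' u, ∑' v, ∑' y, oR (J u v) * μ (FF (D : SV d) u v y) ≤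
    ∑ y ∈ D, ∑ e ∈ D.sym2, oR (wJ J e) * μ {ω | ¬ connIn ω D 0 y ∧ connIn (opn e ω) D 0 y} := by
  have z1 : ∀ u v y, u ∉ D → μ (FF (D : SV d) u v y) = 0 := fun u v y h => measure_mono_null (t := ∅) (fun ω hω => h hω.1.2.1) measure_empty
  have z2 : ∀ u v y, v ∉ D → μ (FF (D : SV d) u v y) = 0 := fun u v y h => measure_mono_null (t := ∅) (fun ω hω => h hω.2.1.1) measure_empty
  have z3 : ∀ u v y, y ∉ D → μ (FF (D : SV d) u v y) = 0 := fun u v y h => measure_mono_null (t := ∅) (fun ω hω => h hω.2.1.2.1) measure_empty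
  have e : ∑' u, ∑' v, ∑' y, oR (J u v) * μ (FF (D : SV d) u v y) = ∑ u ∈ D, ∑ v ∈ D, ∑ y ∈ D, oR (J u v) * μ (FF (D : SV d) u v y) := by
    rw [tsum_eq_sum (s := D) fun u hu => by simp [z1 u _ _ hu]]
    refine Finset.sum_congr rfl fun u _ => ?_
    rw [tsum_eq_sum (s := D) fun v hv => by simp [z2 u v _ hv]]
    refine Finset.sum_congr rfl fun v _ => ?_
    rw [tsum_eq_sum (s := D) fun y hy => by simp [z3 u v y hy]]
  rw [e, Finset.sum_congr rfl fun u _ => Finset.sum_comm, Finset.sum_comm]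
  refine Finset.sum_le_sum fun y _ => le_sym2 (fun u hu v hv huv => ?_) fun u => ?_
  · rw [wJ_mk hJ, hJ.symm v u, ← mul_add, ← measure_union]
    · refine mul_le_mul' le_rfl (measure_mono ?_)
      have piv : ∀ {ω : Config d} {u v : V d}, u ≠ v → ω ∈ FF (D : SV d) u v y → ¬ connIn ω D 0 y ∧ connIn (opn s(u, v) ω) D 0 y := by
        rintro ω u v huv ⟨h1, h2, h3⟩
        refine ⟨fun h => h3 ((h.trans h2.symm).mono (Set.subset_univ _)), ?_⟩
        exact ((connIn_opn h1).tail h2.1 (adj_opn huv)).trans (connIn_opn h2)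
      rintro ω (hω | hω)
      · exact piv huv hω
      · have := piv (Ne.symm huv) hω
        rwa [Sym2.eq_swap] at this
    · exact Set.disjoint_left.2 fun ω h1 h2 => h2.2.2 (h1.1.mono (Set.subset_univ _))
    · exact meas_connIn.inter (meas_connIn.inter meas_connIn.compl)
  · rw [mul_eq_zero]
    exact Or.inr (measure_mono_null (t := ∅) (fun ω hω => hω.2.2 (hω.1.mono (Set.subset_univ _))) measure_empty)
open Filter in
theorem chi_incr (hJ : KernelHyp d J α c C) (hP : IsLRP J P) {a b : ℝ} (ha : 0 ≤ a) (hab : a ≤ b) {κ : ℝ≥0∞}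
    (hκ : ∀ t, a ≤ t → t ≤ b → κ ≤ DD J (P t)) : oR (b - a) * κ + chi P a ≤ chi P b := by
  choose g g' h1 h2 h3 using fun n : ℕ => chiD_deriv hJ hP (bx n : FV d) 0
  have hI : ∀ n, ∫⁻ t in Set.Ioc a b, oR (g' n t) = oR (g n b - g n a) := by
    intro n
    have hint : IntegrableOn (g' n) (Set.Ioc a b) := intervalIntegral.integrableOn_deriv_of_nonneg (fun x _ => (h2 n x).continuousAt.continuousWithinAt)
      (fun x _ => h2 n x) fun x hx => (h3 n x (ha.trans hx.1.le)).1
    rw [← ofReal_integral_eq_lintegral_ofReal hint]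
    · rw [← intervalIntegral.integral_of_le hab, intervalIntegral.integral_eq_sub_of_hasDerivAt (fun x _ => h2 n x)]
      exact (intervalIntegrable_iff_integrableOn_Ioc_of_le hab).2 hint
    · exact (ae_restrict_iff' measurableSet_Ioc).2 (ae_of_all _ fun x hx => (h3 n x (ha.trans hx.1.le)).1)
  have hle : oR (b - a) * κ ≤ liminf (fun n => oR (g n b - g n a)) atTop := by
    simp_rw [← hI]
    refine le_trans ?_ (lintegral_liminf_le fun n => ?_)
    · calc oR (b - a) * κ = ∫⁻ t in Set.Ioc a b, κ := by rw [setLIntegral_const, Real.volume_Ioc, mul_comm]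
        _ ≤ _ := setLIntegral_mono' measurableSet_Ioc fun t ht => ?_
      refine (hκ t ht.1.le ht.2).trans ?_
      rw [DD_iSup]
      have ht0 := ha.trans ht.1.le
      have hmono : Monotone fun n : ℕ => ∑' u, ∑' v, ∑' y, oR (J u v) * P t (FF ((bx n : FV d) : SV d) u v y) := by
        intro m n h
        refine ENNReal.tsum_le_tsum fun u => ENNReal.tsum_le_tsum fun v => ENNReal.tsum_le_tsum fun y => mul_le_mul' le_rfl (measure_mono fun ω hω => ?_)
        have hs := Finset.coe_subset.2 (bx_mono (d := d) h)
        exact ⟨hω.1.mono hs, hω.2.1.mono hs, hω.2.2⟩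
      rw [← (tendsto_atTop_iSup hmono).liminf_eq]
      refine liminf_le_liminf (Eventually.of_forall fun n => ?_)
      rw [(h3 n t ht0).2]
      exact HG hJ (P t) _
    · have : g' n = deriv (g n) := funext fun t => ((h2 n t).deriv).symm
      rw [this]
      exact (measurable_deriv _).ennreal_ofReal
  have hchi : chi P a = ⨆ n, oR (g n a) := by
    rw [chi_eq, tsum_tau_iSup]
    exact iSup_congr fun n => (h1 n a ha).2
  have hup : ∀ n, oR (g n b - g n a) + oR (g n a) ≤ chi P b := by
    intro n
    have hmon : g n a ≤ g n b := by
      have h4 : ∑' y, tau (P a) ((bx n : FV d) : SV d) 0 y ≤ ∑' y, tau (P b) ((bx n : FV d) : SV d) 0 y := ENNReal.tsum_le_tsum fun y => tau_mono_beta hJ hP ha hab _ _ _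
      rw [(h1 n a ha).2, (h1 n b (ha.trans hab)).2] at h4
      exact (ofReal_le_ofReal_iff (h1 n b (ha.trans hab)).1).1 h4
    rw [← ofReal_add (by linarith) (h1 n a ha).1, sub_add_cancel, ← (h1 n b (ha.trans hab)).2]
    exact chi_D_le hJ hP (ha.trans hab) _ 0
  have hg : Monotone fun n => oR (g n a) := by
    intro m n h
    simp only [← (h1 _ a ha).2]
    exact ENNReal.tsum_le_tsum fun y => tau_mono_bx _ _ _ h
  rw [hchi, ENNReal.add_iSup]
  refine iSup_le fun n => ?_
  refine le_trans (add_le_add hle le_rfl) ?_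
  rw [liminf_eq_iSup_iInf_of_nat, ENNReal.iSup_add]
  refine iSup_le fun N => le_trans (add_le_add (iInf₂_le (max N n) (le_max_left N n)) (hg (le_max_right N n))) (hup _)
end Integ
end Part17
section Part18
section Final
variable {d : ℕ} {J : V d → V d → ℝ} {α c C : ℝ} {P : ℝ → Measure (Config d)} {β : ℝ}
theorem log_q {s : ℝ} (hs : 1 ≤ s) : (1 + Real.log s) ^ 2 ≤ 16 * √s := by
  obtain ⟨q, hq⟩ : ∃ q, q = √(√s) := ⟨_, rfl⟩
  have h2 : q ^ 2 = √s := by rw [hq, Real.sq_sqrt (Real.sqrt_nonneg s)]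
  have h4 : q ^ 4 = s := by
    have : q ^ 4 = (q ^ 2) ^ 2 := by ring
    rw [this, h2, Real.sq_sqrt (by linarith)]
  have hq0 : 0 < q := by rw [hq]; positivity
  have hl : Real.log s = 4 * Real.log q := by rw [← h4, Real.log_pow]; norm_num
  have h5 := Real.log_le_sub_one_of_pos hq0
  have h6 := Real.log_nonneg hs
  rw [← h2]
  nlinarith
theorem dd_low {X s K L ℓ B t : ℝ} {D : ℝ≥0∞} (hK : 0 < K) (hs : 0 < s) (hsX : s ≤ X) (hL : 0 ≤ L) (hLℓ : L ≤ ℓ) (hℓ : 0 < ℓ) (hs2 : 2 * K * ℓ ^ 2 ≤ s) (hB : 0 < B)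
    (ht : 0 ≤ t) (htB : t ≤ B) (h : oR X * oR X ≤ oR (K * L ^ 2) * (oR X + oR t * D)) :
    oR (s ^ 2 / (2 * K * ℓ ^ 2 * B)) ≤ D := by
  by_cases hD : D = ∞
  · simp [hD]
  obtain ⟨r, hr, rfl⟩ : ∃ r : ℝ, 0 ≤ r ∧ D = oR r := ⟨D.toReal, toReal_nonneg, (ofReal_toReal hD).symm⟩
  have hX : 0 < X := hs.trans_le hsX
  rw [← ofReal_mul hX.le, ← ofReal_mul ht, ← ofReal_add hX.le (by positivity), ← ofReal_mul (by positivity), ofReal_le_ofReal_iff (by positivity)] at h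
  refine ofReal_le_ofReal ?_
  rw [div_le_iff₀ (by positivity)]
  have h1 : X * X ≤ K * ℓ ^ 2 * (X + B * r) := h.trans (by gcongr)
  have h2 : K * ℓ ^ 2 * X ≤ X / 2 * X := mul_le_mul_of_nonneg_right (by linarith) hX.le
  nlinarith
noncomputable def Psi (A s : ℝ) : ℝ := A * (1 + Real.log s) ^ 2 / s
theorem Psi_step {A k s : ℝ} (hk : 0 < k) (hA : A = 5 * k) (hs : 0 < s) (hl : 3 ≤ Real.log s) :
    k * (1 + Real.log (2 * s)) ^ 2 / s + Psi A (2 * s) ≤ Psi A s := by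
  have h2 := Real.log_two_lt_d9
  have h0 : 0 < Real.log 2 := Real.log_pos (by norm_num)
  obtain ⟨l, hll⟩ : ∃ l, l = Real.log s := ⟨_, rfl⟩
  obtain ⟨b, hb⟩ : ∃ b, b = Real.log 2 := ⟨_, rfl⟩
  rw [Psi, Psi, Real.log_mul (by norm_num) hs.ne', hA, ← hll, ← hb]
  rw [← hb] at h2 h0
  rw [← hll] at hl
  have : k * (1 + (b + l)) ^ 2 / s + 5 * k * (1 + (b + l)) ^ 2 / (2 * s) = (k / s) * (7 / 2 * (1 + (b + l)) ^ 2) := by field_simp; ring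
  rw [this]
  have : 5 * k * (1 + l) ^ 2 / s = (k / s) * (5 * (1 + l) ^ 2) := by field_simp
  rw [this]
  refine mul_le_mul_of_nonneg_left ?_ (by positivity)
  nlinarith
theorem descent {X : ℝ → ℝ} {b0 B k X0 A : ℝ} (hmono : ∀ a b, b0 ≤ a → a ≤ b → b < B → X a ≤ X b) (hk : 0 < k) (hA : A = 5 * k) (hX0 : Real.exp 3 ≤ X0)
    (hstep : ∀ s a b, X0 ≤ s → b0 ≤ a → a ≤ b → b < B → s ≤ X a → X b ≤ 2 * s → b - a ≤ k * (1 + Real.log (2 * s)) ^ 2 / s) (n : ℕ) :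
    ∀ s a b, X0 ≤ s → b0 ≤ a → a ≤ b → b < B → s ≤ X a → X b ≤ 2 ^ n * s → b - a ≤ Psi A s := by
  have hpos : ∀ s, X0 ≤ s → 0 < s ∧ 3 ≤ Real.log s := by
    intro s hs
    have h1 : 0 < s := (Real.exp_pos 3).trans_le (hX0.trans hs)
    exact ⟨h1, (Real.le_log_iff_exp_le h1).2 (hX0.trans hs)⟩
  have hA0 : 0 < A := by rw [hA]; positivity
  have hPsi : ∀ s, X0 ≤ s → 0 ≤ Psi A (2 * s) := fun s hs => by have := (hpos s hs).1; unfold Psi; positivity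
  induction n with
  | zero =>
    intro s a b hs ha hab hb h1 h2
    have h3 := hstep s a b hs ha hab hb h1 (by have := (hpos s hs).1; linarith)
    have h4 := Psi_step hk hA (hpos s hs).1 (hpos s hs).2
    linarith [hPsi s hs]
  | succ n ih =>
    intro s a b hs ha hab hb h1 h2
    have hs0 := (hpos s hs).1
    have h4 := Psi_step hk hA hs0 (hpos s hs).2
    by_contra hcon
    push Not at hcon
    obtain ⟨q, hq⟩ : ∃ q, q = k * (1 + Real.log (2 * s)) ^ 2 / s := ⟨_, rfl⟩
    have hq0 : 0 ≤ q := by rw [hq]; positivity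
    have hP := hPsi s hs
    rw [← hq] at h4
    obtain ⟨t, ht1, ht2⟩ : ∃ t, a + q < t ∧ t < b - Psi A (2 * s) := exists_between (by linarith)
    rcases le_total (X t) (2 * s) with h | h
    · have := hstep s a t hs ha (by linarith) (by linarith) h1 h
      linarith
    · have := ih (2 * s) t b (by linarith) (by linarith) (by linarith) hb h (h2.trans_eq (by ring))
      linarith
set_option maxHeartbeats 1600000 in
theorem main (hJ : KernelHyp d J α c C) (hP : IsLRP J P) (hα1 : α < 1) (hα3 : α = (d:ℝ) / 3) :
    ∃ C₁ ε₀ : ℝ, 0 < C₁ ∧ 0 < ε₀ ∧ ∀ ε : ℝ, 0 < ε → ε < ε₀ →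
      oR (C₁⁻¹ * (Real.log (1 / ε) ^ 2)⁻¹ * ε⁻¹) ≤ chi P (betaC P - ε) ∧
      chi P (betaC P - ε) ≤ oR (C₁ * Real.log (1 / ε) ^ 2 * ε⁻¹) := by
  obtain ⟨A0, hA0, hAinf, -⟩ := F_bound hJ hP
  have hne : ∃ b, 0 ≤ b ∧ Perc P b := ⟨A0 + 1, by linarith, dct hJ hP hA0 (by linarith) hAinf⟩
  obtain ⟨j, hj⟩ : ∃ j, j = (JJ J).toReal := ⟨_, rfl⟩
  have hj0 : 0 ≤ j := hj ▸ toReal_nonneg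
  obtain ⟨X, hX⟩ : ∃ X : ℝ → ℝ, X = fun t => (chi P t).toReal := ⟨_, rfl⟩
  have hXn : ∀ t, 0 ≤ X t := fun t => by rw [hX]; exact toReal_nonneg
  have hgap : ∀ t δ, 0 ≤ t → chi P t ≠ ∞ → 0 ≤ δ → 4 * j * X t * δ < 1 → t + δ ≤ betaC P := by
    intro t δ h1 h2 h3 h4
    rw [hj, hX] at h4
    exact betaC_gap hJ hP hne h1 h2 h3 h4
  obtain ⟨B, hB⟩ : ∃ B, B = betaC P := ⟨_, rfl⟩
  rw [← hB] at hgap ⊢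
  have hB0 : 0 < B := by
    have h0 := hXn 0
    have hp : 0 < 4 * j * X 0 + 1 := by positivity
    have := hgap 0 (1 / (4 * j * X 0 + 1)) le_rfl (chi_zero_fin hJ hP) (by positivity) (by rw [mul_one_div, div_lt_one hp]; linarith)
    have : 0 < 1 / (4 * j * X 0 + 1) := by positivity
    linarith
  have hfin : ∀ t, 0 ≤ t → t < B → chi P t ≠ ∞ := fun t h1 h2 => chi_fin hJ hP h1 (hB ▸ h2)
  have hofX : ∀ t, 0 ≤ t → t < B → chi P t = oR (X t) := fun t h1 h2 => by rw [hX]; exact (ofReal_toReal (hfin t h1 h2)).symm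
  have hX1 : ∀ t, 0 ≤ t → t < B → 1 ≤ X t := by
    intro t h1 h2
    have := one_le_chi hJ hP h1
    rw [hofX t h1 h2, ← ofReal_one, ofReal_le_ofReal_iff (hXn t)] at this
    exact this
  obtain ⟨M, hM, hlog⟩ := log_bounds hJ hP hα1 hα3 (half_pos hB0)
  obtain ⟨K, hK⟩ : ∃ K, K = M + 2 * M ^ 2 := ⟨_, rfl⟩
  have hK0 : 0 < K := by rw [hK]; positivity
  have hdd : ∀ t, B / 2 ≤ t → t < B → oR (X t) * oR (X t) ≤ oR (K * (1 + Real.log (X t)) ^ 2) * (oR (X t) + oR t * DD J (P t)) := by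
    intro t h1 h2
    have ht0 : 0 ≤ t := by linarith
    obtain ⟨e1, e2⟩ := hlog t h1 (hfin t ht0 h2)
    have hl : 0 ≤ Real.log (X t) := Real.log_nonneg (hX1 t ht0 h2)
    have hxt : (chi P t).toReal = X t := by rw [hX]
    rw [hxt] at e1 e2
    rw [← hofX t ht0 h2]
    refine dstep hJ hP ht0 (hfin t ht0 h2) e1 (by positivity) ?_
    refine (add_le_add e2 le_rfl).trans ?_
    rw [show (2 : ℝ≥0∞) = oR 2 by simp, ← ofReal_mul (by positivity), ← ofReal_mul (by norm_num), ← ofReal_add (by positivity) (by positivity)]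
    refine ofReal_le_ofReal ?_
    rw [hK]
    nlinarith [mul_nonneg hM.le hl, mul_nonneg (mul_nonneg hM.le hl) hl]
  obtain ⟨X0, hX0⟩ : ∃ X0, X0 = Real.exp 3 + 2048 * K ^ 2 := ⟨_, rfl⟩
  have he3 : 1 ≤ Real.exp 3 := Real.one_le_exp (by norm_num)
  have hX0p : 1 ≤ X0 := by rw [hX0]; nlinarith [sq_nonneg K]
  obtain ⟨k, hk⟩ : ∃ k, k = 2 * K * B := ⟨_, rfl⟩
  have hk0 : 0 < k := by rw [hk]; positivity
  have hmono : ∀ a b, B / 2 ≤ a → a ≤ b → b < B → X a ≤ X b := by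
    intro a b h1 h2 h3
    have := chi_mono hJ hP (by linarith : (0:ℝ) ≤ a) h2
    rw [hofX a (by linarith) (by linarith), hofX b (by linarith) h3] at this
    exact (ofReal_le_ofReal_iff (hXn b)).1 this
  have hstep : ∀ s a b, X0 ≤ s → B / 2 ≤ a → a ≤ b → b < B → s ≤ X a → X b ≤ 2 * s → b - a ≤ k * (1 + Real.log (2 * s)) ^ 2 / s := by
    intro s a b hs ha hab hb h1 h2
    have hs1 : 1 ≤ s := hX0p.trans hs
    have hl0 : 0 ≤ Real.log (2 * s) := Real.log_nonneg (by linarith)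
    obtain ⟨ℓ, hℓ⟩ : ∃ ℓ, ℓ = 1 + Real.log (2 * s) := ⟨_, rfl⟩
    have hℓ0 : 0 < ℓ := by rw [hℓ]; linarith
    have hs2 : 2 * K * ℓ ^ 2 ≤ s := by
      have h3 := log_q (s := 2 * s) (by linarith)
      rw [← hℓ] at h3
      have h4 : √(2 * s) * √(2 * s) = 2 * s := Real.mul_self_sqrt (by linarith)
      have h5 : 64 * K ≤ √(2 * s) := Real.le_sqrt_of_sq_le (by nlinarith)
      have h6 : 0 ≤ √(2 * s) := Real.sqrt_nonneg _
      have : 2 * K * ℓ ^ 2 ≤ 2 * K * (16 * √(2 * s)) := mul_le_mul_of_nonneg_left h3 (by positivity)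
      nlinarith
    have key := chi_incr hJ hP (by linarith : (0:ℝ) ≤ a) hab (κ := oR (s ^ 2 / (2 * K * ℓ ^ 2 * B))) (fun t h3 h4 => by
      have hat := hmono a t ha h3 (by linarith)
      have htb := hmono t b (by linarith) h4 hb
      have hXt := hX1 t (by linarith) (by linarith)
      refine dd_low hK0 (by linarith) (h1.trans hat) (L := 1 + Real.log (X t)) (by linarith [Real.log_nonneg hXt]) ?_ hℓ0 hs2 hB0 (by linarith) (by linarith) (hdd t (by linarith) (by linarith))
      rw [hℓ]
      linarith [Real.log_le_log (by linarith) (htb.trans h2)])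
    rw [hofX a (by linarith) (by linarith), hofX b (by linarith) hb, ← ofReal_mul (by linarith), ← ofReal_add (mul_nonneg (by linarith) (by positivity)) (hXn a), ofReal_le_ofReal_iff (hXn b)] at key
    rw [← hℓ, le_div_iff₀ (by linarith), hk]
    have h7 : (b - a) * (s ^ 2 / (2 * K * ℓ ^ 2 * B)) ≤ s := by linarith
    rw [mul_div_assoc', div_le_iff₀ (by positivity)] at h7
    have : s * ((b - a) * s) ≤ s * (2 * K * B * ℓ ^ 2) := by nlinarith
    exact le_of_mul_le_mul_left this (by linarith)
  obtain ⟨A, hA⟩ : ∃ A, A = 5 * k := ⟨_, rfl⟩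
  have hApos : 0 < A := by rw [hA]; positivity
  have hX0e : Real.exp 3 ≤ X0 := by rw [hX0]; nlinarith [sq_nonneg K]
  refine ⟨4 * (j + 1) + 25 * A, min (min (B / 2) (Real.exp (-1))) (min (1 / (16 * A)) (1 / (4 * (j + 1) * X0))), by positivity, by positivity, ?_⟩
  intro ε hε hε0
  obtain ⟨⟨h1, h2⟩, h3, h4⟩ : (ε < B / 2 ∧ ε < Real.exp (-1)) ∧ ε < 1 / (16 * A) ∧ ε < 1 / (4 * (j + 1) * X0) := by simpa [lt_min_iff] using hε0
  have hβ0 : 0 ≤ B - ε := by linarith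
  have hβB : B - ε < B := by linarith
  obtain ⟨s, hs⟩ : ∃ s, s = X (B - ε) := ⟨_, rfl⟩
  have hs1 : 1 ≤ s := hs ▸ hX1 _ hβ0 hβB
  have hlow : 1 ≤ 4 * (j + 1) * s * ε := by
    by_contra hcon
    push Not at hcon
    obtain ⟨δ, hδ1, hδ2⟩ : ∃ δ, ε < δ ∧ δ < 1 / (4 * (j + 1) * s) := exists_between (by rw [lt_div_iff₀ (by positivity)]; linarith)
    rw [lt_div_iff₀ (by positivity)] at hδ2
    have hδ0 : 0 < δ := hε.trans hδ1
    have := hgap (B - ε) δ hβ0 (hfin _ hβ0 hβB) hδ0.le (by rw [← hs]; nlinarith [mul_pos (show 0 < s by linarith) hδ0])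
    linarith
  have hsX0 : X0 ≤ s := by
    rw [lt_div_iff₀ (by positivity)] at h4
    have : ε * (4 * (j + 1)) * X0 ≤ ε * (4 * (j + 1)) * s := by nlinarith
    exact le_of_mul_le_mul_left this (by positivity)
  have hPsi : ε ≤ Psi A s := by
    refine le_of_forall_lt_imp_le_of_dense fun r hr => ?_
    rcases le_or_gt r 0 with hr0 | hr0
    · exact hr0.trans (by unfold Psi; positivity)
    obtain ⟨n, hn⟩ := pow_unbounded_of_one_lt (X (B - ε + r)) (by norm_num : (1:ℝ) < 2)
    have := descent hmono hk0 hA hX0e hstep n s (B - ε) (B - ε + r) hsX0 (by linarith) (by linarith) (by linarith) hs.le (hn.le.trans (by nlinarith [pow_pos (by norm_num : (0:ℝ) < 2) n]))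
    linarith
  have hLe : 1 ≤ Real.log (1 / ε) := by
    rw [one_div, Real.log_inv]
    have := Real.log_le_log hε h2.le
    rw [Real.log_exp] at this
    linarith
  obtain ⟨L, hL⟩ : ∃ L, L = Real.log (1 / ε) := ⟨_, rfl⟩
  have hlogs : Real.log s ≤ 4 * L := by
    have hq := log_q hs1
    have hss : √s * √s = s := Real.mul_self_sqrt (by linarith)
    have hsq : 0 < √s := Real.sqrt_pos.2 (by linarith)
    rw [Psi, le_div_iff₀ (by linarith)] at hPsi
    have e1 : ε * √s * √s ≤ 16 * A * √s := by
      calc ε * √s * √s = ε * s := by rw [mul_assoc, hss]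
        _ ≤ _ := hPsi
        _ ≤ A * (16 * √s) := mul_le_mul_of_nonneg_left hq hApos.le
        _ = _ := by ring
    have e2 : ε * √s ≤ 16 * A := le_of_mul_le_mul_right e1 hsq
    rw [lt_div_iff₀ (by positivity)] at h3
    have e3 : √s ≤ (1 / ε) ^ 2 := by
      rw [div_pow, one_pow, le_div_iff₀ (by positivity)]
      calc √s * ε ^ 2 = ε * (ε * √s) := by ring
        _ ≤ ε * (16 * A) := mul_le_mul_of_nonneg_left e2 hε.le
        _ ≤ 1 := h3.le
    have e4 : s ≤ (1 / ε) ^ 4 := by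
      rw [← hss]
      calc √s * √s ≤ (1 / ε) ^ 2 * (1 / ε) ^ 2 := mul_le_mul e3 e3 hsq.le (by positivity)
        _ = _ := by ring
    have := Real.log_le_log (by linarith) e4
    rw [Real.log_pow, ← hL] at this
    exact_mod_cast this
  rw [hofX _ hβ0 hβB, ← hs, ← hL]
  rw [← hL] at hLe
  constructor
  · refine ofReal_le_ofReal ?_
    rw [← mul_inv, ← mul_inv, inv_le_iff_one_le_mul₀ (by positivity)]
    have hL2 : 1 ≤ L ^ 2 := one_le_pow₀ hLe
    have : 4 * (j + 1) * s * ε * 1 ≤ s * ((4 * (j + 1) + 25 * A) * L ^ 2 * ε) := by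
      have : s * ((4 * (j + 1) + 25 * A) * L ^ 2 * ε) = (s * ε * (4 * (j + 1) + 25 * A)) * L ^ 2 := by ring
      rw [this]
      refine mul_le_mul ?_ hL2 (by norm_num) (by positivity)
      nlinarith [mul_pos (mul_pos (show 0 < s by linarith) hε) hApos]
    linarith
  · refine ofReal_le_ofReal ?_
    rw [Psi, le_div_iff₀ (by linarith)] at hPsi
    rw [← div_eq_mul_inv, le_div_iff₀ hε]
    have h0 := Real.log_nonneg hs1
    have e5 : (1 + Real.log s) ^ 2 ≤ (5 * L) ^ 2 := pow_le_pow_left₀ (by linarith) (by linarith) 2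
    have e6 := mul_le_mul_of_nonneg_left e5 hApos.le
    nlinarith [mul_nonneg (show 0 ≤ 4 * (j + 1) by positivity) (sq_nonneg L)]
end Final
end Part18

/-- If `d ∈ {1, 2}` and `α = d/3` then the susceptibility is mean-field to within a
polylogarithmic factor near criticality. -/
theorem susceptibility_polylog {d : ℕ} {J : V d → V d → ℝ} {α c C : ℝ}
    (hJ : KernelHyp d J α c C)
    (P : ℝ → Measure (Config d)) (hP : IsLRP J P)
    (hd : d = 1 ∨ d = 2) (hα : α = (d : ℝ) / 3) :
    ∃ C₁ ε₀ : ℝ, 0 < C₁ ∧ 0 < ε₀ ∧ ∀ ε : ℝ, 0 < ε → ε < ε₀ →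
      ENNReal.ofReal (C₁⁻¹ * (Real.log (1 / ε) ^ 2)⁻¹ * ε⁻¹) ≤ chi P (betaC P - ε) ∧
      chi P (betaC P - ε) ≤ ENNReal.ofReal (C₁ * Real.log (1 / ε) ^ 2 * ε⁻¹) := by
  exact main hJ hP (by rcases hd with rfl | rfl <;> rw [hα] <;> norm_num) hα

end LRP
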